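/- Let D be a disk in ℝ², let p ∈ (1,∞), and let a, b with ∇a ∈ L^{2,∞}(D) and ∇b ∈ L^p(D). Let φ solve Δφ = ∇^⊥a · ∇b in D with φ = 0 on ∂D. Then ‖∇φ‖_{L^p(D)} ≤ C_p ‖∇a‖_{L^{2,∞}(D)} ‖∇b‖_{L^p(D)}, where the constant C_p can be chosen uniformly for p in any compact subinterval [p₀, p₁] ⊂ (1,∞). -/

import Mathlib

open MeasureTheory Metric Real
open scoped ENNReal NNReal RealInnerProductSpace

noncomputable section

abbrev E2 := EuclideanSpace ℝ (Fin 2)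
abbrev E3 := EuclideanSpace ℝ (Fin 3)

/-- `i`-th partial derivative. -/
def pd {F : Type*} [NormedAddCommGroup F] [NormedSpace ℝ F]
    (i : Fin 2) (f : E2 → F) (x : E2) : F :=
  fderiv ℝ f x (EuclideanSpace.single i 1)

/-- Laplacian on `ℝ²`. -/
def lap {F : Type*} [NormedAddCommGroup F] [NormedSpace ℝ F]
    (f : E2 → F) (x : E2) : F :=
  pd 0 (pd 0 f) x + pd 1 (pd 1 f) x

/-- cross product in `ℝ³`. -/
def cross3 (u v : E3) : E3 :=
  (WithLp.equiv 2 (Fin 3 → ℝ)).symm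
    (crossProduct (WithLp.equiv 2 (Fin 3 → ℝ) u) (WithLp.equiv 2 (Fin 3 → ℝ) v))

/-- weak `L^p` (Marcinkiewicz) quasinorm of `f` on the set `s`. -/
def wnorm (p : ℝ) (f : E2 → ℝ) (s : Set E2) : ℝ≥0∞ :=
  ⨆ t : ℝ≥0, (t : ℝ≥0∞) * (volume {x ∈ s | (t : ℝ) < |f x|}) ^ (1 / p)

/-- Lorentz `L^{p,q}` quasinorm (with `q = ∞` giving weak `L^p`). -/
def lorentzNorm (p : ℝ) (q : ℝ≥0∞) (f : E2 → ℝ) (s : Set E2) : ℝ≥0∞ :=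
  if q = ⊤ then wnorm p f s
  else (∫⁻ t in Set.Ioi (0 : ℝ),
    (ENNReal.ofReal t * (volume {x ∈ s | t < |f x|}) ^ (1 / p)) ^ q.toReal
      / ENNReal.ofReal t) ^ (1 / q.toReal)

section

open MeasureTheory Metric Real Set Filter Topology
open scoped ENNReal NNReal

namespace WenteDisk

theorem volume_ball_eq (x : ℂ) {ρ : ℝ} (hρ : 0 ≤ ρ) :
    volume (ball x ρ) = ENNReal.ofReal (π * ρ ^ 2) := by
  rw [Complex.volume_ball, mul_comm π, ENNReal.ofReal_mul (by positivity), ENNReal.ofReal_pow hρ,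
    ← NNReal.coe_real_pi, ENNReal.ofReal_coe_nnreal]

theorem volume_closedBall_eq (x : ℂ) {ρ : ℝ} (hρ : 0 ≤ ρ) :
    volume (closedBall x ρ) = ENNReal.ofReal (π * ρ ^ 2) := by
  rw [Complex.volume_closedBall, mul_comm π, ENNReal.ofReal_mul (by positivity),
    ENNReal.ofReal_pow hρ, ← NNReal.coe_real_pi, ENNReal.ofReal_coe_nnreal]

/-- Vitali covering lemma for balls of bounded radius in the plane. -/
theorem exists_disjoint_ball_cover (S : Set ℂ) (ρ : ℂ → ℝ) (R : ℝ) (hpos : ∀ x ∈ S, 0 < ρ x)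
    (hR : ∀ x ∈ S, ρ x ≤ R) :
    ∃ u ⊆ S, u.Countable ∧ u.PairwiseDisjoint (fun x => ball x (ρ x)) ∧
      S ⊆ ⋃ x ∈ u, closedBall x (5 * ρ x) := by
  obtain ⟨u, hu, hd, hc⟩ := Vitali.exists_disjoint_subfamily_covering_enlargement_closedBall
    S id ρ R hR 5 (by norm_num)
  have hd' : u.PairwiseDisjoint (fun x => ball x (ρ x)) := fun x hx y hy hxy =>
    (hd hx hy hxy).mono ball_subset_closedBall ball_subset_closedBall
  refine ⟨u, hu, ?_, hd', fun x hx => ?_⟩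
  · refine hd'.countable_of_isOpen (fun _ _ => isOpen_ball) fun x hx => ?_
    exact nonempty_ball.2 (hpos x (hu hx))
  · obtain ⟨b, hb, hxb⟩ := hc x hx
    exact mem_biUnion hb (hxb (mem_closedBall_self (hpos x hx).le))

/-- If the mass of `g` in a ball exceeds `t ρ²`, half of it sits where `g > t / 8`. -/
theorem mass_le_two_mul_superlevel {μ : Measure ℂ} (hμ : μ ≤ volume) {g : ℂ → ℝ≥0∞}
    (hg : Measurable g) {x : ℂ} {ρ t : ℝ} (hρ : 0 < ρ) (ht : 0 < t)
    (h : ENNReal.ofReal (t * ρ ^ 2) < ∫⁻ y in ball x ρ, g y ∂μ) :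
    ENNReal.ofReal (t * ρ ^ 2) ≤
      2 * ∫⁻ y in ball x ρ ∩ {y | ENNReal.ofReal (t / 8) < g y}, g y ∂μ := by
  have hm : MeasurableSet {y | ENNReal.ofReal (t / 8) < g y} := measurableSet_lt measurable_const hg
  set Z := ∫⁻ y in ball x ρ ∩ {y | ENNReal.ofReal (t / 8) < g y}, g y ∂μ
  have h1 : ∫⁻ y in ball x ρ, g y ∂μ = Z +
      ∫⁻ y in ball x ρ \ {y | ENNReal.ofReal (t / 8) < g y}, g y ∂μ :=
    (lintegral_inter_add_sdiff _ _ hm).symm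
  have h2 : ∫⁻ y in ball x ρ \ {y | ENNReal.ofReal (t / 8) < g y}, g y ∂μ ≤
      ENNReal.ofReal (t * ρ ^ 2 / 2) := by
    calc ∫⁻ y in ball x ρ \ {y | ENNReal.ofReal (t / 8) < g y}, g y ∂μ
        ≤ ∫⁻ y in ball x ρ \ {y | ENNReal.ofReal (t / 8) < g y}, ENNReal.ofReal (t / 8) ∂μ := by
          refine setLIntegral_mono measurable_const fun y hy => ?_
          simpa using hy.2
      _ = ENNReal.ofReal (t / 8) * μ (ball x ρ \ {y | ENNReal.ofReal (t / 8) < g y}) := by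
          rw [setLIntegral_const]
      _ ≤ ENNReal.ofReal (t / 8) * ENNReal.ofReal (π * ρ ^ 2) := by
          gcongr
          rw [← volume_ball_eq x hρ.le]
          exact (measure_mono Set.sdiff_subset).trans (hμ _)
      _ ≤ _ := by
          rw [← ENNReal.ofReal_mul (by positivity)]
          apply ENNReal.ofReal_le_ofReal
          nlinarith [pi_lt_four, mul_pos ht (pow_pos hρ 2)]
  have hZ : ENNReal.ofReal (t * ρ ^ 2) ≤ Z + ENNReal.ofReal (t * ρ ^ 2 / 2) :=
    (h.le.trans_eq h1).trans (by gcongr)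
  have e : ENNReal.ofReal (t * ρ ^ 2) =
      ENNReal.ofReal (t * ρ ^ 2 / 2) + ENNReal.ofReal (t * ρ ^ 2 / 2) := by
    rw [← ENNReal.ofReal_add (by positivity) (by positivity)]; congr 1; ring
  have : ENNReal.ofReal (t * ρ ^ 2 / 2) ≤ Z := by
    rw [e] at hZ
    exact (ENNReal.add_le_add_iff_right ENNReal.ofReal_ne_top).1 hZ
  rw [e, two_mul]; gcongr

/-- Centred Hardy–Littlewood maximal function in the plane (normalised by `ρ²`). -/
noncomputable def maxFn (g : ℂ → ℝ≥0∞) (x : ℂ) : ℝ≥0∞ :=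
  ⨆ (ρ : ℝ) (_ : 0 < ρ), (ENNReal.ofReal (ρ ^ 2))⁻¹ * ∫⁻ y in ball x ρ, g y

theorem lintegral_ball_le_maxFn (g : ℂ → ℝ≥0∞) (x : ℂ) {ρ : ℝ} (hρ : 0 < ρ) :
    ∫⁻ y in ball x ρ, g y ≤ ENNReal.ofReal (ρ ^ 2) * maxFn g x := by
  have h : (ENNReal.ofReal (ρ ^ 2))⁻¹ * ∫⁻ y in ball x ρ, g y ≤ maxFn g x :=
    le_iSup₂ (f := fun (ρ : ℝ) (_ : 0 < ρ) => (ENNReal.ofReal (ρ ^ 2))⁻¹ * ∫⁻ y in ball x ρ, g y)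
      ρ hρ
  have h0 : ENNReal.ofReal (ρ ^ 2) ≠ 0 := by
    rw [Ne, ENNReal.ofReal_eq_zero, not_le]; positivity
  calc ∫⁻ y in ball x ρ, g y
      = ENNReal.ofReal (ρ ^ 2) * ((ENNReal.ofReal (ρ ^ 2))⁻¹ * ∫⁻ y in ball x ρ, g y) := by
        rw [← mul_assoc, ENNReal.mul_inv_cancel h0 ENNReal.ofReal_ne_top, one_mul]
    _ ≤ _ := by gcongr

/-- Weak-type estimate for the maximal function, localised to a superlevel set. -/
theorem volume_lt_maxFn_le {g : ℂ → ℝ≥0∞} (hg : Measurable g) (hgi : ∫⁻ y, g y ≠ ⊤) {t : ℝ}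
    (ht : 0 < t) :
    volume {x | ENNReal.ofReal t < maxFn g x} ≤
      ENNReal.ofReal (200 / t) * ∫⁻ y in {y | ENNReal.ofReal (t / 8) < g y}, g y := by
  set S := {x | ENNReal.ofReal t < maxFn g x}
  have hex : ∀ x ∈ S, ∃ ρ : ℝ, 0 < ρ ∧ ENNReal.ofReal (t * ρ ^ 2) < ∫⁻ y in ball x ρ, g y := by
    intro x hx
    obtain ⟨ρ, hρ⟩ := lt_iSup_iff.1 (show ENNReal.ofReal t < maxFn g x from hx)
    obtain ⟨hρ0, hρ⟩ := lt_iSup_iff.1 hρ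
    refine ⟨ρ, hρ0, ?_⟩
    have h0 : ENNReal.ofReal (ρ ^ 2) ≠ 0 := by
      rw [Ne, ENNReal.ofReal_eq_zero, not_le]; positivity
    rw [ENNReal.ofReal_mul ht.le]
    rw [mul_comm, ← div_eq_mul_inv] at hρ
    exact ENNReal.mul_lt_of_lt_div hρ
  choose! ρ hρ0 hρ using hex
  have hR : ∀ x ∈ S, ρ x ≤ √((∫⁻ y, g y).toReal / t) := by
    intro x hx
    apply Real.le_sqrt_of_sq_le
    rw [le_div_iff₀ ht, mul_comm, ← ENNReal.ofReal_le_iff_le_toReal hgi]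
    exact (hρ x hx).le.trans (setLIntegral_le_lintegral _ _)
  obtain ⟨u, huS, huc, hud, hcov⟩ := exists_disjoint_ball_cover S ρ _ hρ0 hR
  set L := {y | ENNReal.ofReal (t / 8) < g y}
  have hL : MeasurableSet L := measurableSet_lt measurable_const hg
  have : Countable u := huc.to_subtype
  calc volume S ≤ ∑' x : u, volume (closedBall (x : ℂ) (5 * ρ x)) := by
        refine (measure_mono hcov).trans ?_
        rw [biUnion_eq_iUnion]
        exact measure_iUnion_le _
    _ ≤ ∑' x : u, ENNReal.ofReal (200 / t) * ∫⁻ y in ball (x : ℂ) (ρ x) ∩ L, g y := by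
        refine ENNReal.tsum_le_tsum fun x => ?_
        have hx := huS x.2
        have h1 := mass_le_two_mul_superlevel le_rfl hg (hρ0 x hx) ht (hρ x hx)
        rw [volume_closedBall_eq _ (by have := hρ0 x hx; positivity)]
        calc ENNReal.ofReal (π * (5 * ρ x) ^ 2)
            ≤ ENNReal.ofReal (100 / t) * ENNReal.ofReal (t * ρ x ^ 2) := by
              rw [← ENNReal.ofReal_mul (by positivity)]
              apply ENNReal.ofReal_le_ofReal
              rw [show 100 / t * (t * ρ x ^ 2) = 100 * ρ x ^ 2 by field_simp]
              nlinarith [pi_lt_four, sq_nonneg (ρ x)]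
          _ ≤ ENNReal.ofReal (100 / t) * (2 * ∫⁻ y in ball (x : ℂ) (ρ x) ∩ L, g y) := by gcongr
          _ = _ := by
              rw [← mul_assoc, show (200 : ℝ) / t = 100 / t * 2 by ring,
                ENNReal.ofReal_mul (by positivity)]
              simp
    _ = ENNReal.ofReal (200 / t) * ∫⁻ y in ⋃ x : u, ball (x : ℂ) (ρ x) ∩ L, g y := by
        rw [ENNReal.tsum_mul_left, lintegral_iUnion]
        · exact fun x => measurableSet_ball.inter hL
        · intro x y hxy
          exact (hud x.2 y.2 (fun h => hxy (Subtype.ext h))).mono inter_subset_left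
            inter_subset_left
    _ ≤ _ := by
        gcongr
        exact iUnion_subset fun x => inter_subset_right

section

/-- A bounded open set of diameter at most `d` in which every ball centred in the set and of radius
at most `d` fills a fixed proportion `κ`. -/
structure IsThick (Ω : Set ℂ) (d κ : ℝ) : Prop where
  isOpen : IsOpen Ω
  diam_pos : 0 < d
  ratio_pos : 0 < κ
  subset_ball : ∀ x ∈ Ω, Ω ⊆ ball x d
  le_volume : ∀ x ∈ Ω, ∀ ρ, 0 < ρ → ρ ≤ d → ENNReal.ofReal (κ * ρ ^ 2) ≤ volume (ball x ρ ∩ Ω)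

variable {E : Type*} [NormedAddCommGroup E]

theorem exists_stopping_radius {Ω : Set ℂ} {d κ : ℝ} (hΩ : IsThick Ω d κ) {F : ℂ → E}
    (hF : ContinuousOn F Ω) {l : ℝ} (hl : 0 < l)
    (hI : ∫⁻ y in Ω, ‖F y‖ₑ < ENNReal.ofReal (l * d ^ 2)) {x : ℂ} (hx : x ∈ Ω)
    (hFx : ENNReal.ofReal (144 / κ * l) < ‖F x‖ₑ) :
    ∃ ρ, 0 < ρ ∧ ρ ≤ d ∧ ENNReal.ofReal (l * ρ ^ 2) < ∫⁻ y in ball x ρ ∩ Ω, ‖F y‖ₑ ∧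
      ∫⁻ y in ball x (6 * ρ) ∩ Ω, ‖F y‖ₑ ≤ ENNReal.ofReal (36 * l * ρ ^ 2) := by
  have hd := hΩ.diam_pos
  have hκ := hΩ.ratio_pos
  set P := {ρ : ℝ | 0 < ρ ∧ ENNReal.ofReal (l * ρ ^ 2) < ∫⁻ y in ball x ρ ∩ Ω, ‖F y‖ₑ}
  have hPd : ∀ ρ ∈ P, ρ ≤ d := by
    rintro ρ ⟨h0, h⟩
    by_contra! hlt
    have h1 : ∫⁻ y in ball x ρ ∩ Ω, ‖F y‖ₑ < ENNReal.ofReal (l * d ^ 2) :=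
      (lintegral_mono_set inter_subset_right).trans_lt hI
    have h2 := (ENNReal.ofReal_lt_ofReal_iff (by positivity)).1 (h.trans h1)
    nlinarith [pow_le_pow_left₀ hd.le hlt.le 2]
  have hPne : P.Nonempty := by
    have hev : ∀ᶠ y in 𝓝 x, ENNReal.ofReal (144 / κ * l) < ‖F y‖ₑ ∧ y ∈ Ω := by
      have hc : ContinuousAt (fun y => ‖F y‖ₑ) x :=
        (hF.continuousAt (hΩ.isOpen.mem_nhds hx)).enorm
      exact (hc.eventually (lt_mem_nhds hFx)).and (hΩ.isOpen.mem_nhds hx)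
    obtain ⟨r, hr, hball⟩ := Metric.eventually_nhds_iff_ball.1 hev
    refine ⟨min r d, lt_min hr hd, ?_⟩
    have hm : 0 < min r d := lt_min hr hd
    calc ENNReal.ofReal (l * min r d ^ 2)
        < ENNReal.ofReal (144 / κ * l) * ENNReal.ofReal (κ * min r d ^ 2) := by
          rw [← ENNReal.ofReal_mul (by positivity)]
          apply (ENNReal.ofReal_lt_ofReal_iff (by positivity)).2
          rw [show 144 / κ * l * (κ * min r d ^ 2) = 144 * (l * min r d ^ 2) by field_simp]
          nlinarith [mul_pos hl (pow_pos hm 2)]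
      _ ≤ ENNReal.ofReal (144 / κ * l) * volume (ball x (min r d) ∩ Ω) := by
          gcongr; exact hΩ.le_volume x hx _ hm (min_le_right _ _)
      _ = ∫⁻ y in ball x (min r d) ∩ Ω, ENNReal.ofReal (144 / κ * l) := by rw [setLIntegral_const]
      _ ≤ _ := by
          refine setLIntegral_mono' (measurableSet_ball.inter hΩ.isOpen.measurableSet) ?_
          exact fun y hy => (hball y (ball_subset_ball (min_le_left _ _) hy.1)).1.le
  have hbdd : BddAbove P := ⟨d, hPd⟩
  obtain ⟨ρ0, hρ0⟩ := hPne
  have hs0 : 0 < sSup P := hρ0.1.trans_le (le_csSup hbdd hρ0)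
  obtain ⟨ρ, hρP, hρ⟩ := exists_lt_of_lt_csSup ⟨ρ0, hρ0⟩ (show sSup P / 2 < sSup P by linarith)
  refine ⟨ρ, hρP.1, hPd ρ hρP, hρP.2, ?_⟩
  by_contra! hlt
  have : 6 * ρ ∈ P := by
    refine ⟨by linarith [hρP.1], ?_⟩
    convert hlt using 2
    ring
  have := le_csSup hbdd this
  linarith [hρP.1]

theorem level_ball_le {Ω : Set ℂ} {d κ : ℝ} (hΩ : IsThick Ω d κ) {F : ℂ → E}
    (hFm : StronglyMeasurable F)
    {H : ℂ → ℝ≥0∞}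
    (hosc : ∀ x ∈ Ω, ∀ ρ, 0 < ρ → ρ ≤ d → ∃ c : E, ∀ y ∈ ball x ρ ∩ Ω,
      ∫⁻ z in ball x ρ ∩ Ω, ‖F z - c‖ₑ ≤ ENNReal.ofReal (ρ ^ 2) * H y)
    {l γ : ℝ} (hl : 0 < l) (hγ : 0 < γ) (hγ1 : γ ≤ 1) {x : ℂ} (hx : x ∈ Ω) {ρ : ℝ} (hρ : 0 < ρ)
    (hρd : ρ ≤ d) (h1 : ENNReal.ofReal (l * ρ ^ 2) < ∫⁻ y in ball x ρ ∩ Ω, ‖F y‖ₑ)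
    (h6 : ∫⁻ y in ball x (6 * ρ) ∩ Ω, ‖F y‖ₑ ≤ ENNReal.ofReal (36 * l * ρ ^ 2)) :
    ∫⁻ y in ball x (6 * ρ) ∩ (Ω ∩ {y | ENNReal.ofReal (144 / κ * l) < ‖F y‖ₑ}), ‖F y‖ₑ ≤
      ENNReal.ofReal (36 / κ * l) *
        volume (ball x ρ ∩ (Ω ∩ {y | ENNReal.ofReal (γ * l) < H y})) +
      ENNReal.ofReal (144 * γ) *
        ∫⁻ y in ball x ρ ∩ (Ω ∩ {y | ENNReal.ofReal (l / 8) < ‖F y‖ₑ}), ‖F y‖ₑ := by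
  have hd := hΩ.diam_pos
  have hκ := hΩ.ratio_pos
  have hΩm := hΩ.isOpen.measurableSet
  have hum : Measurable fun y => ‖F y‖ₑ := hFm.enorm
  set S := Ω ∩ {y | ENNReal.ofReal (144 / κ * l) < ‖F y‖ₑ}
  have hSm : MeasurableSet S := hΩm.inter (measurableSet_lt measurable_const hum)
  by_cases hbad : ball x ρ ∩ Ω ⊆ {y | ENNReal.ofReal (γ * l) < H y}
  · refine le_add_right ?_
    have e : ball x ρ ∩ (Ω ∩ {y | ENNReal.ofReal (γ * l) < H y}) = ball x ρ ∩ Ω := by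
      rw [← inter_assoc]; exact inter_eq_left.2 hbad
    rw [e]
    calc ∫⁻ y in ball x (6 * ρ) ∩ S, ‖F y‖ₑ ≤ ∫⁻ y in ball x (6 * ρ) ∩ Ω, ‖F y‖ₑ :=
          lintegral_mono_set (inter_subset_inter_right _ inter_subset_left)
      _ ≤ _ := h6
      _ = ENNReal.ofReal (36 / κ * l) * ENNReal.ofReal (κ * ρ ^ 2) := by
          rw [← ENNReal.ofReal_mul (by positivity)]; congr 1; field_simp
      _ ≤ _ := by gcongr; exact hΩ.le_volume x hx ρ hρ hρd
  · refine le_add_left ?_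
    obtain ⟨y, hy, hHy⟩ := not_subset.1 hbad
    replace hHy : H y ≤ ENNReal.ofReal (γ * l) := not_lt.1 hHy
    obtain ⟨c, hc⟩ : ∃ c : E, ∫⁻ z in ball x (6 * ρ) ∩ Ω, ‖F z - c‖ₑ ≤
        ENNReal.ofReal (36 * ρ ^ 2) * H y := by
      rcases le_total (6 * ρ) d with h | h
      · obtain ⟨c, hc⟩ := hosc x hx (6 * ρ) (by positivity) h
        refine ⟨c, (hc y ⟨ball_subset_ball (by linarith) hy.1, hy.2⟩).trans_eq ?_⟩
        congr 2; ring
      · obtain ⟨c, hc⟩ := hosc x hx d hd le_rfl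
        have hs := hΩ.subset_ball x hx
        refine ⟨c, ?_⟩
        have := hc y ⟨hs hy.2, hy.2⟩
        rw [inter_eq_right.2 hs] at this
        rw [inter_eq_right.2 (hs.trans (ball_subset_ball h))]
        refine this.trans ?_
        gcongr
        nlinarith
    have hc' : ∫⁻ z in ball x (6 * ρ) ∩ Ω, ‖F z - c‖ₑ ≤ ENNReal.ofReal (36 * γ * l * ρ ^ 2) := by
      refine hc.trans ((mul_le_mul_right hHy _).trans_eq ?_)
      rw [← ENNReal.ofReal_mul (by positivity)]; congr 1; ring
    have hcn : ‖c‖ₑ ≤ ENNReal.ofReal (72 / κ * l) := by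
      have h2 : ‖c‖ₑ * ENNReal.ofReal (κ * ρ ^ 2) ≤
          ENNReal.ofReal (72 / κ * l) * ENNReal.ofReal (κ * ρ ^ 2) := by
        calc ‖c‖ₑ * ENNReal.ofReal (κ * ρ ^ 2) ≤ ‖c‖ₑ * volume (ball x (6 * ρ) ∩ Ω) := by
              gcongr
              exact (hΩ.le_volume x hx ρ hρ hρd).trans (measure_mono
                (inter_subset_inter_left _ (ball_subset_ball (by linarith))))
          _ = ∫⁻ z in ball x (6 * ρ) ∩ Ω, ‖c‖ₑ := by rw [setLIntegral_const]
          _ ≤ ∫⁻ z in ball x (6 * ρ) ∩ Ω, (‖F z - c‖ₑ + ‖F z‖ₑ) := by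
              refine lintegral_mono fun z => ?_
              rw [← enorm_neg (F z - c)]
              refine le_trans (le_of_eq ?_) (enorm_add_le _ _)
              congr 1; abel
          _ = (∫⁻ z in ball x (6 * ρ) ∩ Ω, ‖F z - c‖ₑ) + ∫⁻ z in ball x (6 * ρ) ∩ Ω, ‖F z‖ₑ :=
              lintegral_add_right _ hum
          _ ≤ ENNReal.ofReal (36 * γ * l * ρ ^ 2) + ENNReal.ofReal (36 * l * ρ ^ 2) :=
              add_le_add hc' h6
          _ ≤ ENNReal.ofReal (72 / κ * l) * ENNReal.ofReal (κ * ρ ^ 2) := by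
              rw [← ENNReal.ofReal_add (by positivity) (by positivity),
                ← ENNReal.ofReal_mul (by positivity)]
              apply ENNReal.ofReal_le_ofReal
              rw [show 72 / κ * l * (κ * ρ ^ 2) = 72 * (l * ρ ^ 2) by field_simp]
              nlinarith [mul_pos hl (pow_pos hρ 2)]
      refine (ENNReal.mul_le_mul_iff_left ?_ ENNReal.ofReal_ne_top).1 h2
      rw [Ne, ENNReal.ofReal_eq_zero, not_le]; positivity
    calc ∫⁻ z in ball x (6 * ρ) ∩ S, ‖F z‖ₑ ≤ ∫⁻ z in ball x (6 * ρ) ∩ S, 2 * ‖F z - c‖ₑ := by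
          refine setLIntegral_mono' (measurableSet_ball.inter hSm) fun z hz => ?_
          have h3 : 2 * ‖c‖ₑ ≤ ‖F z‖ₑ := by
            refine le_trans ?_ hz.2.2.le
            refine (mul_le_mul_right hcn 2).trans_eq ?_
            rw [← ENNReal.ofReal_ofNat 2, ← ENNReal.ofReal_mul (by norm_num)]
            congr 1; ring
          have h4 : ‖F z‖ₑ ≤ ‖F z - c‖ₑ + ‖c‖ₑ := by
            refine le_trans (le_of_eq ?_) (enorm_add_le _ _); simp
          have h5 : ‖F z‖ₑ + ‖F z‖ₑ ≤ 2 * ‖F z - c‖ₑ + ‖F z‖ₑ := by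
            calc ‖F z‖ₑ + ‖F z‖ₑ ≤ (‖F z - c‖ₑ + ‖c‖ₑ) + (‖F z - c‖ₑ + ‖c‖ₑ) := add_le_add h4 h4
              _ = 2 * ‖F z - c‖ₑ + 2 * ‖c‖ₑ := by ring
              _ ≤ _ := by gcongr
          exact (ENNReal.add_le_add_iff_right enorm_ne_top).1 h5
      _ = 2 * ∫⁻ z in ball x (6 * ρ) ∩ S, ‖F z - c‖ₑ :=
          lintegral_const_mul' _ _ (by simp)
      _ ≤ 2 * ENNReal.ofReal (36 * γ * l * ρ ^ 2) := by
          gcongr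
          exact (lintegral_mono_set (inter_subset_inter_right _ inter_subset_left)).trans hc'
      _ = ENNReal.ofReal (72 * γ) * ENNReal.ofReal (l * ρ ^ 2) := by
          rw [← ENNReal.ofReal_ofNat 2, ← ENNReal.ofReal_mul (by norm_num),
            ← ENNReal.ofReal_mul (by positivity)]
          congr 1; ring
      _ ≤ ENNReal.ofReal (72 * γ) *
          (2 * ∫⁻ y in ball x ρ ∩ (Ω ∩ {y | ENNReal.ofReal (l / 8) < ‖F y‖ₑ}), ‖F y‖ₑ) := by
          gcongr
          have h1' : ENNReal.ofReal (l * ρ ^ 2) <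
              ∫⁻ y in ball x ρ, ‖F y‖ₑ ∂(volume.restrict Ω) := by
            rwa [Measure.restrict_restrict measurableSet_ball]
          have := mass_le_two_mul_superlevel Measure.restrict_le_self hum hρ hl h1'
          rw [Measure.restrict_restrict (measurableSet_ball.inter
            (measurableSet_lt measurable_const hum))] at this
          rwa [inter_assoc, inter_comm _ Ω] at this
      _ = _ := by
          rw [← mul_assoc, ← ENNReal.ofReal_ofNat 2, ← ENNReal.ofReal_mul (by positivity)]
          congr 2; ring

/-- Good-`λ` inequality comparing a function with its mean oscillation. -/
theorem level_set_le {Ω : Set ℂ} {d κ : ℝ} (hΩ : IsThick Ω d κ) {F : ℂ → E}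
    (hF : ContinuousOn F Ω) (hFm : StronglyMeasurable F)
    {H : ℂ → ℝ≥0∞}
    (hosc : ∀ x ∈ Ω, ∀ ρ, 0 < ρ → ρ ≤ d → ∃ c : E, ∀ y ∈ ball x ρ ∩ Ω,
      ∫⁻ z in ball x ρ ∩ Ω, ‖F z - c‖ₑ ≤ ENNReal.ofReal (ρ ^ 2) * H y)
    {l γ : ℝ} (hl : 0 < l) (hI : ∫⁻ y in Ω, ‖F y‖ₑ < ENNReal.ofReal (l * d ^ 2))
    (hγ : 0 < γ) (hγ1 : γ ≤ 1) :
    ∫⁻ y in Ω ∩ {y | ENNReal.ofReal (144 / κ * l) < ‖F y‖ₑ}, ‖F y‖ₑ ≤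
      ENNReal.ofReal (36 / κ * l) * volume (Ω ∩ {y | ENNReal.ofReal (γ * l) < H y}) +
      ENNReal.ofReal (144 * γ) * ∫⁻ y in Ω ∩ {y | ENNReal.ofReal (l / 8) < ‖F y‖ₑ}, ‖F y‖ₑ := by
  have hΩm := hΩ.isOpen.measurableSet
  have hum : Measurable fun y => ‖F y‖ₑ := hFm.enorm
  set S := Ω ∩ {y | ENNReal.ofReal (144 / κ * l) < ‖F y‖ₑ}
  set T := Ω ∩ {y | ENNReal.ofReal (γ * l) < H y}
  set L := Ω ∩ {y | ENNReal.ofReal (l / 8) < ‖F y‖ₑ}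
  have hex : ∀ x ∈ S, _ := fun x hx => exists_stopping_radius hΩ hF hl hI hx.1 hx.2
  choose! ρ hρ0 hρd hρ1 hρ6 using hex
  obtain ⟨u, huS, huc, hud, hcov⟩ := exists_disjoint_ball_cover S ρ d hρ0 hρd
  have : Countable u := huc.to_subtype
  have hdisj : Pairwise (Function.onFun Disjoint fun x : u => ball (x : ℂ) (ρ x)) :=
    fun x y hxy => hud x.2 y.2 (fun h => hxy (Subtype.ext h))
  have hcov' : S ⊆ ⋃ x : u, ball (x : ℂ) (6 * ρ x) ∩ S := by
    intro z hz
    obtain ⟨x, hx, hzx⟩ := mem_iUnion₂.1 (hcov hz)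
    refine mem_iUnion.2 ⟨⟨x, hx⟩, ?_, hz⟩
    exact closedBall_subset_ball (by linarith [hρ0 x (huS hx)]) hzx
  have hsumT : ∑' x : u, volume (ball (x : ℂ) (ρ x) ∩ T) ≤ volume T := by
    have h : ∀ x : u, volume (ball (x : ℂ) (ρ x) ∩ T) = volume.restrict T (ball (x : ℂ) (ρ x)) :=
      fun x => (Measure.restrict_apply measurableSet_ball).symm
    simp_rw [h]
    rw [← measure_iUnion hdisj fun _ => measurableSet_ball]
    exact (measure_mono (subset_univ _)).trans_eq (by simp)
  have hsumL : ∑' x : u, ∫⁻ y in ball (x : ℂ) (ρ x) ∩ L, ‖F y‖ₑ ≤ ∫⁻ y in L, ‖F y‖ₑ := by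
    have hLm : MeasurableSet L := hΩm.inter (measurableSet_lt measurable_const hum)
    rw [← lintegral_iUnion (fun x => measurableSet_ball.inter hLm)]
    · exact lintegral_mono_set (iUnion_subset fun _ => inter_subset_right)
    · exact fun x y hxy => (hdisj hxy).mono inter_subset_left inter_subset_left
  calc ∫⁻ y in S, ‖F y‖ₑ ≤ ∑' x : u, ∫⁻ y in ball (x : ℂ) (6 * ρ x) ∩ S, ‖F y‖ₑ :=
        (lintegral_mono_set hcov').trans (lintegral_iUnion_le _ _)
    _ ≤ ∑' x : u, (ENNReal.ofReal (36 / κ * l) * volume (ball (x : ℂ) (ρ x) ∩ T) +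
          ENNReal.ofReal (144 * γ) * ∫⁻ y in ball (x : ℂ) (ρ x) ∩ L, ‖F y‖ₑ) :=
        ENNReal.tsum_le_tsum fun x => level_ball_le hΩ hFm hosc hl hγ hγ1 (huS x.2).1
          (hρ0 x (huS x.2)) (hρd x (huS x.2)) (hρ1 x (huS x.2)) (hρ6 x (huS x.2))
    _ = ENNReal.ofReal (36 / κ * l) * ∑' x : u, volume (ball (x : ℂ) (ρ x) ∩ T) +
          ENNReal.ofReal (144 * γ) * ∑' x : u, ∫⁻ y in ball (x : ℂ) (ρ x) ∩ L, ‖F y‖ₑ := by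
        rw [ENNReal.tsum_add, ENNReal.tsum_mul_left, ENNReal.tsum_mul_left]
    _ ≤ _ := by gcongr

end

section

/-- Integrated good-`λ` inequality. -/
theorem lintegral_rpow_le_of_good_lambda {α : Type*} [MeasurableSpace α] {ν : Measure α}
    [IsFiniteMeasure ν] {w : α → ℝ} (hw0 : ∀ x, 0 ≤ w x) (hw : Measurable w) {K q ε : ℝ}
    (hK : 1 ≤ K) (hq : 0 < q) (hε : 0 ≤ ε) (hεK : ε * (8 * K) ^ q ≤ 1 / 2) {θ : ℝ → ℝ≥0∞}
    (h : ∀ l > 0, ν {x | K * l < w x} ≤ θ l + ENNReal.ofReal ε * ν {x | l / 8 < w x}) :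
    ∫⁻ x, ENNReal.ofReal (w x ^ q) ∂ν ≤
      2 * ENNReal.ofReal (K ^ q) *
        (ENNReal.ofReal q * ∫⁻ l in Ioi 0, θ l * ENNReal.ofReal (l ^ (q - 1))) := by
  have hK0 : 0 < K := by linarith
  set Y := ENNReal.ofReal q * ∫⁻ l in Ioi (0 : ℝ), θ l * ENNReal.ofReal (l ^ (q - 1))
  have trunc : ∀ Λ : ℝ, 0 < Λ → ∫⁻ x, ENNReal.ofReal ((min (w x / K) Λ) ^ q) ∂ν ≤ 2 * Y := by
    intro Λ hΛ
    set X := ∫⁻ x, ENNReal.ofReal ((min (w x / K) Λ) ^ q) ∂ν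
    have hmin0 : ∀ x, 0 ≤ min (w x / K) Λ := fun x => le_min (div_nonneg (hw0 x) hK0.le) hΛ.le
    have hXfin : X ≠ ⊤ := by
      refine ne_top_of_le_ne_top (b := ENNReal.ofReal (Λ ^ q) * ν univ) (by finiteness) ?_
      rw [← lintegral_const]
      refine lintegral_mono fun x => ENNReal.ofReal_le_ofReal ?_
      exact Real.rpow_le_rpow (hmin0 x) (min_le_right _ _) hq.le
    have h1 : X = ENNReal.ofReal q *
        ∫⁻ l in Ioi 0, ν {x | l < min (w x / K) Λ} * ENNReal.ofReal (l ^ (q - 1)) :=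
      lintegral_rpow_eq_lintegral_meas_lt_mul ν (ae_of_all _ hmin0)
        ((hw.div_const K).min measurable_const).aemeasurable hq
    have h2 : ∫⁻ x, ENNReal.ofReal ((min (8 * w x) Λ) ^ q) ∂ν = ENNReal.ofReal q *
        ∫⁻ l in Ioi 0, ν {x | l < min (8 * w x) Λ} * ENNReal.ofReal (l ^ (q - 1)) :=
      lintegral_rpow_eq_lintegral_meas_lt_mul ν
        (ae_of_all _ fun x => le_min (mul_nonneg (by norm_num) (hw0 x)) hΛ.le)
        ((hw.const_mul 8).min measurable_const).aemeasurable hq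
    have hpt : ∀ l > 0, ν {x | l < min (w x / K) Λ} ≤
        θ l + ENNReal.ofReal ε * ν {x | l < min (8 * w x) Λ} := by
      intro l hl
      rcases lt_or_ge l Λ with hlΛ | hlΛ
      · have e1 : {x | l < min (w x / K) Λ} = {x | K * l < w x} := by
          ext x; simp [lt_div_iff₀ hK0, hlΛ, mul_comm]
        have e2 : {x | l < min (8 * w x) Λ} = {x | l / 8 < w x} := by
          ext x; simp [hlΛ, div_lt_iff₀, mul_comm]
        rw [e1, e2]; exact h l hl
      · have e1 : {x | l < min (w x / K) Λ} = ∅ := by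
          ext x; simp [not_lt.2 hlΛ]
        rw [e1]; simp
    have hmono : Antitone fun l => ν {x | l < min (8 * w x) Λ} := fun l l' hll' =>
      measure_mono fun x hx => lt_of_le_of_lt hll' hx
    have hcomp : ∫⁻ x, ENNReal.ofReal ((min (8 * w x) Λ) ^ q) ∂ν ≤
        ENNReal.ofReal ((8 * K) ^ q) * X := by
      rw [← lintegral_const_mul' _ _ ENNReal.ofReal_ne_top]
      refine lintegral_mono fun x => ?_
      rw [← ENNReal.ofReal_mul (by positivity), ← Real.mul_rpow (by positivity) (hmin0 x)]
      refine ENNReal.ofReal_le_ofReal (Real.rpow_le_rpow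
        (le_min (mul_nonneg (by norm_num) (hw0 x)) hΛ.le) ?_ hq.le)
      rw [mul_min_of_nonneg _ _ (by positivity)]
      refine min_le_min (le_of_eq (by field_simp)) (by nlinarith)
    have hX : X ≤ Y + ENNReal.ofReal (1 / 2) * X := by
      calc X = ENNReal.ofReal q *
          ∫⁻ l in Ioi 0, ν {x | l < min (w x / K) Λ} * ENNReal.ofReal (l ^ (q - 1)) := h1
        _ ≤ ENNReal.ofReal q * ∫⁻ l in Ioi 0, (θ l * ENNReal.ofReal (l ^ (q - 1)) +
            ENNReal.ofReal ε * (ν {x | l < min (8 * w x) Λ} * ENNReal.ofReal (l ^ (q - 1)))) := by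
          gcongr ENNReal.ofReal q * ?_
          refine setLIntegral_mono' measurableSet_Ioi fun l hl => ?_
          rw [← mul_assoc, ← add_mul]
          gcongr
          exact hpt l hl
        _ = Y + ENNReal.ofReal ε * ∫⁻ x, ENNReal.ofReal ((min (8 * w x) Λ) ^ q) ∂ν := by
          rw [lintegral_add_right, lintegral_const_mul' _ _ ENNReal.ofReal_ne_top, mul_add, h2]
          · ring
          · exact (hmono.measurable.mul (by fun_prop)).const_mul _
        _ ≤ Y + ENNReal.ofReal ε * (ENNReal.ofReal ((8 * K) ^ q) * X) := by gcongr
        _ ≤ _ := by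
          rw [← mul_assoc, ← ENNReal.ofReal_mul hε]
          gcongr
    have hhalf : X = ENNReal.ofReal (1 / 2) * X + ENNReal.ofReal (1 / 2) * X := by
      rw [← add_mul, ← ENNReal.ofReal_add (by norm_num) (by norm_num)]; norm_num
    have hf : ENNReal.ofReal (1 / 2) * X ≤ Y := by
      nth_rw 1 [hhalf] at hX
      exact (ENNReal.add_le_add_iff_right (by finiteness)).1 hX
    rw [hhalf, two_mul]; gcongr
  have hlim : ∫⁻ x, ENNReal.ofReal ((w x / K) ^ q) ∂ν ≤ 2 * Y := by
    have hmono : ∀ x, Monotone fun n : ℕ => ENNReal.ofReal ((min (w x / K) (n + 1 : ℝ)) ^ q) :=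
      fun x n m hnm => ENNReal.ofReal_le_ofReal (Real.rpow_le_rpow
        (le_min (div_nonneg (hw0 x) hK0.le) (by positivity)) (by gcongr) hq.le)
    have ht := lintegral_tendsto_of_tendsto_of_monotone (μ := ν)
      (f := fun (n : ℕ) x => ENNReal.ofReal ((min (w x / K) (n + 1 : ℝ)) ^ q))
      (F := fun x => ENNReal.ofReal ((w x / K) ^ q))
      (fun n => (((hw.div_const K).min measurable_const).pow_const q).ennreal_ofReal.aemeasurable)
      (ae_of_all _ hmono) (ae_of_all _ fun x => by
        refine tendsto_const_nhds.congr' ?_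
        filter_upwards [eventually_ge_atTop ⌈w x / K⌉₊] with n hn
        rw [min_eq_left]
        exact (Nat.le_ceil _).trans ((Nat.cast_le.2 hn).trans (by linarith)))
    exact le_of_tendsto' ht fun n => trunc _ (by positivity)
  calc ∫⁻ x, ENNReal.ofReal (w x ^ q) ∂ν
      = ENNReal.ofReal (K ^ q) * ∫⁻ x, ENNReal.ofReal ((w x / K) ^ q) ∂ν := by
        rw [← lintegral_const_mul' _ _ ENNReal.ofReal_ne_top]
        refine lintegral_congr fun x => ?_
        rw [← ENNReal.ofReal_mul (by positivity), ← Real.mul_rpow hK0.le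
          (div_nonneg (hw0 x) hK0.le), mul_div_cancel₀ _ hK0.ne']
    _ ≤ ENNReal.ofReal (K ^ q) * (2 * Y) := by gcongr
    _ = _ := by ring

variable {E : Type*} [NormedAddCommGroup E]

/-- `L^p` norm of a function on a thick set controlled by the distribution of a majorant of its
mean oscillation. -/
theorem lintegral_rpow_le_of_oscillation {Ω : Set ℂ} {d κ : ℝ} (hΩ : IsThick Ω d κ) (hκ1 : κ ≤ 1)
    {F : ℂ → E} (hF : ContinuousOn F Ω) (hFm : StronglyMeasurable F)
    (hfin : ∫⁻ y in Ω, ‖F y‖ₑ ≠ ⊤) {H : ℂ → ℝ≥0∞}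
    (hosc : ∀ x ∈ Ω, ∀ ρ, 0 < ρ → ρ ≤ d → ∃ c : E, ∀ y ∈ ball x ρ ∩ Ω,
      ∫⁻ z in ball x ρ ∩ Ω, ‖F z - c‖ₑ ≤ ENNReal.ofReal (ρ ^ 2) * H y)
    (hlarge : ∀ y ∈ Ω, ∫⁻ z in Ω, ‖F z‖ₑ ≤ ENNReal.ofReal (d ^ 2) * H y)
    {γ p : ℝ} (hγ : 0 < γ) (hγ1 : γ ≤ 1 / 2) (hp : 1 < p)
    (hγp : 144 * γ * (8 * (144 / κ)) ^ (p - 1) ≤ 1 / 2) :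
    ∫⁻ y in Ω, ENNReal.ofReal (‖F y‖ ^ p) ≤
      ENNReal.ofReal (2 * (144 / κ) ^ (p - 1) * (37 * p / κ)) *
        ∫⁻ l in Ioi 0, volume (Ω ∩ {y | ENNReal.ofReal (γ * l) < H y}) *
          ENNReal.ofReal (l ^ (p - 1)) := by
  have hd := hΩ.diam_pos
  have hκ := hΩ.ratio_pos
  have hΩm := hΩ.isOpen.measurableSet
  have hwm : Measurable fun y => ‖F y‖ := hFm.norm.measurable
  have hum : Measurable fun y => ‖F y‖ₑ := hFm.enorm
  rcases Ω.eq_empty_or_nonempty with rfl | ⟨x₀, hx₀⟩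
  · simp
  set M := ∫⁻ l in Ioi (0 : ℝ), volume (Ω ∩ {y | ENNReal.ofReal (γ * l) < H y}) *
          ENNReal.ofReal (l ^ (p - 1))
  set ν : Measure ℂ := (volume.restrict Ω).withDensity fun y => ‖F y‖ₑ
  have hνuniv : ν univ = ∫⁻ y in Ω, ‖F y‖ₑ := by
    rw [withDensity_apply _ MeasurableSet.univ]; simp
  have : IsFiniteMeasure ν := ⟨by rw [hνuniv]; exact hfin.lt_top⟩
  have hν : ∀ t ≥ 0, ν {x | t < ‖F x‖} =
      ∫⁻ y in Ω ∩ {y | ENNReal.ofReal t < ‖F y‖ₑ}, ‖F y‖ₑ := by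
    intro t ht
    have e : {x | t < ‖F x‖} = {y | ENNReal.ofReal t < ‖F y‖ₑ} := by
      ext y
      simp only [mem_ofPred_eq]
      rw [← ofReal_norm, ENNReal.ofReal_lt_ofReal_iff_of_nonneg ht]
    have hm : MeasurableSet {y | ENNReal.ofReal t < ‖F y‖ₑ} :=
      measurableSet_lt measurable_const hum
    rw [e, withDensity_apply _ hm, Measure.restrict_restrict hm, inter_comm]
  set I := (∫⁻ y in Ω, ‖F y‖ₑ).toReal
  have hI : ∫⁻ y in Ω, ‖F y‖ₑ = ENNReal.ofReal I := (ENNReal.ofReal_toReal hfin).symm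
  have hI0 : 0 ≤ I := ENNReal.toReal_nonneg
  set l₀ := 2 * I / d ^ 2
  have hl₀ : 0 ≤ l₀ := by positivity
  have hHl : ∀ y ∈ Ω, ENNReal.ofReal (l₀ / 2) ≤ H y := by
    intro y hy
    have h1 := hlarge y hy
    have h2 : ENNReal.ofReal (d ^ 2) ≠ 0 := by
      rw [Ne, ENNReal.ofReal_eq_zero, not_le]; positivity
    refine (ENNReal.mul_le_mul_iff_right h2 ENNReal.ofReal_ne_top).1 (le_trans (le_of_eq ?_) h1)
    rw [hI, ← ENNReal.ofReal_mul (by positivity)]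
    congr 1
    simp only [l₀]; field_simp
  have key := lintegral_rpow_le_of_good_lambda (ν := ν) (w := fun y => ‖F y‖)
    (fun _ => norm_nonneg _) hwm (K := 144 / κ) (q := p - 1) (ε := 144 * γ)
    (by rw [le_div_iff₀ hκ]; linarith) (by linarith) (by positivity) hγp
    (θ := fun l => ENNReal.ofReal (36 / κ * l) *
      volume (Ω ∩ {y | ENNReal.ofReal (γ * l) < H y}) + ν {_x | l < l₀}) (by
      intro l hl
      rcases lt_or_ge l l₀ with hlt | hge
      · refine le_add_right (le_add_left ?_)
        simp only [hlt]
        exact measure_mono (subset_univ _)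
      · have : ∫⁻ y in Ω, ‖F y‖ₑ < ENNReal.ofReal (l * d ^ 2) := by
          rw [hI]
          apply (ENNReal.ofReal_lt_ofReal_iff (by positivity)).2
          have h3 : 2 * I ≤ l * d ^ 2 := by
            rwa [div_le_iff₀ (by positivity)] at hge
          rcases hI0.eq_or_lt with h | h
          · rw [← h]; positivity
          · linarith
        have h4 := level_set_le hΩ hF hFm hosc hl this hγ (by linarith)
        rw [hν _ (by positivity), hν _ (by positivity)]
        refine h4.trans ?_
        gcongr
        exact le_self_add)
  have hlay1 : ENNReal.ofReal (p - 1) *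
      ∫⁻ l in Ioi (0 : ℝ), ν {_x | l < l₀} * ENNReal.ofReal (l ^ (p - 1 - 1)) =
      ENNReal.ofReal (l₀ ^ (p - 1)) * ENNReal.ofReal I := by
    rw [← lintegral_rpow_eq_lintegral_meas_lt_mul ν (f := fun _ => l₀) (ae_of_all _ fun _ => hl₀)
      aemeasurable_const (by linarith), lintegral_const, hνuniv, hI]
  have hlay2 : ENNReal.ofReal (l₀ ^ p) * volume Ω ≤ ENNReal.ofReal p * M := by
    have := lintegral_rpow_eq_lintegral_meas_lt_mul (volume.restrict Ω) (f := fun _ => l₀)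
      (ae_of_all _ fun _ => hl₀) aemeasurable_const (p := p) (by linarith)
    rw [lintegral_const, Measure.restrict_apply MeasurableSet.univ, univ_inter] at this
    rw [this]
    gcongr ENNReal.ofReal p * ?_
    refine setLIntegral_mono' measurableSet_Ioi fun l hl => ?_
    gcongr ?_ * _
    rcases lt_or_ge l l₀ with hlt | hge
    · simp only [hlt, ofPred_true, Measure.restrict_apply MeasurableSet.univ, univ_inter]
      refine measure_mono fun y hy => ⟨hy, lt_of_lt_of_le ?_ (hHl y hy)⟩
      have hl' : 0 < l := hl
      exact (ENNReal.ofReal_lt_ofReal_iff (by linarith)).2 (by nlinarith)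
    · simp [not_lt.2 hge]
  have hbd : ENNReal.ofReal (l₀ ^ (p - 1)) * ENNReal.ofReal I ≤ ENNReal.ofReal (p / κ) * M := by
    calc ENNReal.ofReal (l₀ ^ (p - 1)) * ENNReal.ofReal I
        ≤ ENNReal.ofReal (1 / κ) * (ENNReal.ofReal (l₀ ^ p) * ENNReal.ofReal (κ * d ^ 2)) := by
          rw [← ENNReal.ofReal_mul (by positivity), ← ENNReal.ofReal_mul (by positivity),
            ← ENNReal.ofReal_mul (by positivity)]
          apply ENNReal.ofReal_le_ofReal
          rcases hl₀.eq_or_lt with h | h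
          · have : I = 0 := by
              have h5 : 2 * I / d ^ 2 = 0 := h.symm
              have : d ^ 2 ≠ 0 := by positivity
              field_simp at h5
              linarith
            rw [this, mul_zero]; positivity
          · rw [Real.rpow_sub_one h.ne']
            have h6 : I = l₀ * d ^ 2 / 2 := by simp only [l₀]; field_simp
            have h7 : l₀ ^ p / l₀ * I = l₀ ^ p * d ^ 2 / 2 := by rw [h6]; field_simp
            have h8 : 1 / κ * (l₀ ^ p * (κ * d ^ 2)) = l₀ ^ p * d ^ 2 := by field_simp
            rw [h7, h8]
            have : 0 ≤ l₀ ^ p * d ^ 2 := by positivity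
            linarith
      _ ≤ ENNReal.ofReal (1 / κ) * (ENNReal.ofReal (l₀ ^ p) * volume Ω) := by
          gcongr
          exact (hΩ.le_volume x₀ hx₀ d hd le_rfl).trans (measure_mono inter_subset_right)
      _ ≤ ENNReal.ofReal (1 / κ) * (ENNReal.ofReal p * M) := by gcongr
      _ = _ := by
          rw [← mul_assoc, ← ENNReal.ofReal_mul (by positivity)]; congr 2; ring
  have hlhs : ∫⁻ y in Ω, ENNReal.ofReal (‖F y‖ ^ p) =
      ∫⁻ y, ENNReal.ofReal (‖F y‖ ^ (p - 1)) ∂ν := by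
    rw [lintegral_withDensity_eq_lintegral_mul _ hum (by fun_prop)]
    refine lintegral_congr fun y => ?_
    simp only [Pi.mul_apply]
    rw [← ofReal_norm, ← ENNReal.ofReal_mul (norm_nonneg _)]
    congr 1
    rcases (norm_nonneg (F y)).eq_or_lt with h | h
    · rw [← h, Real.zero_rpow (by linarith), zero_mul]
    · rw [Real.rpow_sub_one h.ne']; field_simp
  have hθ : ENNReal.ofReal (p - 1) * ∫⁻ l in Ioi (0 : ℝ), (ENNReal.ofReal (36 / κ * l) *
      volume (Ω ∩ {y | ENNReal.ofReal (γ * l) < H y}) + ν {_x | l < l₀}) *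
        ENNReal.ofReal (l ^ (p - 1 - 1)) ≤ ENNReal.ofReal (37 * p / κ) * M := by
    have hmono : Antitone fun l => ν {_x | l < l₀} := fun l l' hll' =>
      measure_mono fun x hx => lt_of_le_of_lt hll' hx
    have e : ∫⁻ l in Ioi (0 : ℝ), (ENNReal.ofReal (36 / κ * l) *
      volume (Ω ∩ {y | ENNReal.ofReal (γ * l) < H y}) + ν {_x | l < l₀}) *
        ENNReal.ofReal (l ^ (p - 1 - 1)) = ENNReal.ofReal (36 / κ) * M +
        ∫⁻ l in Ioi (0 : ℝ), ν {_x | l < l₀} * ENNReal.ofReal (l ^ (p - 1 - 1)) := by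
      simp_rw [add_mul]
      have hm : Measurable fun l : ℝ => ν {_x | l < l₀} * ENNReal.ofReal (l ^ (p - 1 - 1)) :=
        hmono.measurable.mul (by fun_prop)
      rw [lintegral_add_right _ hm]
      congr 1
      rw [← lintegral_const_mul' _ _ ENNReal.ofReal_ne_top]
      refine setLIntegral_congr_fun measurableSet_Ioi fun l hl => ?_
      have hl' : 0 < l := hl
      rw [Real.rpow_sub_one hl'.ne', mul_right_comm, ← ENNReal.ofReal_mul (by positivity),
        mul_left_comm, mul_comm (volume _), ← ENNReal.ofReal_mul (by positivity), ]
      congr 2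
      field_simp
    rw [e, mul_add, hlay1]
    calc _ ≤ ENNReal.ofReal (p - 1) * (ENNReal.ofReal (36 / κ) * M) +
          ENNReal.ofReal (p / κ) * M := by gcongr
      _ = ENNReal.ofReal ((p - 1) * (36 / κ) + p / κ) * M := by
          rw [← mul_assoc, ← ENNReal.ofReal_mul (by linarith), ← add_mul,
            ← ENNReal.ofReal_add (mul_nonneg (by linarith) (by positivity)) (by positivity)]
      _ ≤ _ := by
          gcongr
          have : (p - 1) * (36 / κ) + p / κ = (37 * p - 36) / κ := by field_simp; ring
          rw [this]; gcongr; linarith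
  rw [hlhs]
  refine key.trans ?_
  calc _ ≤ 2 * ENNReal.ofReal ((144 / κ) ^ (p - 1)) * (ENNReal.ofReal (37 * p / κ) * M) := by
        gcongr
    _ = _ := by
        rw [← ENNReal.ofReal_ofNat 2, ← ENNReal.ofReal_mul (by norm_num), ← mul_assoc,
          ← ENNReal.ofReal_mul (by positivity)]

/-- `L^p` bound for the superlevel sets of a maximal function of power type. -/
theorem lintegral_volume_lt_maxFn_le {f : ℂ → ℝ} (hf0 : ∀ x, 0 ≤ f x) (hf : Measurable f)
    {s p γ : ℝ} (hs : 1 ≤ s) (hsp : s < p) (hγ : 0 < γ)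
    (hfin : ∫⁻ y, ENNReal.ofReal (f y ^ s) ≠ ⊤) :
    ∫⁻ l in Ioi 0, volume {y | ENNReal.ofReal (γ * l) <
        maxFn (fun y => ENNReal.ofReal (f y ^ s)) y ^ (1 / s)} * ENNReal.ofReal (l ^ (p - 1)) ≤
      ENNReal.ofReal (200 / γ ^ s * (8 / γ) ^ (p - s) / (p - s)) *
        ∫⁻ y, ENNReal.ofReal (f y ^ p) := by
  have hs0 : 0 < s := by linarith
  have hps : 0 < p - s := by linarith
  set g : ℂ → ℝ≥0∞ := fun y => ENNReal.ofReal (f y ^ s)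
  have hg : Measurable g := by fun_prop
  set ν : Measure ℂ := volume.withDensity g
  have hpt : ∀ l : ℝ, 0 < l → volume {y | ENNReal.ofReal (γ * l) < maxFn g y ^ (1 / s)} ≤
      ENNReal.ofReal (200 / γ ^ s * l ^ (-s)) * ν {y | l < 8 / γ * f y} := by
    intro l hl
    have hgl : 0 < γ * l := by positivity
    have e1 : {y | ENNReal.ofReal (γ * l) < maxFn g y ^ (1 / s)} =
        {y | ENNReal.ofReal ((γ * l) ^ s) < maxFn g y} := by
      ext y
      simp only [mem_ofPred_eq]
      rw [← ENNReal.ofReal_rpow_of_pos hgl, one_div, ENNReal.lt_rpow_inv_iff hs0]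
    rw [e1]
    refine (volume_lt_maxFn_le hg hfin (t := (γ * l) ^ s) (by positivity)).trans ?_
    have hm : MeasurableSet {y | ENNReal.ofReal ((γ * l) ^ s / 8) < g y} :=
      measurableSet_lt measurable_const hg
    rw [← withDensity_apply _ hm]
    gcongr ?_ * ?_
    · apply ENNReal.ofReal_le_ofReal
      rw [Real.mul_rpow hγ.le hl.le, Real.rpow_neg hl.le]
      apply le_of_eq; field_simp
    · refine measure_mono fun y hy => ?_
      have h1 : (γ * l) ^ s / 8 < f y ^ s :=
        (ENNReal.ofReal_lt_ofReal_iff_of_nonneg (by positivity)).1 hy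
      have h2 : (γ * l / 8) ^ s < f y ^ s := by
        refine lt_of_le_of_lt ?_ h1
        rw [Real.div_rpow hgl.le (by norm_num)]
        gcongr
        exact (Real.self_le_rpow_of_one_le (by norm_num) hs)
      have h3 := (Real.rpow_lt_rpow_iff (by positivity) (hf0 y) hs0).1 h2
      show l < 8 / γ * f y
      rw [div_mul_eq_mul_div, lt_div_iff₀ hγ]
      linarith
  have hlay := lintegral_rpow_eq_lintegral_meas_lt_mul ν (f := fun y => 8 / γ * f y)
    (ae_of_all _ fun y => mul_nonneg (by positivity) (hf0 y)) (by fun_prop) hps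
  have hlhs : ∫⁻ y, ENNReal.ofReal ((8 / γ * f y) ^ (p - s)) ∂ν =
      ENNReal.ofReal ((8 / γ) ^ (p - s)) * ∫⁻ y, ENNReal.ofReal (f y ^ p) := by
    rw [lintegral_withDensity_eq_lintegral_mul _ hg (by fun_prop),
      ← lintegral_const_mul' _ _ ENNReal.ofReal_ne_top]
    refine lintegral_congr fun y => ?_
    simp only [Pi.mul_apply, g]
    rw [← ENNReal.ofReal_mul (Real.rpow_nonneg (hf0 y) _), ← ENNReal.ofReal_mul (by positivity),
      Real.mul_rpow (by positivity) (hf0 y), mul_left_comm,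
      ← Real.rpow_add_of_nonneg (hf0 y) hs0.le hps.le]
    congr 3; ring
  calc _ ≤ ∫⁻ l in Ioi (0 : ℝ), ENNReal.ofReal (200 / γ ^ s) *
        (ν {y | l < 8 / γ * f y} * ENNReal.ofReal (l ^ (p - s - 1))) := by
        refine setLIntegral_mono' measurableSet_Ioi fun l hl => ?_
        have hl' : 0 < l := hl
        refine (mul_le_mul_left (hpt l hl) _).trans (le_of_eq ?_)
        rw [ENNReal.ofReal_mul (by positivity), mul_assoc, mul_assoc, mul_left_comm _ (ν _),
          ← ENNReal.ofReal_mul (by positivity), ← Real.rpow_add hl',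
          show -s + (p - 1) = p - s - 1 by ring]
    _ = ENNReal.ofReal (200 / γ ^ s / (p - s)) * (ENNReal.ofReal (p - s) *
        ∫⁻ l in Ioi (0 : ℝ), (ν {y | l < 8 / γ * f y} * ENNReal.ofReal (l ^ (p - s - 1)))) := by
        rw [lintegral_const_mul' _ _ ENNReal.ofReal_ne_top, ← mul_assoc,
          ← ENNReal.ofReal_mul (by positivity), div_mul_cancel₀ _ hps.ne']
    _ = _ := by
        rw [← hlay, hlhs, ← mul_assoc, ← ENNReal.ofReal_mul (by positivity)]
        congr 2; ring

/-- If the mean oscillation of `F` over balls of a thick set is controlled by the maximal function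
of `f ^ s`, then `‖F‖_p ≲ ‖f‖_p` for `p > s`, locally uniformly in `p`. -/
theorem exists_sharp_maximal_bound (E : Type*) [NormedAddCommGroup E] {κ s p₀ p₁ : ℝ} (hκ : 0 < κ)
    (hκ1 : κ ≤ 1) (hs : 1 ≤ s) (hsp : s < p₀) :
    ∃ C > (0 : ℝ), ∀ (Ω : Set ℂ) (d : ℝ), IsThick Ω d κ → ∀ (F : ℂ → E), ContinuousOn F Ω →
      StronglyMeasurable F → ∫⁻ y in Ω, ‖F y‖ₑ ≠ ⊤ → ∀ f : ℂ → ℝ, (∀ x, 0 ≤ f x) →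
      Measurable f → ∫⁻ y, ENNReal.ofReal (f y ^ s) ≠ ⊤ →
      (∀ x ∈ Ω, ∀ ρ, 0 < ρ → ρ ≤ d → ∃ c : E, ∀ y ∈ ball x ρ ∩ Ω,
        ∫⁻ z in ball x ρ ∩ Ω, ‖F z - c‖ₑ ≤ ENNReal.ofReal (ρ ^ 2) *
          maxFn (fun y => ENNReal.ofReal (f y ^ s)) y ^ (1 / s)) →
      (∀ y ∈ Ω, ∫⁻ z in Ω, ‖F z‖ₑ ≤ ENNReal.ofReal (d ^ 2) *
          maxFn (fun y => ENNReal.ofReal (f y ^ s)) y ^ (1 / s)) →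
      ∀ p ∈ Icc p₀ p₁, ∫⁻ y in Ω, ENNReal.ofReal (‖F y‖ ^ p) ≤
        ENNReal.ofReal C * ∫⁻ y, ENNReal.ofReal (f y ^ p) := by
  rcases lt_or_ge p₁ p₀ with hlt | hp₁
  · exact ⟨1, one_pos, fun _ _ _ _ _ _ _ _ _ _ _ _ _ p hp => absurd (hp.1.trans hp.2) (by linarith)⟩
  set K := 144 / κ
  have hK : 1 ≤ K := by rw [le_div_iff₀ hκ]; linarith
  have h8K : 1 ≤ 8 * K := by linarith
  set γ := 1 / (288 * (8 * K) ^ p₁)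
  have hpow : 1 ≤ (8 * K) ^ p₁ := Real.one_le_rpow h8K (by linarith)
  have hγ : 0 < γ := by positivity
  have hγ1 : γ ≤ 1 / 2 := by
    apply one_div_le_one_div_of_le (by norm_num); linarith
  have h8γ : 1 ≤ 8 / γ := by rw [le_div_iff₀ hγ]; linarith
  refine ⟨(2 * K ^ p₁ * (37 * p₁ / κ)) * (200 / γ ^ s * (8 / γ) ^ p₁ / (p₀ - s)), ?_, ?_⟩
  · have : 0 < p₀ - s := by linarith
    have : 0 < p₁ := by linarith
    positivity
  intro Ω d hΩ F hF hFm hfin f hf0 hf hfs hosc hlarge p hp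
  obtain ⟨hp0, hp1⟩ := hp
  have h1p : 1 < p := by linarith
  have h1 := lintegral_rpow_le_of_oscillation hΩ hκ1 hF hFm hfin hosc hlarge hγ hγ1 h1p (by
    have h2 : (8 * K) ^ (p - 1) ≤ (8 * K) ^ p₁ :=
      Real.rpow_le_rpow_of_exponent_le h8K (by linarith)
    calc 144 * γ * (8 * K) ^ (p - 1) ≤ 144 * γ * (8 * K) ^ p₁ := by gcongr
      _ = 1 / 2 := by simp only [γ]; field_simp; norm_num)
  refine h1.trans ?_
  calc _ ≤ ENNReal.ofReal (2 * K ^ p₁ * (37 * p₁ / κ)) *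
        (ENNReal.ofReal (200 / γ ^ s * (8 / γ) ^ (p - s) / (p - s)) *
        ∫⁻ y, ENNReal.ofReal (f y ^ p)) := by
        gcongr ?_ * ?_
        · apply ENNReal.ofReal_le_ofReal
          have : K ^ (p - 1) ≤ K ^ p₁ := Real.rpow_le_rpow_of_exponent_le hK (by linarith)
          gcongr
        · refine le_trans ?_ (lintegral_volume_lt_maxFn_le hf0 hf hs (by linarith) hγ hfs)
          gcongr
          exact inter_subset_right
    _ ≤ _ := by
        rw [← mul_assoc, ← ENNReal.ofReal_mul (by
          have : 0 < p₁ := by linarith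
          positivity)]
        gcongr ENNReal.ofReal (_ * ?_) * _
        · have : 0 < p₁ := by linarith
          positivity
        · have h3 : (8 / γ) ^ (p - s) ≤ (8 / γ) ^ p₁ :=
            Real.rpow_le_rpow_of_exponent_le h8γ (by linarith)
          have : 0 < p₀ - s := by linarith
          gcongr

end

theorem measurable_indicator_of_continuousOn {E : Type*} [NormedAddCommGroup E] [MeasurableSpace E]
    [BorelSpace E] {U : Set ℂ} (hU : IsOpen U) {f : ℂ → E} (hf : ContinuousOn f U) :
    Measurable (U.indicator f) := by
  classical
  rw [← piecewise_eq_indicator]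
  exact hf.measurable_piecewise continuousOn_const hU.measurableSet

theorem IsThick.of_convex {Ω : Set ℂ} {d : ℝ} (ho : IsOpen Ω) (hc : Convex ℝ Ω) (hd : 0 < d)
    (hs : ∀ x ∈ Ω, Ω ⊆ ball x d) {y₀ : ℂ} (hy₀ : ball y₀ (d / 4) ⊆ Ω) : IsThick Ω d (1 / 16) := by
  refine ⟨ho, hd, by norm_num, hs, fun x hx ρ hρ hρd => ?_⟩
  have hsub : ball (x + (ρ / d) • (y₀ - x)) (ρ / 4) ⊆ ball x ρ ∩ Ω := by
    intro z hz
    set w : ℂ := x + (d / ρ) • (z - x) with hw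
    have hzw : z = x + (ρ / d) • (w - x) := by
      rw [hw, add_sub_cancel_left, smul_smul, div_mul_div_cancel₀ hd.ne', div_self hρ.ne']; simp
    have hwy : w ∈ ball y₀ (d / 4) := by
      rw [mem_ball, dist_eq_norm] at hz ⊢
      have e : z - (x + (ρ / d) • (y₀ - x)) = (ρ / d) • (w - y₀) := by
        rw [hzw, ← sub_eq_zero]; simp only [smul_sub]; abel
      rw [e, norm_smul, Real.norm_of_nonneg (by positivity)] at hz
      rw [div_mul_eq_mul_div, div_lt_iff₀ hd] at hz
      nlinarith
    have hwΩ := hy₀ hwy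
    refine ⟨?_, ?_⟩
    · rw [hzw, mem_ball, dist_eq_norm, add_sub_cancel_left, norm_smul,
        Real.norm_of_nonneg (by positivity), div_mul_eq_mul_div, div_lt_iff₀ hd]
      have := hs x hx hwΩ
      rw [mem_ball, dist_eq_norm] at this
      gcongr
    · rw [hzw]
      exact hc.add_smul_sub_mem hx hwΩ ⟨by positivity, (div_le_one hd).2 hρd⟩
  refine le_trans ?_ (measure_mono hsub)
  rw [volume_ball_eq _ (by positivity)]
  apply ENNReal.ofReal_le_ofReal
  nlinarith [pi_gt_three, sq_nonneg ρ]

theorem isThick_unitDisc : IsThick (ball (0 : ℂ) 1) 2 (1 / 16) := by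
  refine IsThick.of_convex (y₀ := 0) isOpen_ball (convex_ball _ _) (by norm_num) (fun x hx y hy => ?_)
    (ball_subset_ball (by norm_num))
  rw [mem_ball_zero_iff] at hx hy
  rw [mem_ball, dist_eq_norm]
  linarith [norm_sub_le y x]

theorem exists_ball_subset_inter_unitDisc {x : ℂ} (hx : x ∈ ball (0 : ℂ) 1) {ρ : ℝ} (hρ : 0 < ρ)
    (hρ2 : ρ ≤ 2) : ∃ y, ball y (ρ / 2) ⊆ ball x ρ ∩ ball 0 1 := by
  rw [mem_ball_zero_iff] at hx
  rcases lt_or_ge ‖x‖ (ρ / 2) with h | h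
  · refine ⟨0, subset_inter (ball_subset_ball' ?_) (ball_subset_ball (by linarith))⟩
    rw [dist_zero_left]; linarith
  · have hx0 : 0 < ‖x‖ := by linarith
    refine ⟨(1 - ρ / 2 / ‖x‖) • x, subset_inter (ball_subset_ball' ?_) (ball_subset_ball' ?_)⟩
    · rw [dist_eq_norm, sub_smul, one_smul, sub_sub_cancel_left, norm_neg, norm_smul,
        Real.norm_of_nonneg (by positivity), div_mul_cancel₀ _ hx0.ne']
      linarith
    · rw [dist_zero_right, norm_smul, Real.norm_of_nonneg (by
        rw [sub_nonneg, div_le_one hx0]; exact h), sub_mul, div_mul_cancel₀ _ hx0.ne']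
      linarith

theorem isThick_ball_inter_unitDisc {x : ℂ} (hx : x ∈ ball (0 : ℂ) 1) {ρ : ℝ} (hρ : 0 < ρ)
    (hρ2 : ρ ≤ 2) : IsThick (ball x ρ ∩ ball 0 1) (2 * ρ) (1 / 16) := by
  obtain ⟨y, hy⟩ := exists_ball_subset_inter_unitDisc hx hρ hρ2
  refine IsThick.of_convex (y₀ := y) (isOpen_ball.inter isOpen_ball)
    ((convex_ball _ _).inter (convex_ball _ _)) (by positivity) (fun z hz w hw => ?_) ?_
  · have h1 := mem_ball.1 hz.1
    have h2 := mem_ball.1 hw.1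
    rw [mem_ball]
    linarith [dist_triangle_right w z x]
  · convert hy using 2; ring

theorem lintegral_comp_smul_add {g : ℂ → ℝ≥0∞} (hg : Measurable g) {r : ℝ} (hr : r ≠ 0) (v : ℂ) :
    ∫⁻ x, g (r • x + v) = ENNReal.ofReal ((r ^ 2)⁻¹) * ∫⁻ x, g x := by
  have h1 : ∫⁻ x : ℂ, g (r • x + v) = ∫⁻ x, g (x + v) ∂(Measure.map (r • ·) volume) := by
    rw [lintegral_map (by fun_prop) (by fun_prop)]
  rw [h1, Measure.map_addHaar_smul volume hr, lintegral_smul_measure, lintegral_add_right_eq_self g]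
  rw [Complex.finrank_real_complex, abs_of_nonneg (by positivity)]
  rfl

theorem enorm_sub_le_lintegral_segment {U : Set ℂ} {δ : ℝ} (hUo : IsOpen U) (hUc : Convex ℝ U)
    (hd : ∀ x ∈ U, U ⊆ ball x δ) {a : ℂ → ℝ}
    (ha : ContDiffOn ℝ 1 a U) {x y : ℂ} (hx : x ∈ U) (hy : y ∈ U) :
    ‖a x - a y‖ₑ ≤ ENNReal.ofReal δ * ∫⁻ t in Icc (0 : ℝ) 1,
      U.indicator (fun z => ‖fderiv ℝ a z‖ₑ) ((1 - t) • x + t • y) := by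
  have hmem : ∀ t ∈ Icc (0 : ℝ) 1, (1 - t) • x + t • y ∈ U := fun t ht =>
    hUc hx hy (by linarith [ht.2]) ht.1 (by ring)
  have hcont : ContDiffOn ℝ 1 (fun t : ℝ => a ((1 - t) • x + t • y)) (Icc 0 1) :=
    ha.comp (ContDiff.contDiffOn (by fun_prop)) hmem
  have h := enorm_sub_le_lintegral_deriv_of_contDiffOn_Icc hcont zero_le_one
  simp only [sub_self, zero_smul, one_smul, zero_add, sub_zero, add_zero] at h
  rw [← enorm_neg, neg_sub]
  refine h.trans ?_
  rw [← lintegral_const_mul' _ _ ENNReal.ofReal_ne_top]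
  refine setLIntegral_mono' measurableSet_Icc fun t ht => ?_
  have hm := hmem t ht
  rw [indicator_of_mem hm]
  have hc : HasDerivAt (fun t : ℝ => (1 - t) • x + t • y) (y - x) t := by
    have h1 := (((hasDerivAt_id t).const_sub 1).smul_const x).add ((hasDerivAt_id t).smul_const y)
    exact h1.congr_deriv (by module)
  have hda : HasFDerivAt a (fderiv ℝ a ((1 - t) • x + t • y)) ((1 - t) • x + t • y) :=
    ((ha.contDiffAt (hUo.mem_nhds hm)).differentiableAt (by norm_num)).hasFDerivAt
  have e : deriv (fun t : ℝ => a ((1 - t) • x + t • y)) t =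
      fderiv ℝ a ((1 - t) • x + t • y) (y - x) := (hda.comp_hasDerivAt t hc).deriv
  rw [e, mul_comm, ← ofReal_norm, ← ofReal_norm, ← ENNReal.ofReal_mul (norm_nonneg _)]
  apply ENNReal.ofReal_le_ofReal
  refine (ContinuousLinearMap.le_opNorm _ _).trans ?_
  gcongr
  have := hd x hx hy
  rw [mem_ball, dist_eq_norm] at this
  exact this.le

/-- Poincaré inequality on convex sets. -/
theorem exists_poincare {U : Set ℂ} {δ : ℝ} (hUo : IsOpen U) (hUc : Convex ℝ U) (hne : U.Nonempty)
    (hd : ∀ x ∈ U, U ⊆ ball x δ) {a : ℂ → ℝ} (ha : ContDiffOn ℝ 1 a U) :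
    ∃ c : ℝ, ∫⁻ x in U, ‖a x - c‖ₑ ≤
      ENNReal.ofReal (4 * δ) * ∫⁻ x in U, ‖fderiv ℝ a x‖ₑ := by
  set g : ℂ → ℝ≥0∞ := U.indicator (fun z => ‖fderiv ℝ a z‖ₑ)
  have hg : Measurable g := ((measurable_fderiv ℝ a).enorm).indicator hUo.measurableSet
  have hgU : ∫⁻ x, g x = ∫⁻ x in U, ‖fderiv ℝ a x‖ₑ := lintegral_indicator hUo.measurableSet _
  have hslice : ∀ r : ℝ, 1 / 2 ≤ r → ∀ v : ℂ, ∫⁻ x in U, g (r • x + v) ≤ 4 * ∫⁻ x, g x := by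
    intro r hr v
    refine (setLIntegral_le_lintegral _ _).trans ?_
    rw [lintegral_comp_smul_add hg (by linarith)]
    gcongr
    rw [← ENNReal.ofReal_ofNat 4]
    apply ENNReal.ofReal_le_ofReal
    rw [inv_le_comm₀ (by positivity) (by norm_num)]
    nlinarith
  obtain ⟨x₀, hx₀⟩ := hne
  have hU0 : volume U ≠ 0 := (hUo.measure_pos volume ⟨x₀, hx₀⟩).ne'
  have hUt : volume U ≠ ⊤ := ne_top_of_le_ne_top measure_ball_lt_top.ne (measure_mono (hd x₀ hx₀))
  have hmeas : Measurable fun q : ℂ × ℂ × ℝ => g ((1 - q.2.2) • q.2.1 + q.2.2 • q.1) :=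
    hg.comp (by fun_prop)
  set G : ℂ → ℝ≥0∞ := fun y => ∫⁻ x in U, ∫⁻ t in Icc (0 : ℝ) 1, g ((1 - t) • x + t • y)
  have hG : Measurable G := by
    refine Measurable.lintegral_prod_right' (f := fun q : ℂ × ℂ =>
      ∫⁻ t in Icc (0 : ℝ) 1, g ((1 - t) • q.2 + t • q.1)) ?_
    exact Measurable.lintegral_prod_right' (f := fun q : (ℂ × ℂ) × ℝ =>
      g ((1 - q.2) • q.1.2 + q.2 • q.1.1)) (hg.comp (by fun_prop))
  have hGint : ∫⁻ y in U, G y ≤ volume U * (4 * ∫⁻ x, g x) := by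
    have e1 : ∀ y, G y = ∫⁻ t in Icc (0 : ℝ) 1, ∫⁻ x in U, g ((1 - t) • x + t • y) := fun y =>
      lintegral_lintegral_swap (Measurable.aemeasurable (hg.comp (by fun_prop)))
    simp_rw [e1]
    rw [lintegral_lintegral_swap]
    · calc _ ≤ ∫⁻ t in Icc (0 : ℝ) 1, volume U * (4 * ∫⁻ x, g x) := by
            refine setLIntegral_mono' measurableSet_Icc fun t ht => ?_
            rcases le_total t (1 / 2) with h | h
            · calc _ ≤ ∫⁻ y in U, 4 * ∫⁻ x, g x := by
                    refine lintegral_mono fun y => hslice (1 - t) (by linarith) _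
                _ = _ := by rw [setLIntegral_const, mul_comm]
            · have hsw : Measurable (Function.uncurry fun (y x : ℂ) => g ((1 - t) • x + t • y)) :=
                hg.comp (by fun_prop)
              rw [lintegral_lintegral_swap hsw.aemeasurable]
              calc _ ≤ ∫⁻ x in U, 4 * ∫⁻ x, g x := by
                    refine lintegral_mono fun y => ?_
                    simp_rw [add_comm ((1 - t) • y)]
                    exact hslice t h _
                _ = _ := by rw [setLIntegral_const, mul_comm]
        _ = _ := by rw [setLIntegral_const]; simp
    · refine Measurable.aemeasurable (Measurable.lintegral_prod_right'
        (f := fun q : (ℂ × ℝ) × ℂ => g ((1 - q.1.2) • q.2 + q.1.2 • q.1.1)) (hg.comp (by fun_prop)))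
  obtain ⟨y, hy, hGy⟩ := exists_le_setLAverage hU0 hUt hG.aemeasurable
  refine ⟨a y, ?_⟩
  have hGy' : G y ≤ 4 * ∫⁻ x, g x := by
    refine hGy.trans ?_
    rw [setLAverage_eq]
    refine ENNReal.div_le_of_le_mul ?_
    rwa [mul_comm]
  calc ∫⁻ x in U, ‖a x - a y‖ₑ
      ≤ ∫⁻ x in U, ENNReal.ofReal δ * ∫⁻ t in Icc (0 : ℝ) 1, g ((1 - t) • x + t • y) :=
        setLIntegral_mono' hUo.measurableSet fun x hx =>
          enorm_sub_le_lintegral_segment hUo hUc hd ha hx hy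
    _ = ENNReal.ofReal δ * G y := lintegral_const_mul' _ _ ENNReal.ofReal_ne_top
    _ ≤ ENNReal.ofReal δ * (4 * ∫⁻ x, g x) := by gcongr
    _ = _ := by
      rw [hgU, ← mul_assoc, ← ENNReal.ofReal_ofNat 4, mul_comm (4 : ℝ), ENNReal.ofReal_mul']
      norm_num

/-- Weak `L²` functions are integrable on bounded sets. -/
theorem setLIntegral_le_of_weakL2 {D : Set ℂ} {g : ℂ → ℝ} (hg0 : ∀ x, 0 ≤ g x)
    (hg : Measurable g) {N : ℝ} (hN : 0 < N)
    (hw : ∀ t > 0, volume {x ∈ D | t < g x} ≤ ENNReal.ofReal (N ^ 2 / t ^ 2)) {U : Set ℂ}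
    (hU : U ⊆ D) {R : ℝ} (hR : 0 < R) (hUR : volume U ≤ ENNReal.ofReal (π * R ^ 2)) :
    ∫⁻ x in U, ENNReal.ofReal (g x) ≤ ENNReal.ofReal (5 * N * R) := by
  rw [lintegral_eq_lintegral_meas_lt _ (ae_of_all _ hg0) hg.aemeasurable]
  set τ := N / R
  have hτ : 0 < τ := by positivity
  have hpt : ∀ t > 0, volume.restrict U {x | t < g x} ≤ ENNReal.ofReal (N ^ 2 / t ^ 2) := by
    intro t ht
    rw [Measure.restrict_apply (measurableSet_lt measurable_const hg)]
    refine (measure_mono ?_).trans (hw t ht)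
    exact fun x hx => ⟨hU hx.2, hx.1⟩
  rw [← Ioc_union_Ioi_eq_Ioi hτ.le, lintegral_union measurableSet_Ioi (Ioc_disjoint_Ioi le_rfl)]
  have h1 : ∫⁻ t in Ioc 0 τ, volume.restrict U {x | t < g x} ≤ ENNReal.ofReal (4 * N * R) := by
    calc _ ≤ ∫⁻ t in Ioc 0 τ, ENNReal.ofReal (π * R ^ 2) := by
          refine lintegral_mono fun t => ?_
          refine le_trans ?_ hUR
          exact (measure_mono (subset_univ _)).trans_eq (by simp)
      _ = ENNReal.ofReal (π * R ^ 2 * τ) := by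
          rw [setLIntegral_const, Real.volume_Ioc, sub_zero, ← ENNReal.ofReal_mul (by positivity)]
      _ ≤ _ := by
          apply ENNReal.ofReal_le_ofReal
          rw [show π * R ^ 2 * τ = π * (N * R) by simp only [τ]; field_simp]
          nlinarith [pi_lt_four, mul_pos hN hR]
  have h2 : ∫⁻ t in Ioi τ, volume.restrict U {x | t < g x} ≤ ENNReal.ofReal (N * R) := by
    have hi := integrableOn_Ioi_rpow_of_lt (show (-2 : ℝ) < -1 by norm_num) hτ
    calc _ ≤ ∫⁻ t in Ioi τ, ENNReal.ofReal (N ^ 2 * t ^ (-2 : ℝ)) := by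
          refine setLIntegral_mono' measurableSet_Ioi fun t ht => ?_
          have ht0 : 0 < t := hτ.trans ht
          refine (hpt t ht0).trans (le_of_eq ?_)
          rw [Real.rpow_neg ht0.le]
          norm_num [div_eq_mul_inv]
      _ = ENNReal.ofReal (∫ t in Ioi τ, N ^ 2 * t ^ (-2 : ℝ)) := by
          rw [ofReal_integral_eq_lintegral_ofReal (hi.const_mul _)]
          filter_upwards [self_mem_ae_restrict measurableSet_Ioi] with t ht
          have ht0 : 0 < t := hτ.trans ht
          positivity
      _ = _ := by
          rw [integral_const_mul, integral_Ioi_rpow_of_lt (by norm_num) hτ]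
          congr 1
          norm_num
          rw [Real.rpow_neg hτ.le, Real.rpow_one]
          simp only [τ]; field_simp
  refine (add_le_add h1 h2).trans_eq ?_
  rw [← ENNReal.ofReal_add (by positivity) (by positivity)]
  congr 1; ring

theorem le_maxFn_of_isOpen {Q : Set ℂ} (hQ : IsOpen Q) {y : ℂ} (hy : y ∈ Q) {g : ℂ → ℝ≥0∞}
    {B : ℝ} (hg : ∀ x ∈ Q, ENNReal.ofReal B ≤ g x) : ENNReal.ofReal B ≤ maxFn g y := by
  obtain ⟨r, hr, hrQ⟩ := Metric.isOpen_iff.1 hQ y hy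
  have h0 : ENNReal.ofReal (r ^ 2) ≠ 0 := by
    rw [Ne, ENNReal.ofReal_eq_zero, not_le]; positivity
  refine (ENNReal.mul_le_mul_iff_right h0 ENNReal.ofReal_ne_top).1
    (le_trans ?_ (lintegral_ball_le_maxFn g y hr))
  calc ENNReal.ofReal (r ^ 2) * ENNReal.ofReal B ≤ ∫⁻ x in ball y r, ENNReal.ofReal B := by
        rw [setLIntegral_const, volume_ball_eq _ hr.le, mul_comm]
        gcongr
        nlinarith [pi_gt_three, sq_nonneg r]
    _ ≤ _ := setLIntegral_mono' measurableSet_ball fun x hx => hg x (hrQ hx)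

/-- John–Nirenberg type bound for functions with gradient in weak `L²` of the unit disc. -/
theorem exists_john_nirenberg {m : ℝ} (hm : 1 < m) : ∃ C > (0 : ℝ), ∀ N > (0 : ℝ), ∀ a : ℂ → ℝ,
    ContDiffOn ℝ 1 a (ball 0 1) →
    (∀ t > 0, volume {x ∈ ball (0 : ℂ) 1 | t < ‖fderiv ℝ a x‖} ≤ ENNReal.ofReal (N ^ 2 / t ^ 2)) →
    ∀ x₀ ∈ ball (0 : ℂ) 1, ∀ ρ, 0 < ρ → ρ ≤ 2 → ∃ c : ℝ,
      ∫⁻ x in ball x₀ ρ ∩ ball 0 1, ENNReal.ofReal (|a x - c| ^ m) ≤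
        ENNReal.ofReal (C * N ^ m * ρ ^ 2) := by
  obtain ⟨C, hC, hmain⟩ := exists_sharp_maximal_bound ℝ (κ := 1 / 16) (s := 1) (p₀ := m) (p₁ := m)
    (by norm_num) (by norm_num) le_rfl hm
  refine ⟨C * (40 ^ m * π), by positivity, fun N hN a ha hw x₀ hx₀ ρ hρ hρ2 => ?_⟩
  have hosc : ∀ x r, 0 < r → ∀ V : Set ℂ, V ⊆ ball x r → IsOpen V → Convex ℝ V → V.Nonempty →
      V ⊆ ball 0 1 → ∃ c : ℝ, ∫⁻ z in V, ‖a z - c‖ₑ ≤ ENNReal.ofReal (40 * N * r ^ 2) := by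
    intro x r hr V hV hVo hVc hVn hVD
    obtain ⟨c, hc⟩ := exists_poincare (δ := 2 * r) hVo hVc hVn (fun z hz w hw => by
      have h1 := mem_ball.1 (hV hz)
      have h2 := mem_ball.1 (hV hw)
      rw [mem_ball]
      linarith [dist_triangle_right w z x]) (ha.mono hVD)
    refine ⟨c, hc.trans ?_⟩
    have h3 := setLIntegral_le_of_weakL2 (g := fun z => ‖fderiv ℝ a z‖) (fun _ => norm_nonneg _)
      (measurable_fderiv ℝ a).norm hN hw hVD hr
      ((measure_mono hV).trans_eq (volume_ball_eq x hr.le))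
    simp_rw [ofReal_norm] at h3
    refine (mul_le_mul_right h3 _).trans_eq ?_
    rw [← ENNReal.ofReal_mul (by positivity)]; congr 1; ring
  set Q := ball x₀ ρ ∩ ball (0 : ℂ) 1
  have hQo : IsOpen Q := isOpen_ball.inter isOpen_ball
  have hQc : Convex ℝ Q := (convex_ball _ _).inter (convex_ball _ _)
  have hQD : Q ⊆ ball 0 1 := inter_subset_right
  obtain ⟨c, hc⟩ := hosc x₀ ρ hρ Q inter_subset_left hQo hQc ⟨x₀, mem_ball_self hρ, hx₀⟩ hQD
  refine ⟨c, ?_⟩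
  set F : ℂ → ℝ := Q.indicator fun z => a z - c
  have hFQ : ∀ z ∈ Q, F z = a z - c := fun z hz => indicator_of_mem hz _
  have hcont : ContinuousOn (fun z => a z - c) Q := (ha.continuousOn.mono hQD).sub continuousOn_const
  have hFI : ∀ V ⊆ Q, MeasurableSet V → ∀ c' : ℝ,
      ∫⁻ z in V, ‖F z - (c' - c)‖ₑ = ∫⁻ z in V, ‖a z - c'‖ₑ := by
    intro V hV hVm c'
    refine setLIntegral_congr_fun hVm fun z hz => ?_
    rw [hFQ z (hV hz), sub_sub_sub_cancel_right]
  have hFI0 : ∫⁻ z in Q, ‖F z‖ₑ = ∫⁻ z in Q, ‖a z - c‖ₑ := by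
    simpa using hFI Q subset_rfl hQo.measurableSet c
  set f : ℂ → ℝ := Q.indicator fun _ => 40 * N
  have hf0 : ∀ x, 0 ≤ f x := fun x => indicator_nonneg (fun _ _ => by positivity) x
  have hQvol : volume Q ≤ ENNReal.ofReal (π * ρ ^ 2) :=
    (measure_mono inter_subset_left).trans_eq (volume_ball_eq x₀ hρ.le)
  have hfp : ∀ q : ℝ, 0 < q → ∫⁻ y, ENNReal.ofReal (f y ^ q) ≤
      ENNReal.ofReal ((40 * N) ^ q * (π * ρ ^ 2)) := by
    intro q hq
    have e : ∀ y, ENNReal.ofReal (f y ^ q) =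
        Q.indicator (fun _ => ENNReal.ofReal ((40 * N) ^ q)) y := by
      intro y
      by_cases hy : y ∈ Q
      · simp [f, hy]
      · simp [f, hy, Real.zero_rpow hq.ne']
    simp_rw [e]
    rw [lintegral_indicator_const hQo.measurableSet, ENNReal.ofReal_mul (by positivity)]
    gcongr
  have hmax : ∀ y ∈ Q, ENNReal.ofReal (40 * N) ≤
      maxFn (fun y => ENNReal.ofReal (f y ^ (1 : ℝ))) y ^ (1 / (1 : ℝ)) := by
    intro y hy
    simp only [div_one, ENNReal.rpow_one, Real.rpow_one]
    refine le_maxFn_of_isOpen hQo hy fun x hx => ?_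
    simp [f, hx]
  have := hmain Q (2 * ρ) (isThick_ball_inter_unitDisc hx₀ hρ hρ2) F
    (hcont.congr hFQ) (by
      exact (measurable_indicator_of_continuousOn hQo hcont).stronglyMeasurable) (by
      rw [hFI0]; exact ne_top_of_le_ne_top ENNReal.ofReal_ne_top hc) f hf0
    (measurable_const.indicator hQo.measurableSet)
    (ne_top_of_le_ne_top ENNReal.ofReal_ne_top (hfp 1 one_pos)) (by
      intro x hx r hr hr2
      obtain ⟨c', hc'⟩ := hosc x r hr (ball x r ∩ Q) inter_subset_left (isOpen_ball.inter hQo)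
        ((convex_ball _ _).inter hQc) ⟨x, mem_ball_self hr, hx⟩ (inter_subset_right.trans hQD)
      refine ⟨c' - c, fun y hy => ?_⟩
      rw [hFI _ inter_subset_right (measurableSet_ball.inter hQo.measurableSet)]
      refine hc'.trans (le_trans (le_of_eq ?_) (mul_le_mul_right (hmax y hy.2) _))
      rw [← ENNReal.ofReal_mul (by positivity)]; congr 1; ring) (by
      intro y hy
      rw [hFI0]
      refine hc.trans (le_trans ?_ (mul_le_mul_right (hmax y hy) _))
      rw [← ENNReal.ofReal_mul (by positivity)]
      apply ENNReal.ofReal_le_ofReal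
      nlinarith [mul_pos hN (pow_pos hρ 2)]) m ⟨le_rfl, le_rfl⟩
  calc ∫⁻ x in Q, ENNReal.ofReal (|a x - c| ^ m) = ∫⁻ y in Q, ENNReal.ofReal (‖F y‖ ^ m) := by
        refine setLIntegral_congr_fun hQo.measurableSet fun z hz => ?_
        rw [hFQ z hz, Real.norm_eq_abs]
    _ ≤ _ := this
    _ ≤ ENNReal.ofReal C * ENNReal.ofReal ((40 * N) ^ m * (π * ρ ^ 2)) := by
        gcongr; exact hfp m (by linarith)
    _ = _ := by
        rw [← ENNReal.ofReal_mul (by positivity), Real.mul_rpow (by norm_num) hN.le]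
        congr 1; ring

end WenteDisk

end

section

open MeasureTheory Metric Real Set Filter Topology
open scoped ENNReal NNReal ContDiff Manifold

namespace WenteDisk

/-- Smooth functions with compact support in `U`. -/
structure IsTest {E : Type*} [NormedAddCommGroup E] [NormedSpace ℝ E] (U : Set ℂ) (h : ℂ → E) :
    Prop where
  smooth : ContDiff ℝ ∞ h
  compact : HasCompactSupport h
  subset : tsupport h ⊆ U

theorem contDiff_of_tsupport_subset {E : Type*} [NormedAddCommGroup E] [NormedSpace ℝ E]
    {n : WithTop ℕ∞} {U : Set ℂ} (hU : IsOpen U) {f : ℂ → E} (hf : ContDiffOn ℝ n f U)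
    (hs : tsupport f ⊆ U) : ContDiff ℝ n f := by
  rw [contDiff_iff_contDiffAt]
  intro x
  by_cases hx : x ∈ tsupport f
  · exact hf.contDiffAt (hU.mem_nhds (hs hx))
  · have : f =ᶠ[𝓝 x] fun _ => 0 := notMem_tsupport_iff_eventuallyEq.1 hx
    exact contDiffAt_const.congr_of_eventuallyEq this

theorem IsTest.mono {E : Type*} [NormedAddCommGroup E] [NormedSpace ℝ E] {U V : Set ℂ}
    {h : ℂ → E} (hh : IsTest U h) (hUV : U ⊆ V) : IsTest V h :=
  ⟨hh.smooth, hh.compact, hh.subset.trans hUV⟩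

theorem IsTest.smul_of_contDiffOn {E : Type*} [NormedAddCommGroup E] [NormedSpace ℝ E] {U : Set ℂ}
    {η : ℂ → ℝ} (hη : IsTest U η) (hU : IsOpen U) {f : ℂ → E} (hf : ContDiffOn ℝ ∞ f U) :
    IsTest U (fun z => η z • f z) := by
  have hs : tsupport (fun z => η z • f z) ⊆ tsupport η := tsupport_smul_subset_left η f
  exact ⟨contDiff_of_tsupport_subset hU (hη.smooth.contDiffOn.smul hf) (hs.trans hη.subset),
    hη.compact.of_isClosed_subset (isClosed_tsupport _) hs, hs.trans hη.subset⟩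

theorem IsTest.continuous_inner {U : Set ℂ} {h : ℂ → ℂ} (hh : IsTest U h) (hU : IsOpen U)
    {F : ℂ → ℂ} (hF : ContinuousOn F U) : Continuous fun z => inner ℝ (F z) (h z) := by
  refine continuous_of_tsupport fun x hx => ?_
  have hx' : x ∈ tsupport h := by
    refine closure_mono ?_ hx
    intro y hy hy'
    exact hy (by simp [hy'])
  exact (hF.continuousAt (hU.mem_nhds (hh.subset hx'))).inner hh.smooth.continuous.continuousAt

theorem IsTest.integrable_inner {U : Set ℂ} {h : ℂ → ℂ} (hh : IsTest U h) (hU : IsOpen U)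
    {F : ℂ → ℂ} (hF : ContinuousOn F U) : Integrable fun z => inner ℝ (F z) (h z) := by
  refine (hh.continuous_inner hU hF).integrable_of_hasCompactSupport ?_
  refine hh.compact.mono ?_
  intro y hy hy'
  exact hy (by simp [hy'])

theorem exists_test_eq_one {K U : Set ℂ} (hK : IsCompact K) (hU : IsOpen U) (hKU : K ⊆ U) :
    ∃ η : ℂ → ℝ, IsTest U η ∧ (∀ z, 0 ≤ η z) ∧ (∀ z, η z ≤ 1) ∧ ∀ z ∈ K, η z = 1 := by
  obtain ⟨L, hL, hKL, hLU⟩ := exists_compact_between hK hU hKU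
  obtain ⟨f, hf1, hf0, hf⟩ := exists_contMDiffMap_one_nhds_of_subset_interior 𝓘(ℝ, ℂ)
    (n := ⊤) hK.isClosed hKL
  have hs : tsupport f ⊆ L := closure_minimal
    (fun x hx => by_contra fun h => hx (hf0 x h)) hL.isClosed
  exact ⟨f, ⟨f.contMDiff.contDiff, hL.of_isClosed_subset (isClosed_tsupport _) hs,
    hs.trans hLU⟩, fun z => (hf z).1, fun z => (hf z).2, fun z hz => hf1.self_of_nhdsSet z hz⟩

theorem IsTest.norm_integral_le {E : Type*} [NormedAddCommGroup E] [NormedSpace ℝ E] {U : Set ℂ}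
    {h : ℂ → E} (hh : IsTest U h) (hU : volume U ≠ ⊤) (h1 : ∀ z, ‖h z‖ ≤ 1) :
    ‖∫ z, h z‖ ≤ (volume U).toReal := by
  have : ∫ z, h z = ∫ z in U, h z := by
    rw [setIntegral_eq_integral_of_forall_compl_eq_zero]
    intro x hx
    exact image_eq_zero_of_notMem_tsupport fun h => hx (hh.subset h)
  rw [this]
  simpa [Measure.real] using norm_setIntegral_le_of_norm_le_const hU.lt_top (fun z _ => h1 z)

theorem lintegral_enorm_le_of_test {U : Set ℂ} (hU : IsOpen U) {F : ℂ → ℂ}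
    (hF : ContDiffOn ℝ ∞ F U) {M : ℝ}
    (hM : ∀ h : ℂ → ℂ, IsTest U h → (∀ z, ‖h z‖ ≤ 1) → ∫ z, inner ℝ (F z) (h z) ≤ M) :
    ∫⁻ z in U, ‖F z‖ₑ ≤ ENNReal.ofReal M := by
  have key : ∀ K : Set ℂ, IsCompact K → K ⊆ U → ∫⁻ z in K, ‖F z‖ₑ ≤ ENNReal.ofReal M := by
    intro K hK hKU
    obtain ⟨η, hη, hη0, hη1, hηK⟩ := exists_test_eq_one hK hU hKU
    have hηF : IsTest U (fun z => η z • F z) := hη.smul_of_contDiffOn hU hF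
    have hInt : Integrable fun z => η z * ‖F z‖ := by
      have := (hηF.smooth.continuous.integrable_of_hasCompactSupport (μ := volume)
        hηF.compact).norm
      refine this.congr (ae_of_all _ fun z => ?_)
      simp [abs_of_nonneg (hη0 z)]
    have hηint : Integrable η := hη.smooth.continuous.integrable_of_hasCompactSupport hη.compact
    have hreal : ∀ ε > (0 : ℝ), ∫ z, η z * ‖F z‖ ≤ M + ε * ∫ z, η z := by
      intro ε hε
      set h : ℂ → ℂ := fun z => η z • ((√(ε ^ 2 + ‖F z‖ ^ 2))⁻¹ • F z) with hh
      have hpos : ∀ z, 0 < ε ^ 2 + ‖F z‖ ^ 2 := fun z => by positivity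
      have htest : IsTest U h := by
        refine hη.smul_of_contDiffOn hU ((ContDiffOn.inv (ContDiffOn.sqrt ?_ ?_) ?_).smul hF)
        · exact contDiffOn_const.add (hF.norm_sq ℝ)
        · exact fun z _ => (hpos z).ne'
        · exact fun z _ => (Real.sqrt_pos.2 (hpos z)).ne'
      have hle : ∀ z, ‖F z‖ ≤ √(ε ^ 2 + ‖F z‖ ^ 2) := fun z =>
        Real.le_sqrt_of_sq_le (by nlinarith)
      have hnorm : ∀ z, ‖h z‖ ≤ 1 := by
        intro z
        simp only [hh, norm_smul, norm_inv, Real.norm_eq_abs, abs_of_nonneg (hη0 z),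
          abs_of_nonneg (Real.sqrt_nonneg _)]
        have h3 : (√(ε ^ 2 + ‖F z‖ ^ 2))⁻¹ * ‖F z‖ ≤ 1 := by
          rw [inv_mul_le_iff₀ (Real.sqrt_pos.2 (hpos z)), mul_one]; exact hle z
        exact mul_le_one₀ (hη1 z) (by positivity) h3
      have hb := hM h htest hnorm
      have hlow : ∫ z, (η z * ‖F z‖ - ε * η z) ≤ ∫ z, inner ℝ (F z) (h z) := by
        refine integral_mono (hInt.sub (hηint.const_mul ε))
          (htest.integrable_inner hU hF.continuousOn) fun z => ?_
        simp only [hh, inner_smul_right, real_inner_self_eq_norm_sq]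
        have hs := Real.sqrt_pos.2 (hpos z)
        have hs2 := Real.sq_sqrt (hpos z).le
        have : ‖F z‖ - ε ≤ (√(ε ^ 2 + ‖F z‖ ^ 2))⁻¹ * ‖F z‖ ^ 2 := by
          rw [le_inv_mul_iff₀ hs]
          have h4 : √(ε ^ 2 + ‖F z‖ ^ 2) ≤ ‖F z‖ + ε :=
            Real.sqrt_le_iff.2 ⟨by positivity, by nlinarith [norm_nonneg (F z)]⟩
          nlinarith [norm_nonneg (F z), hle z]
        nlinarith [hη0 z]
      rw [integral_sub hInt (hηint.const_mul ε), integral_const_mul] at hlow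
      linarith
    have hreal' : ∫ z, η z * ‖F z‖ ≤ M := by
      have ht : Tendsto (fun ε : ℝ => M + ε * ∫ z, η z) (𝓝[>] 0) (𝓝 (M + 0 * ∫ z, η z)) :=
        ((continuous_const.add (continuous_id.mul continuous_const)).tendsto 0).mono_left
          nhdsWithin_le_nhds
      have := ge_of_tendsto ht (eventually_mem_nhdsWithin.mono fun ε hε => hreal ε hε)
      simpa using this
    calc ∫⁻ z in K, ‖F z‖ₑ ≤ ∫⁻ z in K, ENNReal.ofReal (η z * ‖F z‖) := by
          refine setLIntegral_mono' hK.measurableSet fun z hz => ?_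
          rw [hηK z hz, one_mul, ofReal_norm]
      _ ≤ ∫⁻ z, ENNReal.ofReal (η z * ‖F z‖) := setLIntegral_le_lintegral _ _
      _ = ENNReal.ofReal (∫ z, η z * ‖F z‖) := by
          rw [ofReal_integral_eq_lintegral_ofReal hInt
            (ae_of_all _ fun z => mul_nonneg (hη0 z) (norm_nonneg _))]
      _ ≤ ENNReal.ofReal M := ENNReal.ofReal_le_ofReal hreal'
  obtain ⟨Kc, hKc, hKU, hKun, hKm⟩ := hU.exists_iUnion_isClosed
  have hun : U = ⋃ n, Kc n ∩ closedBall 0 n := by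
    apply subset_antisymm
    · intro z hz
      rw [← hKun] at hz
      obtain ⟨n, hn⟩ := mem_iUnion.1 hz
      obtain ⟨k, hk⟩ := exists_nat_ge ‖z‖
      refine mem_iUnion.2 ⟨max n k, hKm (le_max_left _ _) hn, ?_⟩
      rw [mem_closedBall_zero_iff]
      exact hk.trans (by exact_mod_cast le_max_right _ _)
    · exact iUnion_subset fun n => inter_subset_left.trans (hKU n)
  rw [hun, setLIntegral_iUnion_of_directed]
  · refine iSup_le fun n => key _ ?_ (inter_subset_left.trans (hKU n))
    exact (isCompact_closedBall _ _).inter_left (hKc n)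
  · refine directed_of_isDirected_le fun m n hmn => inter_subset_inter (hKm hmn) ?_
    exact closedBall_subset_closedBall (by exact_mod_cast hmn)

theorem exists_lintegral_enorm_sub_le_of_test {U : Set ℂ} (hU : IsOpen U) (hne : U.Nonempty)
    (hv : volume U ≠ ⊤) {F : ℂ → ℂ} (hF : ContDiffOn ℝ ∞ F U) {M : ℝ}
    (hM : ∀ h : ℂ → ℂ, IsTest U h → (∀ z, ‖h z‖ ≤ 1) → ∫ z, h z = 0 →
      ∫ z, inner ℝ (F z) (h z) ≤ M) :
    ∃ c : ℂ, ∫⁻ z in U, ‖F z - c‖ₑ ≤ ENNReal.ofReal (3 * M) := by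
  have hvpos : 0 < volume U := hU.measure_pos volume hne
  have hVpos : 0 < (volume U).toReal := ENNReal.toReal_pos hvpos.ne' hv
  obtain ⟨K, hKU, hK, hKv⟩ := hU.exists_lt_isCompact (r := volume U / 2)
    (ENNReal.half_lt_self hvpos.ne' hv)
  obtain ⟨η, hη, hη0, hη1, hηK⟩ := exists_test_eq_one hK hU hKU
  have hηint : Integrable η := hη.smooth.continuous.integrable_of_hasCompactSupport hη.compact
  set I := ∫ z, η z with hI
  have hIge : (volume U).toReal / 2 ≤ I := by
    have h1 : volume.real K ≤ I := by
      calc volume.real K = ∫ z in K, (1 : ℝ) := by simp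
        _ = ∫ z in K, η z := setIntegral_congr_fun hK.measurableSet fun z hz => (hηK z hz).symm
        _ ≤ I := setIntegral_le_integral hηint (ae_of_all _ hη0)
    have h2 : (volume U / 2).toReal ≤ (volume K).toReal :=
      ENNReal.toReal_mono hK.measure_lt_top.ne hKv.le
    rw [ENNReal.toReal_div] at h2
    exact le_trans (by simpa [Measure.real] using h2) h1
  have hIpos : 0 < I := by linarith
  have hηF : IsTest U (fun z => η z • F z) := hη.smul_of_contDiffOn hU hF
  have hηFint : Integrable fun z => η z • F z :=
    hηF.smooth.continuous.integrable_of_hasCompactSupport hηF.compact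
  set c := I⁻¹ • ∫ z, η z • F z with hc
  refine ⟨c, lintegral_enorm_le_of_test hU (hF.sub contDiffOn_const) fun h hh h1 => ?_⟩
  set w := ∫ z, h z with hw
  have hwle : ‖w‖ ≤ (volume U).toReal := hh.norm_integral_le hv h1
  have hhint : Integrable h := hh.smooth.continuous.integrable_of_hasCompactSupport hh.compact
  set g : ℂ → ℂ := fun z => (1 / 3 : ℝ) • (h z - η z • (I⁻¹ • w)) with hg
  have hgt : IsTest U g := by
    have hηw : IsTest U (fun z => η z • (I⁻¹ • w)) := hη.smul_of_contDiffOn hU contDiffOn_const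
    have hs : tsupport g ⊆ tsupport h ∪ tsupport η := by
      refine closure_minimal (fun z hz => ?_) ((isClosed_tsupport _).union (isClosed_tsupport _))
      by_contra hcon
      simp only [mem_union, not_or] at hcon
      exact hz (by simp [hg, image_eq_zero_of_notMem_tsupport hcon.1,
        image_eq_zero_of_notMem_tsupport hcon.2])
    refine ⟨(hh.smooth.sub hηw.smooth).const_smul (1 / 3 : ℝ), ?_,
      hs.trans (union_subset hh.subset hη.subset)⟩
    exact (IsCompact.union hh.compact hη.compact).of_isClosed_subset (isClosed_tsupport _) hs
  have hg1 : ∀ z, ‖g z‖ ≤ 1 := by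
    intro z
    have h3 : ‖η z • (I⁻¹ • w)‖ ≤ 2 := by
      rw [norm_smul, norm_smul, Real.norm_of_nonneg (hη0 z), Real.norm_of_nonneg (by positivity)]
      have : I⁻¹ * ‖w‖ ≤ 2 := by
        rw [inv_mul_le_iff₀ hIpos]; linarith
      nlinarith [hη0 z, hη1 z, norm_nonneg w, mul_nonneg (inv_nonneg.2 hIpos.le) (norm_nonneg w)]
    rw [hg, norm_smul, Real.norm_of_nonneg (by norm_num)]
    have := norm_sub_le (h z) (η z • (I⁻¹ • w))
    linarith [h1 z]
  have hηwint : Integrable fun z => η z • (I⁻¹ • w) := hηint.smul_const _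
  have hg0 : ∫ z, g z = 0 := by
    rw [hg, integral_smul, integral_sub hhint hηwint, integral_smul_const, ← hI, smul_smul,
      mul_inv_cancel₀ hIpos.ne', one_smul, sub_self, smul_zero]
  have hb := hM g hgt hg1 hg0
  have e1 : ∫ z, inner ℝ (F z) (g z) =
      (1 / 3) * ((∫ z, inner ℝ (F z) (h z)) - I⁻¹ * inner ℝ (∫ z, η z • F z) w) := by
    have hi1 := hh.integrable_inner hU hF.continuousOn
    have hi2 : Integrable fun z => I⁻¹ * inner ℝ (η z • F z) w :=
      (hηFint.inner_const w).const_mul _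
    have : ∀ z, inner ℝ (F z) (g z) =
        (1 / 3) * (inner ℝ (F z) (h z) - I⁻¹ * inner ℝ (η z • F z) w) := by
      intro z
      simp only [hg, inner_smul_right, inner_sub_right, real_inner_smul_left]
      ring
    simp_rw [this]
    rw [integral_const_mul, integral_sub hi1 hi2, integral_const_mul]
    congr 3
    have := integral_inner (𝕜 := ℝ) hηFint w
    simp_rw [real_inner_comm w]
    rw [this, real_inner_comm]
  have e2 : ∫ z, inner ℝ (F z - c) (h z) =
      (∫ z, inner ℝ (F z) (h z)) - I⁻¹ * inner ℝ (∫ z, η z • F z) w := by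
    simp_rw [inner_sub_left]
    have hi3 : Integrable fun z => inner ℝ c (h z) := hhint.const_inner c
    rw [integral_sub (hh.integrable_inner hU hF.continuousOn) hi3, integral_inner hhint, hc,
      real_inner_smul_left]
  rw [e1] at hb
  rw [e2]
  linarith

end WenteDisk

end

section

open MeasureTheory Metric Real Set Filter Topology
open scoped ENNReal NNReal ContDiff Convolution ComplexConjugate

namespace WenteDisk

theorem locallyIntegrable_inv : LocallyIntegrable (fun w : ℂ => w⁻¹) := by
  intro x
  refine ⟨ball 0 (‖x‖ + 1), isOpen_ball.mem_nhds (by simp), ?_⟩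
  have h : IntegrableOn (fun w : ℂ => ‖w‖⁻¹) (ball (0 : ℂ) (‖x‖ + 1)) := by
    rw [integrableOn_fun_norm_addHaar volume (f := fun y => y⁻¹)]
    simp only [Complex.finrank_real_complex]
    refine IntegrableOn.congr_fun (f := fun _ => (1 : ℝ)) ?_ ?_ measurableSet_Ioo
    · exact integrableOn_const (by simp)
    · intro y hy
      have : y ≠ 0 := hy.1.ne'
      simp [this]
  refine Integrable.mono h measurable_inv.aestronglyMeasurable (ae_of_all _ fun w => ?_)
  simp

theorem integral_dbar_div {k : ℂ → ℂ} (hk : ContDiff ℝ 1 k) (hc : HasCompactSupport k) :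
    ∫ w, w⁻¹ * (fderiv ℝ k w 1 + Complex.I * fderiv ℝ k w Complex.I) = -(2 * π) * k 0 := by
  set e : ℝ → ℂ := fun θ => Real.cos θ + Real.sin θ * Complex.I with he
  have hec : Continuous e := by fun_prop
  have hdk : Continuous (fderiv ℝ k) := hk.continuous_fderiv (by norm_num)
  set X : ℝ × ℝ → ℂ := fun p => fderiv ℝ k (p.1 * e p.2) (e p.2) with hX
  set Y : ℝ × ℝ → ℂ := fun p => fderiv ℝ k (p.1 * e p.2) (Complex.I * e p.2) with hY
  have hXc : Continuous X := by fun_prop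
  have hYc : Continuous Y := by fun_prop
  have hen : ∀ θ, ‖e θ‖ = 1 := by
    intro θ
    have : e θ = Complex.exp (θ * Complex.I) := by
      rw [Complex.exp_mul_I]; simp [he]
    rw [this, Complex.norm_exp_ofReal_mul_I]
  obtain ⟨R, hR⟩ : ∃ R : ℝ, ∀ w : ℂ, R < ‖w‖ → w ∉ tsupport k := by
    obtain ⟨R, hR⟩ := hc.isBounded.subset_closedBall (0 : ℂ)
    exact ⟨R, fun w hw hw' => by have := hR hw'; simp at this; linarith⟩
  have hzero : ∀ w : ℂ, R < ‖w‖ → fderiv ℝ k w = 0 := fun w hw =>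
    image_eq_zero_of_notMem_tsupport fun h => hR w hw (tsupport_fderiv_subset ℝ h)
  have hInt : ∀ Z : ℝ × ℝ → ℂ, Continuous Z → (∀ p : ℝ × ℝ, R < p.1 → 0 < p.1 → Z p = 0) →
      IntegrableOn Z (Ioi 0 ×ˢ Ioo (-π) π) := by
    intro Z hZ hZ0
    have h1 : IntegrableOn Z (Icc 0 R ×ˢ Icc (-π) π) :=
      hZ.continuousOn.integrableOn_compact (isCompact_Icc.prod isCompact_Icc)
    have h2 : IntegrableOn Z ((Ioi 0 ×ˢ Ioo (-π) π) \ (Icc 0 R ×ˢ Icc (-π) π)) := by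
      refine (integrableOn_zero (ε' := ℂ)).congr_fun ?_ ((measurableSet_Ioi.prod measurableSet_Ioo).diff
        (measurableSet_Icc.prod measurableSet_Icc))
      intro p hp
      obtain ⟨⟨hp1, hp2⟩, hp3⟩ := hp
      have h0 : 0 < p.1 := hp1
      refine (hZ0 p ?_ h0).symm
      by_contra hcon
      exact hp3 ⟨⟨h0.le, not_lt.1 hcon⟩, hp2.1.le, hp2.2.le⟩
    refine (h1.union h2).mono_set fun p hp => ?_
    by_cases h : p ∈ (Icc 0 R ×ˢ Icc (-π) π)
    · exact Or.inl h
    · exact Or.inr ⟨hp, h⟩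
  have hnorm : ∀ p : ℝ × ℝ, 0 < p.1 → ‖(p.1 : ℂ) * e p.2‖ = p.1 := fun p hp => by
    rw [norm_mul, hen, mul_one, Complex.norm_real, Real.norm_of_nonneg hp.le]
  have hXi : IntegrableOn X (Ioi 0 ×ˢ Ioo (-π) π) := hInt X hXc fun p hp hp0 => by
    simp [hX, hzero _ (by rwa [hnorm p hp0])]
  have hYi : IntegrableOn Y (Ioi 0 ×ˢ Ioo (-π) π) := hInt Y hYc fun p hp hp0 => by
    simp [hY, hzero _ (by rwa [hnorm p hp0])]
  have hrad : ∀ θ : ℝ, ∫ r in Ioi (0 : ℝ), X (r, θ) = -k 0 := by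
    intro θ
    set f : ℝ → ℂ := fun r => k (r * e θ) with hf
    have hd : ∀ r : ℝ, HasDerivAt f (X (r, θ)) r := by
      intro r
      have h1 : HasDerivAt (fun r : ℝ => (r : ℂ) * e θ) (e θ) r := by
        simpa using (Complex.ofRealCLM.hasDerivAt (x := r)).mul_const (e θ)
      exact ((hk.differentiable (by norm_num) _).hasFDerivAt.comp_hasDerivAt r h1)
    have hX1 : IntegrableOn (fun r => X (r, θ)) (Ioi 0) := by
      have h1 : IntegrableOn (fun r => X (r, θ)) (Icc 0 R) :=
        (hXc.comp (by fun_prop : Continuous fun r : ℝ => (r, θ))).continuousOn.integrableOn_compact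
          isCompact_Icc
      have h2 : IntegrableOn (fun r => X (r, θ)) (Ioi 0 \ Icc 0 R) := by
        refine (integrableOn_zero (ε' := ℂ)).congr_fun ?_ (measurableSet_Ioi.diff measurableSet_Icc)
        intro r hr
        have h0 : 0 < r := hr.1
        have h3 : R < r := by
          by_contra hcon
          exact hr.2 ⟨h0.le, not_lt.1 hcon⟩
        simp [hX, hzero ((r : ℂ) * e θ) (by rw [hnorm (r, θ) h0]; exact h3)]
      refine (h1.union h2).mono_set fun r hr => ?_
      by_cases h : r ∈ Icc 0 R
      · exact Or.inl h
      · exact Or.inr ⟨hr, h⟩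
    rw [integral_Ioi_of_hasDerivAt_of_tendsto' (m := 0) (fun r _ => hd r) hX1]
    · simp [hf]
    · refine tendsto_const_nhds.congr' ?_
      filter_upwards [eventually_gt_atTop (max R 0)] with r hr
      refine (image_eq_zero_of_notMem_tsupport (hR _ ?_)).symm
      rw [hnorm (r, θ) ((le_max_right _ _).trans_lt hr)]
      exact (le_max_left _ _).trans_lt hr
  have hang : ∀ r : ℝ, 0 < r → ∫ θ in Ioo (-π) π, Y (r, θ) = 0 := by
    intro r hr
    have hd : ∀ θ : ℝ, HasDerivAt (fun θ : ℝ => k (r * e θ)) (r * Y (r, θ)) θ := by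
      intro θ
      have h1 : HasDerivAt e (Complex.I * e θ) θ := by
        have h2 : HasDerivAt e ((-Real.sin θ : ℝ) + (Real.cos θ : ℝ) * Complex.I) θ :=
          ((Real.hasDerivAt_cos θ).ofReal_comp).add
            (((Real.hasDerivAt_sin θ).ofReal_comp).mul_const Complex.I)
        convert h2 using 1
        simp only [he, Complex.ofReal_neg]
        linear_combination (Real.sin θ : ℂ) * Complex.I_sq
      have h3 := (hk.differentiable (by norm_num) _).hasFDerivAt.comp_hasDerivAt θ
        (h1.const_mul (r : ℂ))
      refine h3.congr_deriv ?_
      have : (r : ℂ) * (Complex.I * e θ) = r • (Complex.I * e θ) := by simp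
      rw [this, map_smul]
      simp [hY]
    have h4 : ∫ θ in (-π)..π, (r : ℂ) * Y (r, θ) = 0 := by
      rw [intervalIntegral.integral_eq_sub_of_hasDerivAt (fun θ _ => hd θ)]
      · simp [he]
      · exact Continuous.intervalIntegrable (by fun_prop) _ _
    rw [intervalIntegral.integral_const_mul,
      intervalIntegral.integral_of_le (by linarith [Real.pi_pos]), integral_Ioc_eq_integral_Ioo] at h4
    simpa [hr.ne'] using h4
  rw [← Complex.integral_comp_polarCoord_symm, polarCoord_target]
  have hcongr : ∫ p in Ioi (0 : ℝ) ×ˢ Ioo (-π) π, p.1 • ((Complex.polarCoord.symm p)⁻¹ *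
      (fderiv ℝ k (Complex.polarCoord.symm p) 1 +
        Complex.I * fderiv ℝ k (Complex.polarCoord.symm p) Complex.I)) =
      ∫ p in Ioi (0 : ℝ) ×ˢ Ioo (-π) π, (X p + Complex.I * Y p) := by
    refine setIntegral_congr_fun (measurableSet_Ioi.prod measurableSet_Ioo) fun p hp => ?_
    have hp0 : (0 : ℝ) < p.1 := hp.1
    have hpc : (p.1 : ℂ) ≠ 0 := by exact_mod_cast hp0.ne'
    have h0 : e p.2 ≠ 0 := by
      intro h; have := hen p.2; simp [h] at this
    have hes : (Real.cos p.2 : ℂ) ^ 2 + (Real.sin p.2 : ℂ) ^ 2 = 1 := by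
      exact_mod_cast Real.cos_sq_add_sin_sq p.2
    simp only [Complex.polarCoord_symm_apply, hX, hY, Complex.real_smul]
    set T := fderiv ℝ k (p.1 * e p.2) with hT
    have h5 : ∀ u : ℂ, T u = u.re * T 1 + u.im * T Complex.I := by
      intro u
      have : u = u.re • (1 : ℂ) + u.im • Complex.I := by
        simp
      conv_lhs => rw [this]
      rw [map_add, map_smul, map_smul]
      simp
    have h6 : (Real.cos p.2 + Real.sin p.2 * Complex.I : ℂ) = e p.2 := rfl
    rw [h6, h5 (e p.2), h5 (Complex.I * e p.2)]
    have hre : (e p.2).re = Real.cos p.2 := by simp [he, Complex.cos_ofReal_re]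
    have him : (e p.2).im = Real.sin p.2 := by simp [he, Complex.sin_ofReal_re]
    have hre' : (Complex.I * e p.2).re = -Real.sin p.2 := by simp [him]
    have him' : (Complex.I * e p.2).im = Real.cos p.2 := by simp [hre]
    rw [hre, him, hre', him', mul_inv, mul_assoc, mul_inv_cancel_left₀ hpc,
      inv_mul_eq_iff_eq_mul₀ h0]
    simp only [he, Complex.ofReal_neg]
    linear_combination (-T 1 - Complex.I * T Complex.I) * hes +
      ((Real.sin p.2 : ℂ) ^ 2 * T 1 - (Real.sin p.2 : ℂ) * (Real.cos p.2 : ℂ) * T Complex.I) *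
        Complex.I_sq
  rw [hcongr, integral_add hXi (hYi.const_mul _), integral_const_mul]
  have hYz : ∫ p in Ioi (0 : ℝ) ×ˢ Ioo (-π) π, Y p = 0 := by
    rw [Measure.volume_eq_prod, setIntegral_prod _ (by rwa [← Measure.volume_eq_prod])]
    rw [setIntegral_congr_fun (g := fun _ => 0) measurableSet_Ioi fun r hr => hang r hr]
    simp
  have hXz : ∫ p in Ioi (0 : ℝ) ×ˢ Ioo (-π) π, X p = -(2 * π) * k 0 := by
    rw [IntegrableOn, Measure.volume_eq_prod, ← Measure.prod_restrict] at hXi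
    rw [Measure.volume_eq_prod, ← Measure.prod_restrict, integral_prod_symm _ hXi]
    simp_rw [hrad]
    simp [Real.pi_pos.le]
    left
    ring
  rw [hXz, hYz]
  simp

/-- The Cauchy transform `z ↦ ∫ h(w) / (z - w)`. -/
noncomputable def cauchyT (h : ℂ → ℂ) : ℂ → ℂ :=
  (fun w : ℂ => w⁻¹) ⋆[ContinuousLinearMap.mul ℝ ℂ, volume] h

/-- The reflection of the Cauchy transform across the unit circle. -/
noncomputable def reflT (h : ℂ → ℂ) (z : ℂ) : ℂ := ∫ w, conj (h w) * (z / (1 - z * conj w))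

theorem cauchyT_apply (h : ℂ → ℂ) (z : ℂ) : cauchyT h z = ∫ w, h w * (z - w)⁻¹ := by
  rw [cauchyT, convolution_def, ← integral_sub_left_eq_self _ volume z]
  simp [mul_comm]

theorem IsTest.contDiff_cauchyT {U : Set ℂ} {h : ℂ → ℂ} (hh : IsTest U h) :
    ContDiff ℝ ∞ (cauchyT h) :=
  hh.compact.contDiff_convolution_right (n := ⊤) _ locallyIntegrable_inv hh.smooth

theorem IsTest.dbar_cauchyT {U : Set ℂ} {h : ℂ → ℂ} (hh : IsTest U h) (z : ℂ) :
    fderiv ℝ (cauchyT h) z 1 + Complex.I * fderiv ℝ (cauchyT h) z Complex.I = 2 * π * h z := by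
  have h1 : ContDiff ℝ 1 h := hh.smooth.of_le (by norm_cast)
  have hd := hh.compact.hasFDerivAt_convolution_right (ContinuousLinearMap.mul ℝ ℂ)
    locallyIntegrable_inv h1 z
  have hce : ConvolutionExistsAt (fun w : ℂ => w⁻¹) (fderiv ℝ h) z
      ((ContinuousLinearMap.mul ℝ ℂ).precompR ℂ) volume :=
    (hh.compact.fderiv ℝ).convolutionExists_right _ locallyIntegrable_inv
      (h1.continuous_fderiv (by norm_num)) z
  have hInt : ∀ u : ℂ, Integrable (fun w : ℂ => w⁻¹ * fderiv ℝ h (z - w) u) := by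
    intro u
    have := hce.integrable
    exact (ContinuousLinearMap.apply ℝ ℂ u).integrable_comp this
  have hf : ∀ u : ℂ, fderiv ℝ (cauchyT h) z u = ∫ w : ℂ, w⁻¹ * fderiv ℝ h (z - w) u := by
    intro u
    rw [cauchyT, hd.fderiv, convolution_def]
    exact (ContinuousLinearMap.apply ℝ ℂ u).integral_comp_comm hce.integrable |>.symm
  rw [hf, hf, ← integral_const_mul, ← integral_add (hInt 1) ((hInt _).const_mul _)]
  set k : ℂ → ℂ := fun w => h (z - w) with hk
  have hkd : ContDiff ℝ 1 k := h1.comp (contDiff_const.sub contDiff_id)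
  have hkf : ∀ w, fderiv ℝ k w = -fderiv ℝ h (z - w) := by
    intro w
    have := ((h1.differentiable (by norm_num) (z - w)).hasFDerivAt).comp w
      ((hasFDerivAt_id (𝕜 := ℝ) w).const_sub z)
    have h2 : HasFDerivAt k (-fderiv ℝ h (z - w)) w := by
      refine this.congr_fderiv ?_
      ext
      simp
    exact h2.fderiv
  have hkc : HasCompactSupport k := hh.compact.comp_homeomorph (Homeomorph.subLeft z)
  have := integral_dbar_div hkd hkc
  simp only [hkf] at this
  have e : ∀ w : ℂ, w⁻¹ * fderiv ℝ h (z - w) 1 + Complex.I * (w⁻¹ * fderiv ℝ h (z - w) Complex.I) =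
      -(w⁻¹ * ((-fderiv ℝ h (z - w)) 1 + Complex.I * (-fderiv ℝ h (z - w)) Complex.I)) := by
    intro w
    simp
    ring
  simp_rw [e]
  rw [integral_neg, this]
  simp [hk]

theorem IsTest.exists_radius {h : ℂ → ℂ} (hh : IsTest (ball 0 1) h) :
    ∃ r, 0 < r ∧ r < 1 ∧ ∀ w ∈ tsupport h, ‖w‖ ≤ r := by
  obtain ⟨r, hr, hs⟩ := exists_pos_lt_subset_ball one_pos (isClosed_tsupport h) hh.subset
  exact ⟨r, hr.1, hr.2, fun w hw => by have := hs hw; simp at this; linarith⟩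

theorem IsTest.integrable_mul {U : Set ℂ} {h k : ℂ → ℂ} (hh : IsTest U h)
    (hk : ∀ w ∈ tsupport h, ContinuousAt k w) : Integrable fun w => h w * k w := by
  have hs : tsupport (fun w => h w * k w) ⊆ tsupport h := tsupport_mul_subset_left
  refine Continuous.integrable_of_hasCompactSupport ?_
    (hh.compact.of_isClosed_subset (isClosed_tsupport _) hs)
  exact continuous_of_tsupport fun w hw =>
    hh.smooth.continuous.continuousAt.mul (hk w (hs hw))

theorem IsTest.conj {U : Set ℂ} {h : ℂ → ℂ} (hh : IsTest U h) :
    IsTest U fun w => conj (h w) := by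
  have hs : tsupport (fun w => conj (h w)) = tsupport h := by
    rw [tsupport, tsupport]; congr 1; ext w; simp
  refine ⟨Complex.conjCLE.contDiff.comp hh.smooth, ?_, ?_⟩
  · rw [HasCompactSupport, hs]; exact hh.compact
  · rw [hs]; exact hh.subset

theorem one_sub_mul_conj_ne {z w : ℂ} (h : ‖z‖ * ‖w‖ < 1) : 1 - z * conj w ≠ 0 := by
  intro h0
  have : ‖z * conj w‖ = 1 := by rw [← sub_eq_zero.1 h0]; simp
  rw [norm_mul, Complex.norm_conj] at this
  linarith

theorem integrable_reflT_kernel {h : ℂ → ℂ} {U : Set ℂ} (hh : IsTest U h) {r : ℝ}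
    (hr : ∀ w ∈ tsupport h, ‖w‖ ≤ r) {z : ℂ} (hz : ‖z‖ * r < 1) :
    Integrable fun w => conj (h w) * (z / (1 - z * conj w)) := by
  refine hh.conj.integrable_mul fun w hw => ?_
  have hw' : w ∈ tsupport h := by
    have hs : tsupport (fun w => conj (h w)) = tsupport h := by
      rw [tsupport, tsupport]; congr 1; ext w; simp
    rwa [hs] at hw
  have hne := one_sub_mul_conj_ne
    ((mul_le_mul_of_nonneg_left (hr w hw') (norm_nonneg z)).trans_lt hz)
  refine continuousAt_const.div ?_ hne
  exact (continuous_const.sub (continuous_const.mul Complex.continuous_conj)).continuousAt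

theorem differentiableOn_reflT {h : ℂ → ℂ} {U : Set ℂ} (hh : IsTest U h) {r : ℝ} (hr0 : 0 < r)
    (hr : ∀ w ∈ tsupport h, ‖w‖ ≤ r) : DifferentiableOn ℂ (reflT h) (ball 0 r⁻¹) := by
  intro z₀ hz₀
  rw [mem_ball_zero_iff, ← one_div, lt_div_iff₀ hr0] at hz₀
  set s := (1 + ‖z₀‖ * r) / 2 with hs
  have hs1 : s < 1 := by linarith
  have hzs : ‖z₀‖ * r < s := by linarith
  set ε := (s - ‖z₀‖ * r) / r with hε
  have hε0 : 0 < ε := div_pos (by linarith) hr0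
  have hball : ∀ z ∈ ball z₀ ε, ‖z‖ * r ≤ s := by
    intro z hz
    rw [mem_ball_iff_norm] at hz
    have h1 : ‖z‖ ≤ ‖z₀‖ + ‖z - z₀‖ := by simpa using norm_add_le z₀ (z - z₀)
    have h2 : ‖z - z₀‖ * r ≤ s - ‖z₀‖ * r := by
      rw [hε, lt_div_iff₀ hr0] at hz; exact hz.le
    nlinarith
  have hmain := hasDerivAt_integral_of_dominated_loc_of_deriv_le (𝕜 := ℂ) (μ := (volume : Measure ℂ))
    (F := fun z w => conj (h w) * (z / (1 - z * conj w)))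
    (F' := fun z w => conj (h w) * (1 / (1 - z * conj w) ^ 2)) (x₀ := z₀)
    (bound := fun w => ‖h w‖ * (1 - s)⁻¹ ^ 2) (s := ball z₀ ε) (ball_mem_nhds z₀ hε0) ?_ ?_ ?_ ?_ ?_ ?_
  · exact hmain.2.differentiableAt.differentiableWithinAt
  · filter_upwards [ball_mem_nhds z₀ hε0] with z hz
    exact (integrable_reflT_kernel hh hr ((hball z hz).trans_lt hs1)).aestronglyMeasurable
  · exact integrable_reflT_kernel hh hr hz₀
  · have : Measurable fun w : ℂ => conj (h w) * (1 / (1 - z₀ * conj w) ^ 2) := by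
      have := hh.smooth.continuous.measurable
      have hc : Measurable (fun w : ℂ => conj w) := Complex.continuous_conj.measurable
      exact (hc.comp this).mul (measurable_const.div
        ((measurable_const.sub (measurable_const.mul hc)).pow_const 2))
    exact this.aestronglyMeasurable
  · refine ae_of_all _ fun w z hz => ?_
    by_cases hw : w ∈ tsupport h
    · have h3 : 1 - s ≤ ‖1 - z * conj w‖ := by
        have h4 : ‖z * conj w‖ ≤ s := by
          rw [norm_mul, Complex.norm_conj]
          exact (mul_le_mul_of_nonneg_left (hr w hw) (norm_nonneg z)).trans (hball z hz)
        have h5 := norm_sub_norm_le (1 : ℂ) (z * conj w)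
        rw [norm_one] at h5
        linarith
      rw [norm_mul, Complex.norm_conj, norm_div, norm_one, norm_pow, one_div, ← inv_pow]
      gcongr
    · simp [image_eq_zero_of_notMem_tsupport hw]
  · exact (hh.smooth.continuous.integrable_of_hasCompactSupport hh.compact).norm.mul_const _
  · refine ae_of_all _ fun w z hz => ?_
    by_cases hw : w ∈ tsupport h
    · have hne : 1 - z * conj w ≠ 0 := one_sub_mul_conj_ne
        ((mul_le_mul_of_nonneg_left (hr w hw) (norm_nonneg z)).trans_lt
          ((hball z hz).trans_lt hs1))
      have h6 : HasDerivAt (fun z : ℂ => 1 - z * conj w) (-(conj w)) z := by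
        simpa using ((hasDerivAt_id z).mul_const (conj w)).const_sub 1
      have h7 := ((hasDerivAt_id z).div h6 hne).const_mul (conj (h w))
      refine h7.congr_deriv ?_
      congr 2
      simp
    · simp only [image_eq_zero_of_notMem_tsupport hw, map_zero, zero_mul]
      exact hasDerivAt_const _ _

theorem conj_cauchyT_eq_reflT {h : ℂ → ℂ} {z : ℂ} (hz : ‖z‖ = 1) :
    conj (cauchyT h z) = reflT h z := by
  rw [cauchyT_apply, reflT, ← integral_conj]
  congr 1
  ext w
  have hz1 : z * conj z = 1 := by rw [Complex.mul_conj, Complex.normSq_eq_norm_sq, hz]; simp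
  have hz0 : z ≠ 0 := by intro h0; simp [h0] at hz
  rw [map_mul, map_inv₀, map_sub]
  congr 1
  rw [← hz1, ← mul_sub, div_mul_eq_div_div, div_self hz0, one_div]

theorem norm_inv_mul_sub_le {P P' Q Q' : ℂ} {d ρ : ℝ} (hd : 0 < d) (hρ : 0 ≤ ρ) (hP : d / 4 ≤ ‖P‖)
    (hP' : d / 4 ≤ ‖P'‖) (hQ : d / 4 ≤ ‖Q‖) (hQ' : d / 4 ≤ ‖Q'‖) (h : ‖P - Q‖ ≤ ρ)
    (h' : ‖P' - Q'‖ ≤ ρ) : ‖(Q * Q')⁻¹ - (P * P')⁻¹‖ ≤ 128 * ρ / d ^ 3 := by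
  have hd4 : 0 < d / 4 := by positivity
  have nP : P ≠ 0 := norm_pos_iff.1 (hd4.trans_le hP)
  have nP' : P' ≠ 0 := norm_pos_iff.1 (hd4.trans_le hP')
  have nQ : Q ≠ 0 := norm_pos_iff.1 (hd4.trans_le hQ)
  have nQ' : Q' ≠ 0 := norm_pos_iff.1 (hd4.trans_le hQ')
  have e : (Q * Q')⁻¹ - (P * P')⁻¹ =
      (P - Q) * (P⁻¹ * Q⁻¹ * Q'⁻¹) + (P' - Q') * (P⁻¹ * P'⁻¹ * Q'⁻¹) := by
    field_simp
    ring
  have hb : ∀ A B C : ℂ, d / 4 ≤ ‖A‖ → d / 4 ≤ ‖B‖ → d / 4 ≤ ‖C‖ →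
      ‖A⁻¹ * B⁻¹ * C⁻¹‖ ≤ (d / 4)⁻¹ * (d / 4)⁻¹ * (d / 4)⁻¹ := by
    intro A B C hA hB hC
    rw [norm_mul, norm_mul, norm_inv, norm_inv, norm_inv]
    gcongr
  calc ‖(Q * Q')⁻¹ - (P * P')⁻¹‖
      ≤ ‖(P - Q) * (P⁻¹ * Q⁻¹ * Q'⁻¹)‖ + ‖(P' - Q') * (P⁻¹ * P'⁻¹ * Q'⁻¹)‖ := by
        rw [e]; exact norm_add_le _ _
    _ ≤ ρ * ((d / 4)⁻¹ * (d / 4)⁻¹ * (d / 4)⁻¹) + ρ * ((d / 4)⁻¹ * (d / 4)⁻¹ * (d / 4)⁻¹) := by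
        rw [norm_mul (P - Q), norm_mul (P' - Q')]
        exact add_le_add (mul_le_mul h (hb _ _ _ hP hQ hQ') (norm_nonneg _) hρ)
          (mul_le_mul h' (hb _ _ _ hP hP' hQ') (norm_nonneg _) hρ)
    _ = 128 * ρ / d ^ 3 := by field_simp; ring

theorem IsTest.norm_integral_mul_le {U : Set ℂ} {h k : ℂ → ℂ} (hh : IsTest U h)
    (h1 : ∀ z, ‖h z‖ ≤ 1) (h0 : ∫ z, h z = 0) {x₀ : ℂ} {ρ : ℝ} (hρ : 0 ≤ ρ)
    (hs : tsupport h ⊆ ball x₀ ρ)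
    (hk : Integrable fun w => h w * k w) (k₀ : ℂ) {M : ℝ} (hM0 : 0 ≤ M)
    (hM : ∀ w ∈ tsupport h, ‖k w - k₀‖ ≤ M) : ‖∫ w, h w * k w‖ ≤ M * (π * ρ ^ 2) := by
  have hhi : Integrable h := hh.smooth.continuous.integrable_of_hasCompactSupport hh.compact
  have e : ∫ w, h w * k w = ∫ w in ball x₀ ρ, h w * (k w - k₀) := by
    rw [setIntegral_eq_integral_of_forall_compl_eq_zero]
    · simp_rw [mul_sub]
      rw [integral_sub hk (hhi.mul_const _), integral_mul_const, h0, zero_mul, sub_zero]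
    · intro w hw
      rw [image_eq_zero_of_notMem_tsupport fun hw' => hw (hs hw'), zero_mul]
  have hvol : volume.real (ball x₀ ρ) = π * ρ ^ 2 := by
    rw [Measure.real, volume_ball_eq _ hρ, ENNReal.toReal_ofReal (by positivity)]
  rw [e, ← hvol]
  refine norm_setIntegral_le_of_norm_le_const measure_ball_lt_top fun w _ => ?_
  by_cases hw : w ∈ tsupport h
  · rw [norm_mul]
    exact (mul_le_mul (h1 w) (hM w hw) (norm_nonneg _) zero_le_one).trans_eq (one_mul M)
  · simpa [image_eq_zero_of_notMem_tsupport hw] using hM0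

theorem norm_sub_le_norm_one_sub {z w : ℂ} (hz : ‖z‖ ≤ 1) (hw : ‖w‖ ≤ 1) :
    ‖z - w‖ ≤ ‖1 - z * conj w‖ := by
  have h1 := Complex.sq_norm (z - w)
  have h2 := Complex.sq_norm (1 - z * conj w)
  have hz2 : z.re ^ 2 + z.im ^ 2 ≤ 1 := by
    have := Complex.sq_norm z
    rw [Complex.normSq_apply] at this
    nlinarith [norm_nonneg z]
  have hw2 : w.re ^ 2 + w.im ^ 2 ≤ 1 := by
    have := Complex.sq_norm w
    rw [Complex.normSq_apply] at this
    nlinarith [norm_nonneg w]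
  rw [Complex.normSq_apply] at h1 h2
  simp only [Complex.sub_re, Complex.sub_im, Complex.one_re, Complex.one_im, Complex.mul_re,
    Complex.mul_im, Complex.conj_re, Complex.conj_im] at h1 h2
  refine (sq_le_sq₀ (norm_nonneg _) (norm_nonneg _)).1 ?_
  rw [h1, h2]
  nlinarith [mul_nonneg (sub_nonneg.2 hz2) (sub_nonneg.2 hw2)]

theorem norm_cauchyT_sub_le {h : ℂ → ℂ} {U : Set ℂ} (hh : IsTest U h)
    (h1 : ∀ z, ‖h z‖ ≤ 1) (h0 : ∫ z, h z = 0) {x₀ : ℂ} {ρ : ℝ} (hρ : 0 < ρ)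
    (hs : tsupport h ⊆ ball x₀ ρ) {z z' : ℂ} (hz : 2 * ρ ≤ ‖z - x₀‖)
    (hz' : ‖z' - z‖ ≤ ‖z - x₀‖ / 4) :
    ‖cauchyT h z' - cauchyT h z‖ ≤ 128 * ρ / ‖z - x₀‖ ^ 3 * (π * ρ ^ 2) * ‖z' - z‖ := by
  set d := ‖z - x₀‖ with hd
  have hd0 : 0 < d := by linarith
  have hw1 : ∀ w ∈ tsupport h, ‖w - x₀‖ ≤ ρ := fun w hw => (mem_ball_iff_norm.1 (hs hw)).le
  have hQ : ∀ w ∈ tsupport h, d / 2 ≤ ‖z - w‖ := by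
    intro w hw
    have := norm_sub_norm_le (z - x₀) (w - x₀)
    rw [sub_sub_sub_cancel_right] at this
    linarith [hw1 w hw]
  have hP' : d / 4 ≤ ‖z' - x₀‖ := by
    have := norm_sub_norm_le (z - x₀) (z - z')
    rw [show z - x₀ - (z - z') = z' - x₀ by ring, norm_sub_rev z z'] at this
    linarith
  have hQ' : ∀ w ∈ tsupport h, d / 4 ≤ ‖z' - w‖ := by
    intro w hw
    have := norm_sub_norm_le (z - w) (z - z')
    rw [show z - w - (z - z') = z' - w by ring, norm_sub_rev z z'] at this
    linarith [hQ w hw]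
  have nQ : ∀ w ∈ tsupport h, z - w ≠ 0 := fun w hw =>
    norm_pos_iff.1 (by linarith [hQ w hw])
  have nQ' : ∀ w ∈ tsupport h, z' - w ≠ 0 := fun w hw =>
    norm_pos_iff.1 (by linarith [hQ' w hw])
  have i1 : Integrable fun w => h w * (z - w)⁻¹ := hh.integrable_mul fun w hw =>
    (continuousAt_const.sub continuousAt_id).inv₀ (nQ w hw)
  have i2 : Integrable fun w => h w * (z' - w)⁻¹ := hh.integrable_mul fun w hw =>
    (continuousAt_const.sub continuousAt_id).inv₀ (nQ' w hw)
  have i3 : Integrable fun w => h w * ((z - w) * (z' - w))⁻¹ := hh.integrable_mul fun w hw =>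
    ((continuousAt_const.sub continuousAt_id).mul (continuousAt_const.sub continuousAt_id)).inv₀
      (mul_ne_zero (nQ w hw) (nQ' w hw))
  have e : cauchyT h z' - cauchyT h z = (z - z') * ∫ w, h w * ((z - w) * (z' - w))⁻¹ := by
    rw [cauchyT_apply, cauchyT_apply, ← integral_sub i2 i1, ← integral_const_mul]
    congr 1
    ext w
    by_cases hw : w ∈ tsupport h
    · have := nQ w hw
      have := nQ' w hw
      field_simp
      ring
    · simp [image_eq_zero_of_notMem_tsupport hw]
  rw [e, norm_mul, mul_comm, norm_sub_rev]
  gcongr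
  refine hh.norm_integral_mul_le h1 h0 hρ.le hs i3 ((z - x₀) * (z' - x₀))⁻¹ (by positivity) ?_
  intro w hw
  refine norm_inv_mul_sub_le hd0 hρ.le (by linarith) hP' (by linarith [hQ w hw]) (hQ' w hw) ?_ ?_
  · rw [show z - x₀ - (z - w) = w - x₀ by ring]; exact hw1 w hw
  · rw [show z' - x₀ - (z' - w) = w - x₀ by ring]; exact hw1 w hw

theorem norm_reflT_sub_le {h : ℂ → ℂ} (hh : IsTest (ball 0 1) h)
    (h1 : ∀ z, ‖h z‖ ≤ 1) (h0 : ∫ z, h z = 0) {x₀ : ℂ} (hx₀ : ‖x₀‖ < 1) {ρ : ℝ} (hρ : 0 < ρ)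
    (hs : tsupport h ⊆ ball x₀ ρ) {z z' : ℂ} (hz1 : ‖z‖ < 1) (hz_lt_one : ‖z'‖ < 1)
    (hz : 2 * ρ ≤ ‖z - x₀‖) (hz' : ‖z' - z‖ ≤ ‖z - x₀‖ / 4) :
    ‖reflT h z' - reflT h z‖ ≤ 128 * ρ / ‖z - x₀‖ ^ 3 * (π * ρ ^ 2) * ‖z' - z‖ := by
  obtain ⟨r, hr0, hr1, hr⟩ := hh.exists_radius
  set d := ‖z - x₀‖ with hd
  have hd0 : 0 < d := by linarith
  have hss : tsupport (fun w => conj (h w)) = tsupport h := by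
    rw [tsupport, tsupport]; congr 1; ext w; simp
  have hw1 : ∀ w ∈ tsupport h, ‖w - x₀‖ ≤ ρ := fun w hw => (mem_ball_iff_norm.1 (hs hw)).le
  have hwn : ∀ w ∈ tsupport h, ‖w‖ ≤ 1 := fun w hw => (hr w hw).trans hr1.le
  have hQ : ∀ w ∈ tsupport h, d / 2 ≤ ‖1 - z * conj w‖ := by
    intro w hw
    refine le_trans ?_ (norm_sub_le_norm_one_sub hz1.le (hwn w hw))
    have := norm_sub_norm_le (z - x₀) (w - x₀)
    rw [sub_sub_sub_cancel_right] at this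
    linarith [hw1 w hw]
  have hP : d / 4 ≤ ‖1 - z * conj x₀‖ :=
    le_trans (by linarith) (norm_sub_le_norm_one_sub hz1.le hx₀.le)
  have hP' : d / 4 ≤ ‖1 - z' * conj x₀‖ := by
    refine le_trans ?_ (norm_sub_le_norm_one_sub hz_lt_one.le hx₀.le)
    have := norm_sub_norm_le (z - x₀) (z - z')
    rw [show z - x₀ - (z - z') = z' - x₀ by ring, norm_sub_rev z z'] at this
    linarith
  have hQ' : ∀ w ∈ tsupport h, d / 4 ≤ ‖1 - z' * conj w‖ := by
    intro w hw
    refine le_trans ?_ (norm_sub_le_norm_one_sub hz_lt_one.le (hwn w hw))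
    have h2 := norm_sub_norm_le (z - x₀) (w - x₀)
    rw [sub_sub_sub_cancel_right] at h2
    have := norm_sub_norm_le (z - w) (z - z')
    rw [show z - w - (z - z') = z' - w by ring, norm_sub_rev z z'] at this
    linarith [hw1 w hw]
  have nQ : ∀ w ∈ tsupport h, 1 - z * conj w ≠ 0 := fun w hw =>
    norm_pos_iff.1 (by linarith [hQ w hw])
  have nQ' : ∀ w ∈ tsupport h, 1 - z' * conj w ≠ 0 := fun w hw =>
    norm_pos_iff.1 (by linarith [hQ' w hw])
  have i1 := integrable_reflT_kernel hh hr (z := z) (by nlinarith [norm_nonneg z])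
  have i2 := integrable_reflT_kernel hh hr (z := z') (by nlinarith [norm_nonneg z'])
  have hc : ∀ y : ℂ, Continuous fun w : ℂ => 1 - y * conj w := fun y =>
    continuous_const.sub (continuous_const.mul Complex.continuous_conj)
  have i3 : Integrable fun w => conj (h w) * ((1 - z * conj w) * (1 - z' * conj w))⁻¹ := by
    refine hh.conj.integrable_mul fun w hw => ?_
    rw [hss] at hw
    exact ((hc z).mul (hc z')).continuousAt.inv₀ (mul_ne_zero (nQ w hw) (nQ' w hw))
  have e : reflT h z' - reflT h z =
      (z' - z) * ∫ w, conj (h w) * ((1 - z * conj w) * (1 - z' * conj w))⁻¹ := by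
    rw [reflT, reflT, ← integral_sub i2 i1, ← integral_const_mul]
    congr 1
    ext w
    by_cases hw : w ∈ tsupport h
    · have q1 := nQ w hw
      have q2 := nQ' w hw
      rw [← mul_sub, div_sub_div _ _ q2 q1, ← div_eq_mul_inv, mul_div_assoc', mul_div_assoc',
        mul_comm (1 - z' * conj w)]
      ring
    · simp [image_eq_zero_of_notMem_tsupport hw]
  rw [e, norm_mul, mul_comm]
  gcongr
  refine hh.conj.norm_integral_mul_le (fun w => by simpa using h1 w) ?_ hρ.le
    (by rw [hss]; exact hs) i3
    ((1 - z * conj x₀) * (1 - z' * conj x₀))⁻¹ (by positivity) ?_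
  · rw [integral_conj, h0, map_zero]
  intro w hw
  rw [hss] at hw
  have hdiff : ∀ y : ℂ, ‖y‖ < 1 → ‖1 - y * conj x₀ - (1 - y * conj w)‖ ≤ ρ := by
    intro y hy
    rw [show 1 - y * conj x₀ - (1 - y * conj w) = y * conj (w - x₀) by rw [map_sub]; ring,
      norm_mul, Complex.norm_conj]
    nlinarith [hw1 w hw, norm_nonneg (w - x₀)]
  exact norm_inv_mul_sub_le hd0 hρ.le hP hP' (by linarith [hQ w hw]) (hQ' w hw)
    (hdiff z hz1) (hdiff z' hz_lt_one)

/-- `ψ` solves `Δψ = div h` in the unit disc with zero boundary values; the equation is expressed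
through a stream function `v` for the divergence free field `∇ψ - h`. -/
structure IsPotential (h : ℂ → ℂ) (ψ : ℂ → ℝ) : Prop where
  exists_stream : ∃ R > (1 : ℝ), ∃ v : ℂ → ℝ, ContDiffOn ℝ ∞ ψ (ball 0 R) ∧
    ContDiffOn ℝ ∞ v (ball 0 R) ∧ ∀ z ∈ ball (0 : ℂ) R,
      fderiv ℝ ψ z 1 = (h z).re + fderiv ℝ v z Complex.I ∧
      fderiv ℝ ψ z Complex.I = (h z).im - fderiv ℝ v z 1
  eq_zero : ∀ z, ‖z‖ = 1 → ψ z = 0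

theorem exists_potential {h : ℂ → ℂ} (hh : IsTest (ball 0 1) h) : ∃ ψ : ℂ → ℝ, IsPotential h ψ ∧
    ((∀ z, ‖h z‖ ≤ 1) → ∫ z, h z = 0 → ∀ x₀ ∈ ball (0 : ℂ) 1, ∀ ρ > (0 : ℝ),
      tsupport h ⊆ ball x₀ ρ → ∀ z ∈ ball (0 : ℂ) 1, 2 * ρ ≤ ‖z - x₀‖ →
        ‖fderiv ℝ ψ z‖ ≤ 128 * ρ ^ 3 / ‖z - x₀‖ ^ 3) := by
  obtain ⟨r, hr0, hr1, hr⟩ := hh.exists_radius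
  have hB := differentiableOn_reflT hh hr0 hr
  have hBc : ContDiffOn ℝ ∞ (reflT h) (ball 0 r⁻¹) :=
    (hB.contDiffOn (n := ∞) isOpen_ball).restrict_scalars ℝ
  set f : ℂ → ℂ := fun z => (2 * π)⁻¹ • (cauchyT h z - reflT h z) with hf
  have hfc : ContDiffOn ℝ ∞ f (ball 0 r⁻¹) :=
    (hh.contDiff_cauchyT.contDiffOn.sub hBc).const_smul _
  have hfd : ∀ z ∈ ball (0 : ℂ) r⁻¹, DifferentiableAt ℝ f z := fun z hz =>
    (hfc.contDiffAt (isOpen_ball.mem_nhds hz)).differentiableAt (by simp)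
  have hdbar : ∀ z ∈ ball (0 : ℂ) r⁻¹,
      fderiv ℝ f z 1 + Complex.I * fderiv ℝ f z Complex.I = h z := by
    intro z hz
    have hBz : DifferentiableAt ℂ (reflT h) z := hB.differentiableAt (isOpen_ball.mem_nhds hz)
    have hAz : DifferentiableAt ℝ (cauchyT h) z := hh.contDiff_cauchyT.differentiable (by simp) z
    have e : fderiv ℝ f z = (2 * π)⁻¹ • (fderiv ℝ (cauchyT h) z - fderiv ℝ (reflT h) z) :=
      ((hAz.hasFDerivAt.sub (hBz.restrictScalars ℝ).hasFDerivAt).const_smul (2 * π)⁻¹).fderiv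
    have hBI : fderiv ℝ (reflT h) z Complex.I = Complex.I * fderiv ℝ (reflT h) z 1 := by
      rw [hBz.fderiv_restrictScalars ℝ]
      simp
    have hA := hh.dbar_cauchyT z
    have hpi : (π : ℂ) ≠ 0 := by exact_mod_cast Real.pi_ne_zero
    rw [e]
    simp only [smul_apply, sub_apply, hBI,
      Complex.real_smul]
    push_cast
    field_simp
    linear_combination hA - fderiv ℝ (reflT h) z 1 * Complex.I_sq
  have hre : ∀ z ∈ ball (0 : ℂ) r⁻¹, ∀ u, fderiv ℝ (fun z => (f z).re) z u = (fderiv ℝ f z u).re :=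
    fun z hz u => by
      have h2 : HasFDerivAt (fun z => (f z).re) (Complex.reCLM.comp (fderiv ℝ f z)) z :=
        Complex.reCLM.hasFDerivAt.comp z (hfd z hz).hasFDerivAt
      rw [h2.fderiv]
      rfl
  have him : ∀ z ∈ ball (0 : ℂ) r⁻¹, ∀ u, fderiv ℝ (fun z => (f z).im) z u = (fderiv ℝ f z u).im :=
    fun z hz u => by
      have h2 : HasFDerivAt (fun z => (f z).im) (Complex.imCLM.comp (fderiv ℝ f z)) z :=
        Complex.imCLM.hasFDerivAt.comp z (hfd z hz).hasFDerivAt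
      rw [h2.fderiv]
      rfl
  refine ⟨fun z => (f z).re, ⟨⟨r⁻¹, (one_lt_inv₀ hr0).2 hr1, fun z => (f z).im,
    Complex.reCLM.contDiff.comp_contDiffOn hfc, Complex.imCLM.contDiff.comp_contDiffOn hfc, ?_⟩,
    ?_⟩, ?_⟩
  · intro z hz
    rw [hre z hz, hre z hz, him z hz, him z hz]
    have h1 := congrArg Complex.re (hdbar z hz)
    have h2 := congrArg Complex.im (hdbar z hz)
    simp at h1 h2
    constructor <;> linarith
  · intro z hz
    simp [hf, ← conj_cauchyT_eq_reflT hz]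
  · intro h1 h0 x₀ hx₀ ρ hρ hs z hz hzx
    refine norm_fderiv_le_of_lip' ℝ (by positivity) ?_
    have hd0 : 0 < ‖z - x₀‖ / 4 := by linarith
    filter_upwards [isOpen_ball.mem_nhds hz, closedBall_mem_nhds z hd0] with z' hz1 hz2
    rw [mem_closedBall, dist_eq_norm] at hz2
    have b1 := norm_cauchyT_sub_le hh h1 h0 hρ hs hzx hz2
    have b2 := norm_reflT_sub_le hh h1 h0 (mem_ball_zero_iff.1 hx₀) hρ hs (mem_ball_zero_iff.1 hz)
      (mem_ball_zero_iff.1 hz1) hzx hz2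
    calc ‖(f z').re - (f z).re‖ = |(f z' - f z).re| := by rw [Complex.sub_re, Real.norm_eq_abs]
      _ ≤ ‖f z' - f z‖ := Complex.abs_re_le_norm _
      _ = (2 * π)⁻¹ * ‖(cauchyT h z' - cauchyT h z) - (reflT h z' - reflT h z)‖ := by
          rw [hf]
          simp only
          rw [← smul_sub, norm_smul, Real.norm_of_nonneg (by positivity)]
          congr 2
          ring
      _ ≤ (2 * π)⁻¹ * (128 * ρ / ‖z - x₀‖ ^ 3 * (π * ρ ^ 2) * ‖z' - z‖ +
          128 * ρ / ‖z - x₀‖ ^ 3 * (π * ρ ^ 2) * ‖z' - z‖) := by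
          gcongr
          exact (norm_sub_le _ _).trans (add_le_add b1 b2)
      _ = 128 * ρ ^ 3 / ‖z - x₀‖ ^ 3 * ‖z' - z‖ := by
          have : ‖z - x₀‖ ≠ 0 := by linarith
          field_simp
          ring

end WenteDisk

end

section

open MeasureTheory Metric Real Set Filter Topology
open scoped ENNReal NNReal ContDiff ComplexConjugate

namespace WenteDisk

/-- Partial derivative in the real direction. -/
noncomputable def dx (f : ℂ → ℝ) (z : ℂ) : ℝ := fderiv ℝ f z 1

/-- Partial derivative in the imaginary direction. -/
noncomputable def dy (f : ℂ → ℝ) (z : ℂ) : ℝ := fderiv ℝ f z Complex.I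

/-- The Jacobian determinant of a pair of functions. -/
noncomputable def jac (f g : ℂ → ℝ) (z : ℂ) : ℝ := dx f z * dy g z - dy f z * dx g z

/-- The scalar product of two gradients. -/
noncomputable def gdot (f g : ℂ → ℝ) (z : ℂ) : ℝ := dx f z * dx g z + dy f z * dy g z

theorem fderiv_eq_dx_dy (f : ℂ → ℝ) (z w : ℂ) : fderiv ℝ f z w = w.re * dx f z + w.im * dy f z := by
  have : w = w.re • (1 : ℂ) + w.im • Complex.I := by
    simp [Complex.re_add_im]
  conv_lhs => rw [this, map_add, map_smul, map_smul]
  rfl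

theorem norm_fderiv_sq (f : ℂ → ℝ) (z : ℂ) : ‖fderiv ℝ f z‖ ^ 2 = dx f z ^ 2 + dy f z ^ 2 := by
  have h1 : ‖fderiv ℝ f z‖ ≤ √(dx f z ^ 2 + dy f z ^ 2) := by
    refine ContinuousLinearMap.opNorm_le_bound _ (sqrt_nonneg _) fun w => ?_
    rw [fderiv_eq_dx_dy, Complex.norm_eq_sqrt_sq_add_sq, ← sqrt_mul (by positivity)]
    refine abs_le_sqrt ?_
    nlinarith [sq_nonneg (w.re * dy f z - w.im * dx f z)]
  refine le_antisymm ?_ ?_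
  · calc ‖fderiv ℝ f z‖ ^ 2 ≤ √(dx f z ^ 2 + dy f z ^ 2) ^ 2 := by gcongr
      _ = _ := sq_sqrt (by positivity)
  · have h2 := (fderiv ℝ f z).le_opNorm ⟨dx f z, dy f z⟩
    rw [fderiv_eq_dx_dy, Complex.norm_eq_sqrt_sq_add_sq] at h2
    have h3 := sq_sqrt (show 0 ≤ dx f z ^ 2 + dy f z ^ 2 by positivity)
    set s := √(dx f z ^ 2 + dy f z ^ 2)
    have h4 : s * s ≤ ‖fderiv ℝ f z‖ * s := by
      refine le_trans ?_ ((le_abs_self _).trans h2)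
      simp only
      nlinarith
    rw [← h3]
    rcases (sqrt_nonneg (dx f z ^ 2 + dy f z ^ 2)).eq_or_lt with h5 | h5
    · change 0 = s at h5
      rw [← h5, zero_pow two_ne_zero]
      positivity
    · have := le_of_mul_le_mul_right h4 h5
      exact pow_le_pow_left₀ h5.le this 2

theorem abs_jac_le (f g : ℂ → ℝ) (z : ℂ) : |jac f g z| ≤ ‖fderiv ℝ f z‖ * ‖fderiv ℝ g z‖ := by
  refine abs_le_of_sq_le_sq ?_ (by positivity)
  rw [mul_pow, norm_fderiv_sq, norm_fderiv_sq, jac]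
  nlinarith [sq_nonneg (dx f z * dx g z + dy f z * dy g z)]

theorem abs_gdot_le (f g : ℂ → ℝ) (z : ℂ) : |gdot f g z| ≤ ‖fderiv ℝ f z‖ * ‖fderiv ℝ g z‖ := by
  refine abs_le_of_sq_le_sq ?_ (by positivity)
  rw [mul_pow, norm_fderiv_sq, norm_fderiv_sq, gdot]
  nlinarith [sq_nonneg (dx f z * dy g z - dy f z * dx g z)]

theorem contDiffOn_fderiv_apply {U : Set ℂ} (hU : IsOpen U) {f : ℂ → ℝ} (hf : ContDiffOn ℝ ∞ f U)
    (u : ℂ) : ContDiffOn ℝ ∞ (fun z => fderiv ℝ f z u) U :=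
  (hf.fderiv_of_isOpen hU (by simp)).clm_apply contDiffOn_const

theorem contDiffOn_dx {U : Set ℂ} (hU : IsOpen U) {f : ℂ → ℝ} (hf : ContDiffOn ℝ ∞ f U) :
    ContDiffOn ℝ ∞ (dx f) U := contDiffOn_fderiv_apply hU hf 1

theorem contDiffOn_dy {U : Set ℂ} (hU : IsOpen U) {f : ℂ → ℝ} (hf : ContDiffOn ℝ ∞ f U) :
    ContDiffOn ℝ ∞ (dy f) U := contDiffOn_fderiv_apply hU hf Complex.I

theorem differentiableAt_of_contDiffOn {U : Set ℂ} (hU : IsOpen U) {f : ℂ → ℝ}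
    (hf : ContDiffOn ℝ ∞ f U) {z : ℂ} (hz : z ∈ U) : DifferentiableAt ℝ f z :=
  (hf.contDiffAt (hU.mem_nhds hz)).differentiableAt (by simp)

theorem dy_dx_eq_dx_dy {U : Set ℂ} (hU : IsOpen U) {f : ℂ → ℝ} (hf : ContDiffOn ℝ ∞ f U) {z : ℂ}
    (hz : z ∈ U) : dy (dx f) z = dx (dy f) z := by
  have h1 : ContDiffAt ℝ ∞ f z := hf.contDiffAt (hU.mem_nhds hz)
  have h2 : DifferentiableAt ℝ (fderiv ℝ f) z :=
    (h1.fderiv_right (m := 1) (by norm_cast)).differentiableAt (by simp)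
  have h3 : ∀ u v, fderiv ℝ (fun y => fderiv ℝ f y u) z v = fderiv ℝ (fderiv ℝ f) z v u := by
    intro u v
    rw [fderiv_clm_apply h2 (differentiableAt_const u)]
    simp
  have h4 : IsSymmSndFDerivAt ℝ f z := h1.isSymmSndFDerivAt (by
    rw [minSmoothness_of_isRCLikeNormedField]; exact WithTop.coe_le_coe.2 le_top)
  rw [dy, dx]
  change fderiv ℝ (fun y => fderiv ℝ f y 1) z _ = fderiv ℝ (fun y => fderiv ℝ f y Complex.I) z _
  rw [h3, h3, h4.eq]

theorem dx_mul {f g : ℂ → ℝ} {z : ℂ} (hf : DifferentiableAt ℝ f z) (hg : DifferentiableAt ℝ g z) :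
    dx (fun y => f y * g y) z = f z * dx g z + g z * dx f z := by
  rw [dx, fderiv_fun_mul hf hg]; rfl

theorem dy_mul {f g : ℂ → ℝ} {z : ℂ} (hf : DifferentiableAt ℝ f z) (hg : DifferentiableAt ℝ g z) :
    dy (fun y => f y * g y) z = f z * dy g z + g z * dy f z := by
  rw [dy, fderiv_fun_mul hf hg]; rfl

theorem IsTest.mul_of_contDiffOn {U : Set ℂ} {η : ℂ → ℝ} (hη : IsTest U η) (hU : IsOpen U)
    {f : ℂ → ℝ} (hf : ContDiffOn ℝ ∞ f U) : IsTest U (fun z => η z * f z) :=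
  hη.smul_of_contDiffOn hU hf

theorem IsTest.fderiv_apply {U : Set ℂ} {η : ℂ → ℝ} (hη : IsTest U η) (u : ℂ) :
    IsTest U (fun z => fderiv ℝ η z u) := by
  have hs : tsupport (fun z => fderiv ℝ η z u) ⊆ tsupport η := tsupport_fderiv_apply_subset ℝ u
  exact ⟨contDiffOn_univ.1 (contDiffOn_fderiv_apply isOpen_univ hη.smooth.contDiffOn u),
    hη.compact.of_isClosed_subset (isClosed_tsupport _) hs, hs.trans hη.subset⟩

theorem IsTest.dx {U : Set ℂ} {η : ℂ → ℝ} (hη : IsTest U η) : IsTest U (dx η) :=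
  hη.fderiv_apply 1

theorem IsTest.dy {U : Set ℂ} {η : ℂ → ℝ} (hη : IsTest U η) : IsTest U (dy η) :=
  hη.fderiv_apply Complex.I

theorem IsTest.integrable {E : Type*} [NormedAddCommGroup E] [NormedSpace ℝ E] {U : Set ℂ}
    {η : ℂ → E} (hη : IsTest U η) : Integrable η :=
  hη.smooth.continuous.integrable_of_hasCompactSupport hη.compact

theorem IsTest.integral_mul_fderiv {U : Set ℂ} {η f : ℂ → ℝ} (hη : IsTest U η) (hU : IsOpen U)
    (hf : ContDiffOn ℝ ∞ f U) (u : ℂ) :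
    ∫ z, η z * fderiv ℝ f z u = -∫ z, fderiv ℝ η z u * f z :=
  integral_mul_fderiv_eq_neg_fderiv_mul_of_integrable
    ((hη.fderiv_apply u).mul_of_contDiffOn hU hf).integrable
    (hη.mul_of_contDiffOn hU (contDiffOn_fderiv_apply hU hf u)).integrable
    (hη.mul_of_contDiffOn hU hf).integrable
    (fun x _ => hη.smooth.differentiable (by simp) x)
    (fun x hx => differentiableAt_of_contDiffOn hU hf (hη.subset hx))

theorem IsTest.integral_mul_dx {U : Set ℂ} {η f : ℂ → ℝ} (hη : IsTest U η) (hU : IsOpen U)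
    (hf : ContDiffOn ℝ ∞ f U) : ∫ z, η z * WenteDisk.dx f z = -∫ z, WenteDisk.dx η z * f z :=
  hη.integral_mul_fderiv hU hf 1

theorem IsTest.integral_mul_dy {U : Set ℂ} {η f : ℂ → ℝ} (hη : IsTest U η) (hU : IsOpen U)
    (hf : ContDiffOn ℝ ∞ f U) : ∫ z, η z * WenteDisk.dy f z = -∫ z, WenteDisk.dy η z * f z :=
  hη.integral_mul_fderiv hU hf Complex.I

theorem IsTest.eq_zero {U : Set ℂ} {E : Type*} [NormedAddCommGroup E] [NormedSpace ℝ E]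
    {η : ℂ → E} (hη : IsTest U η) {z : ℂ} (hz : z ∉ U) : η z = 0 :=
  image_eq_zero_of_notMem_tsupport fun h => hz (hη.subset h)

theorem IsTest.integrable_jac {U : Set ℂ} {η v : ℂ → ℝ} (hη : IsTest U η) (hU : IsOpen U)
    (hv : ContDiffOn ℝ ∞ v U) : Integrable (jac η v) :=
  (hη.dx.mul_of_contDiffOn hU (contDiffOn_dy hU hv)).integrable.sub
    (hη.dy.mul_of_contDiffOn hU (contDiffOn_dx hU hv)).integrable

theorem IsTest.integrable_gdot {U : Set ℂ} {η v : ℂ → ℝ} (hη : IsTest U η) (hU : IsOpen U)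
    (hv : ContDiffOn ℝ ∞ v U) : Integrable (gdot η v) :=
  (hη.dx.mul_of_contDiffOn hU (contDiffOn_dx hU hv)).integrable.add
    (hη.dy.mul_of_contDiffOn hU (contDiffOn_dy hU hv)).integrable

theorem IsTest.integral_jac {U : Set ℂ} {η v : ℂ → ℝ} (hη : IsTest U η) (hU : IsOpen U)
    (hv : ContDiffOn ℝ ∞ v U) : ∫ z, jac η v z = 0 := by
  have hvx := contDiffOn_dx hU hv
  have hvy := contDiffOn_dy hU hv
  have e1 := hη.integral_mul_dx hU hvy
  have e2 := hη.integral_mul_dy hU hvx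
  have e3 : ∫ z, η z * WenteDisk.dx (WenteDisk.dy v) z = ∫ z, η z * WenteDisk.dy (WenteDisk.dx v) z := by
    refine integral_congr_ae (Eventually.of_forall fun z => ?_)
    by_cases hz : z ∈ U
    · simp only [dy_dx_eq_dx_dy hU hv hz]
    · simp [hη.eq_zero hz]
  unfold jac
  rw [integral_sub (hη.dx.mul_of_contDiffOn hU hvy).integrable
    (hη.dy.mul_of_contDiffOn hU hvx).integrable]
  linarith

theorem IsTest.integral_gdot {U : Set ℂ} {η v : ℂ → ℝ} (hη : IsTest U η) (hU : IsOpen U)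
    (hv : ContDiffOn ℝ ∞ v U) : ∫ z, gdot η v z =
      -∫ z, η z * (WenteDisk.dx (WenteDisk.dx v) z + WenteDisk.dy (WenteDisk.dy v) z) := by
  have hvx := contDiffOn_dx hU hv
  have hvy := contDiffOn_dy hU hv
  have e1 := hη.integral_mul_dx hU hvx
  have e2 := hη.integral_mul_dy hU hvy
  unfold gdot
  simp_rw [mul_add]
  rw [integral_add (hη.dx.mul_of_contDiffOn hU hvx).integrable
    (hη.dy.mul_of_contDiffOn hU hvy).integrable,
    integral_add (hη.mul_of_contDiffOn hU (contDiffOn_dx hU hvx)).integrable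
    (hη.mul_of_contDiffOn hU (contDiffOn_dy hU hvy)).integrable]
  linarith

theorem IsTest.integral_gdot' {U : Set ℂ} {η v : ℂ → ℝ} (hη : IsTest U η) (hU : IsOpen U)
    (hv : ContDiffOn ℝ ∞ v U) : ∫ z, gdot η v z =
      -∫ z, (WenteDisk.dx (WenteDisk.dx η) z + WenteDisk.dy (WenteDisk.dy η) z) * v z := by
  have hvx := contDiffOn_dx hU hv
  have hvy := contDiffOn_dy hU hv
  have e1 := hη.dx.integral_mul_dx hU hv
  have e2 := hη.dy.integral_mul_dy hU hv
  unfold gdot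
  simp_rw [add_mul]
  rw [integral_add (hη.dx.mul_of_contDiffOn hU hvx).integrable
    (hη.dy.mul_of_contDiffOn hU hvy).integrable,
    integral_add (hη.dx.dx.mul_of_contDiffOn hU hv).integrable
    (hη.dy.dy.mul_of_contDiffOn hU hv).integrable]
  linarith

/-- A sequence of cutoff functions exhausting the unit disc, with transition layer of width
comparable to `1 / n`. -/
structure IsCutoff (C : ℝ) (η : ℕ → ℂ → ℝ) : Prop where
  test : ∀ n, IsTest (ball 0 1) (η n)
  nonneg : ∀ n z, 0 ≤ η n z
  le_one : ∀ n z, η n z ≤ 1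
  eq_one : ∀ (n : ℕ) (z : ℂ), 2 ≤ n * (1 - ‖z‖ ^ 2) → η n z = 1
  norm_fderiv_le : ∀ (n : ℕ) (z : ℂ), ‖fderiv ℝ (η n) z‖ ≤ C * n
  abs_laplacian_le : ∀ (n : ℕ) (z : ℂ), |dx (dx (η n)) z + dy (dy (η n)) z| ≤ C * n ^ 2

theorem exists_bound_of_eq_zero {f : ℝ → ℝ} (hf : Continuous f) (h0 : ∀ x ∉ Icc (0 : ℝ) 1, f x = 0) :
    ∃ M, 0 ≤ M ∧ ∀ x, |f x| ≤ M := by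
  obtain ⟨M, hM⟩ := isCompact_Icc.exists_bound_of_continuousOn (s := Icc (0 : ℝ) 1) hf.continuousOn
  refine ⟨M, (norm_nonneg _).trans (hM 0 (by simp)), fun x => ?_⟩
  by_cases hx : x ∈ Icc (0 : ℝ) 1
  · exact hM x hx
  · rw [h0 x hx, abs_zero]
    exact (norm_nonneg _).trans (hM 0 (by simp))

theorem deriv_smoothTransition_eq_zero {x : ℝ} (hx : x ∉ Icc (0 : ℝ) 1) :
    deriv smoothTransition x = 0 := by
  rw [mem_Icc, not_and_or, not_le, not_le] at hx
  rcases hx with hx | hx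
  · have : smoothTransition =ᶠ[𝓝 x] fun _ => 0 := by
      filter_upwards [Iio_mem_nhds hx] with y hy
      exact smoothTransition.zero_of_nonpos (le_of_lt hy)
    rw [this.deriv_eq]; simp
  · have : smoothTransition =ᶠ[𝓝 x] fun _ => 1 := by
      filter_upwards [Ioi_mem_nhds hx] with y hy
      exact smoothTransition.one_of_one_le (le_of_lt hy)
    rw [this.deriv_eq]; simp

theorem exists_cutoff : ∃ C > (0 : ℝ), ∃ η : ℕ → ℂ → ℝ, IsCutoff C η := by
  have hS : ContDiff ℝ ∞ smoothTransition := smoothTransition.contDiff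
  have hS1 : ContDiff ℝ ∞ (deriv smoothTransition) := (contDiff_infty_iff_deriv.1 hS).2
  have hS2 : ContDiff ℝ ∞ (deriv (deriv smoothTransition)) := (contDiff_infty_iff_deriv.1 hS1).2
  obtain ⟨M₁, hM₁0, hM₁⟩ := exists_bound_of_eq_zero hS1.continuous
    fun x hx => deriv_smoothTransition_eq_zero hx
  obtain ⟨M₂, hM₂0, hM₂⟩ := exists_bound_of_eq_zero hS2.continuous fun x hx => by
    have : deriv smoothTransition =ᶠ[𝓝 x] fun _ => 0 := by
      filter_upwards [isClosed_Icc.isOpen_compl.mem_nhds hx] with y hy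
      exact deriv_smoothTransition_eq_zero hy
    rw [this.deriv_eq]; simp
  set u : ℕ → ℂ → ℝ := fun n z => n * (1 - (z.re ^ 2 + z.im ^ 2)) - 1 with hu
  have hre : ContDiff ℝ ∞ fun z : ℂ => z.re := Complex.reCLM.contDiff
  have him : ContDiff ℝ ∞ fun z : ℂ => z.im := Complex.imCLM.contDiff
  have hdre : ∀ z : ℂ, HasFDerivAt (fun z : ℂ => z.re) Complex.reCLM z := fun z =>
    Complex.reCLM.hasFDerivAt
  have hdim : ∀ z : ℂ, HasFDerivAt (fun z : ℂ => z.im) Complex.imCLM z := fun z =>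
    Complex.imCLM.hasFDerivAt
  have huc : ∀ n, ContDiff ℝ ∞ (u n) := fun n =>
    (contDiff_const.mul (contDiff_const.sub ((hre.pow 2).add (him.pow 2)))).sub contDiff_const
  have hud : ∀ n z, HasFDerivAt (u n)
      ((-2 * n * z.re : ℝ) • Complex.reCLM + (-2 * n * z.im : ℝ) • Complex.imCLM) z := by
    intro n z
    have := (((((hdre z).pow 2).add ((hdim z).pow 2)).const_sub 1).const_mul (n : ℝ)).sub_const 1
    refine this.congr_fderiv ?_
    ext
    · simp; ring
  have hcomp : ∀ (f : ℝ → ℝ), ContDiff ℝ ∞ f → ∀ n z,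
      dx (fun z => f (u n z)) z = deriv f (u n z) * (-2 * n * z.re) ∧
      dy (fun z => f (u n z)) z = deriv f (u n z) * (-2 * n * z.im) := by
    intro f hf n z
    have h1 := ((hf.differentiable (by simp) (u n z)).hasDerivAt).comp_hasFDerivAt z (hud n z)
    have h2 : HasFDerivAt (fun z => f (u n z)) (deriv f (u n z) •
      ((-2 * n * z.re : ℝ) • Complex.reCLM + (-2 * n * z.im : ℝ) • Complex.imCLM)) z := h1
    rw [dx, dy, h2.fderiv]
    simp
  have hnorm : ∀ z : ℂ, ‖z‖ ^ 2 = z.re ^ 2 + z.im ^ 2 := fun z => by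
    rw [Complex.sq_norm, Complex.normSq_apply]; ring
  have hsub : ∀ n, tsupport (fun z => smoothTransition (u n z)) ⊆ {z | 1 ≤ n * (1 - ‖z‖ ^ 2)} := by
    intro n
    refine closure_minimal (fun z hz => ?_) ?_
    · by_contra h
      refine hz (smoothTransition.zero_of_nonpos ?_)
      simp only [mem_ofPred_eq, not_le, hnorm] at h
      simp only [hu]
      linarith
    · exact isClosed_le continuous_const (by fun_prop)
  have hball : ∀ n : ℕ, {z : ℂ | 1 ≤ n * (1 - ‖z‖ ^ 2)} ⊆ ball 0 1 := by
    intro n z hz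
    rw [mem_ofPred_eq] at hz
    rw [mem_ball_zero_iff]
    by_contra h
    have : (n : ℝ) * (1 - ‖z‖ ^ 2) ≤ 0 := mul_nonpos_of_nonneg_of_nonpos n.cast_nonneg (by nlinarith)
    linarith
  have htest : ∀ n, IsTest (ball 0 1) fun z => smoothTransition (u n z) := fun n =>
    ⟨hS.comp (huc n), (isCompact_closedBall (0 : ℂ) 1).of_isClosed_subset (isClosed_tsupport _)
      ((hsub n).trans ((hball n).trans ball_subset_closedBall)), (hsub n).trans (hball n)⟩
  have hz1 : ∀ n, ∀ z ∈ tsupport (fun z => smoothTransition (u n z)), z.re ^ 2 + z.im ^ 2 ≤ 1 := by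
    intro n z hz
    have := mem_ball_zero_iff.1 ((htest n).subset hz)
    rw [← hnorm]
    nlinarith [norm_nonneg z]
  refine ⟨2 * M₁ + 4 * M₂ + 4 * M₁ + 1, by positivity, fun n z => smoothTransition (u n z),
    htest, fun n z => smoothTransition.nonneg _, fun n z => smoothTransition.le_one _, ?_, ?_, ?_⟩
  · intro n z hz
    refine smoothTransition.one_of_one_le ?_
    rw [hnorm] at hz
    simp only [hu]
    linarith
  · intro n z
    by_cases hz : z ∈ tsupport (fun z => smoothTransition (u n z))
    · have h1 := hcomp _ hS n z
      refine le_trans ?_ (show 2 * M₁ * n ≤ _ by gcongr; linarith)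
      refine le_of_sq_le_sq ?_ (by positivity)
      rw [norm_fderiv_sq, h1.1, h1.2]
      calc _ = (2 * |deriv smoothTransition (u n z)| * n) ^ 2 * (z.re ^ 2 + z.im ^ 2) := by
            rw [mul_pow (2 * |_|), mul_pow 2 |_|, sq_abs]; ring
        _ ≤ (2 * M₁ * n) ^ 2 * 1 := by
            gcongr
            · exact hM₁ _
            · exact hz1 n z hz
        _ = _ := mul_one _
    · have : fderiv ℝ (fun z => smoothTransition (u n z)) z = 0 :=
        image_eq_zero_of_notMem_tsupport fun h => hz (tsupport_fderiv_subset ℝ h)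
      rw [this, norm_zero]
      positivity
  · intro n z
    by_cases hz : z ∈ tsupport (fun z => smoothTransition (u n z))
    · have e1 : dx (fun z => smoothTransition (u n z)) =
          fun z => deriv smoothTransition (u n z) * (-2 * n * z.re) := by
        ext z; exact (hcomp _ hS n z).1
      have e2 : dy (fun z => smoothTransition (u n z)) =
          fun z => deriv smoothTransition (u n z) * (-2 * n * z.im) := by
        ext z; exact (hcomp _ hS n z).2
      have d1 : DifferentiableAt ℝ (fun z => deriv smoothTransition (u n z)) z :=
        (hS1.comp (huc n)).differentiable (by simp) z
      have e3 : dx (fun z : ℂ => -2 * n * z.re) z = -2 * n := by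
        have : HasFDerivAt (fun z : ℂ => -2 * n * z.re) ((-2 * n : ℝ) • Complex.reCLM) z :=
          (hdre z).const_mul _
        rw [dx, this.fderiv]; simp
      have e4 : dy (fun z : ℂ => -2 * n * z.im) z = -2 * n := by
        have : HasFDerivAt (fun z : ℂ => -2 * n * z.im) ((-2 * n : ℝ) • Complex.imCLM) z :=
          (hdim z).const_mul _
        rw [dy, this.fderiv]; simp
      have e5 := hcomp _ hS1 n z
      rw [e1, e2, dx_mul d1 ((hdre z).differentiableAt.const_mul _),
        dy_mul d1 ((hdim z).differentiableAt.const_mul _), e3, e4, e5.1, e5.2]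
      have b1 := hM₁ (u n z)
      have b2 := hM₂ (u n z)
      have hr := hz1 n z hz
      set A := deriv smoothTransition (u n z)
      set B := deriv (deriv smoothTransition) (u n z)
      have hn : (n : ℝ) ≤ (n : ℝ) ^ 2 := by
        exact_mod_cast Nat.le_self_pow two_ne_zero n
      calc _ = |4 * B * (n ^ 2 * (z.re ^ 2 + z.im ^ 2)) - 4 * A * n| := by congr 1; ring
        _ ≤ |4 * B * (n ^ 2 * (z.re ^ 2 + z.im ^ 2))| + |4 * A * n| := abs_sub _ _
        _ = 4 * |B| * (n ^ 2 * (z.re ^ 2 + z.im ^ 2)) + 4 * |A| * n := by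
            have h4 : |(4 : ℝ)| = 4 := abs_of_nonneg (by norm_num)
            rw [abs_mul (4 * B), abs_mul 4, abs_mul (4 * A), abs_mul 4, h4,
              abs_of_nonneg (show (0 : ℝ) ≤ n ^ 2 * (z.re ^ 2 + z.im ^ 2) by positivity),
              Nat.abs_cast]
        _ ≤ 4 * M₂ * (n ^ 2 * 1) + 4 * M₁ * n ^ 2 := by gcongr
        _ ≤ _ := by nlinarith [sq_nonneg (n : ℝ)]
    · have t1 : dx (dx fun z => smoothTransition (u n z)) z = 0 :=
        image_eq_zero_of_notMem_tsupport fun h => hz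
          (tsupport_fderiv_apply_subset ℝ (1 : ℂ) (tsupport_fderiv_apply_subset ℝ (1 : ℂ) h))
      have t2 : dy (dy fun z => smoothTransition (u n z)) z = 0 :=
        image_eq_zero_of_notMem_tsupport fun h => hz
          (tsupport_fderiv_apply_subset ℝ Complex.I (tsupport_fderiv_apply_subset ℝ Complex.I h))
      rw [t1, t2, add_zero, abs_zero]
      positivity

theorem IsCutoff.eventuallyEq_one {C : ℝ} {η : ℕ → ℂ → ℝ} (hη : IsCutoff C η) {n : ℕ} {z : ℂ}
    (hz : 2 < n * (1 - ‖z‖ ^ 2)) : η n =ᶠ[𝓝 z] fun _ => 1 := by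
  have ho : IsOpen {z : ℂ | 2 < n * (1 - ‖z‖ ^ 2)} := isOpen_lt continuous_const (by fun_prop)
  filter_upwards [ho.mem_nhds hz] with y hy
  exact hη.eq_one n y hy.le

theorem IsCutoff.fderiv_eq_zero {C : ℝ} {η : ℕ → ℂ → ℝ} (hη : IsCutoff C η) {n : ℕ} {z : ℂ}
    (hz : 2 < n * (1 - ‖z‖ ^ 2)) : fderiv ℝ (η n) z = 0 := by
  rw [(hη.eventuallyEq_one hz).fderiv_eq]; simp

theorem IsCutoff.laplacian_eq_zero {C : ℝ} {η : ℕ → ℂ → ℝ} (hη : IsCutoff C η) {n : ℕ} {z : ℂ}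
    (hz : 2 < n * (1 - ‖z‖ ^ 2)) : dx (dx (η n)) z + dy (dy (η n)) z = 0 := by
  have h := (hη.eventuallyEq_one hz).fderiv (𝕜 := ℝ)
  have h1 : dx (η n) =ᶠ[𝓝 z] fun _ => 0 := by
    filter_upwards [h] with y hy
    rw [dx, hy]; simp
  have h2 : dy (η n) =ᶠ[𝓝 z] fun _ => 0 := by
    filter_upwards [h] with y hy
    rw [dy, hy]; simp
  rw [dx, dy, h1.fderiv_eq, h2.fderiv_eq]; simp

theorem exists_bound_of_eq_zero_on_circle {R : ℝ} (hR : 1 < R) {ψ : ℂ → ℝ}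
    (hψ : ContDiffOn ℝ ∞ ψ (ball 0 R)) (h0 : ∀ z, ‖z‖ = 1 → ψ z = 0) :
    ∃ C, 0 ≤ C ∧ ∀ z ∈ ball (0 : ℂ) 1, ‖fderiv ℝ ψ z‖ ≤ C ∧ |ψ z| ≤ C * (1 - ‖z‖ ^ 2) := by
  have hsub : closedBall (0 : ℂ) 1 ⊆ ball 0 R := closedBall_subset_ball hR
  have hc : ContinuousOn (fderiv ℝ ψ) (closedBall 0 1) :=
    (hψ.continuousOn_fderiv_of_isOpen isOpen_ball (by simp)).mono hsub
  obtain ⟨C, hC⟩ := (isCompact_closedBall (0 : ℂ) 1).exists_bound_of_continuousOn hc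
  have hC0 : 0 ≤ C := (norm_nonneg _).trans (hC 0 (by simp))
  refine ⟨C, hC0, fun z hz => ⟨hC z (ball_subset_closedBall hz), ?_⟩⟩
  rw [mem_ball_zero_iff] at hz
  obtain ⟨w, hw, hzw⟩ : ∃ w : ℂ, ‖w‖ = 1 ∧ ‖z - w‖ = 1 - ‖z‖ := by
    rcases eq_or_ne z 0 with rfl | hz0
    · exact ⟨1, by simp, by simp⟩
    · have hn : ‖z‖ ≠ 0 := norm_ne_zero_iff.2 hz0
      refine ⟨(‖z‖⁻¹ : ℝ) • z, by rw [norm_smul, norm_inv, norm_norm, inv_mul_cancel₀ hn], ?_⟩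
      have : z - (‖z‖⁻¹ : ℝ) • z = (1 - ‖z‖⁻¹ : ℝ) • z := by rw [sub_smul, one_smul]
      rw [this, norm_smul, Real.norm_eq_abs, abs_of_nonpos, neg_sub, sub_mul, inv_mul_cancel₀ hn,
        one_mul]
      rw [sub_nonpos]
      exact (one_le_inv₀ (norm_pos_iff.2 hz0)).2 hz.le
  have := (convex_closedBall (0 : ℂ) 1).norm_image_sub_le_of_norm_fderiv_le (𝕜 := ℝ) (f := ψ)
    (fun y hy => differentiableAt_of_contDiffOn isOpen_ball hψ (hsub hy)) hC
    (x := w) (y := z) (by simp [hw]) (by simpa using hz.le)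
  rw [h0 w hw, sub_zero, hzw, Real.norm_eq_abs] at this
  refine this.trans ?_
  gcongr
  nlinarith [norm_nonneg z]

theorem IsCutoff.norm_fderiv_mul_le {C : ℝ} (hC : 0 < C) {η : ℕ → ℂ → ℝ} (hη : IsCutoff C η)
    {R : ℝ} (hR : 1 < R) {ξ : ℂ → ℝ} (hξ : ContDiffOn ℝ ∞ ξ (ball 0 R)) {B : ℝ} (hB0 : 0 ≤ B)
    (hB : ∀ z ∈ ball (0 : ℂ) 1, ‖fderiv ℝ ξ z‖ ≤ B ∧ |ξ z| ≤ B * (1 - ‖z‖ ^ 2)) (n : ℕ) {z : ℂ}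
    (hz : z ∈ ball (0 : ℂ) 1) : ‖fderiv ℝ (fun y => η n y * ξ y) z‖ ≤ B + 2 * C * B := by
  obtain ⟨h1, h2⟩ := hB z hz
  rw [fderiv_fun_mul ((hη.test n).smooth.differentiable (by simp) z)
    (differentiableAt_of_contDiffOn isOpen_ball hξ (ball_subset_ball hR.le hz))]
  refine (norm_add_le _ _).trans (add_le_add ?_ ?_)
  · rw [norm_smul, Real.norm_eq_abs, abs_of_nonneg (hη.nonneg n z)]
    exact (mul_le_mul (hη.le_one n z) h1 (norm_nonneg _) zero_le_one).trans_eq (one_mul B)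
  · rw [norm_smul, Real.norm_eq_abs]
    by_cases h3 : 2 < n * (1 - ‖z‖ ^ 2)
    · rw [hη.fderiv_eq_zero h3, norm_zero, mul_zero]
      positivity
    · calc |ξ z| * ‖fderiv ℝ (η n) z‖ ≤ (B * (1 - ‖z‖ ^ 2)) * (C * n) :=
            mul_le_mul h2 (hη.norm_fderiv_le n z) (norm_nonneg _) ((abs_nonneg _).trans h2)
        _ = B * C * (n * (1 - ‖z‖ ^ 2)) := by ring
        _ ≤ B * C * 2 := by gcongr; exact not_lt.1 h3
        _ = _ := by ring

theorem eventually_lt_mul_one_sub {z : ℂ} (hz : z ∈ ball (0 : ℂ) 1) :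
    ∀ᶠ n : ℕ in atTop, 2 < n * (1 - ‖z‖ ^ 2) := by
  have h : 0 < 1 - ‖z‖ ^ 2 := by
    rw [mem_ball_zero_iff] at hz
    nlinarith [norm_nonneg z]
  exact (tendsto_natCast_atTop_atTop.atTop_mul_const h).eventually_gt_atTop 2

theorem aestronglyMeasurable_fderiv_apply {U : Set ℂ} (hU : IsOpen U) {f : ℂ → ℝ}
    (hf : ContDiffOn ℝ ∞ f U) {V : ℂ → ℂ} (hV : AEStronglyMeasurable V (volume.restrict U)) :
    AEStronglyMeasurable (fun z => fderiv ℝ f z (V z)) (volume.restrict U) := by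
  simp_rw [fderiv_eq_dx_dy]
  exact ((Complex.continuous_re.comp_aestronglyMeasurable hV).mul
    ((contDiffOn_dx hU hf).continuousOn.aestronglyMeasurable hU.measurableSet)).add
    ((Complex.continuous_im.comp_aestronglyMeasurable hV).mul
    ((contDiffOn_dy hU hf).continuousOn.aestronglyMeasurable hU.measurableSet))

theorem IsCutoff.tendsto_integral_fderiv_mul {C : ℝ} (hC : 0 < C) {η : ℕ → ℂ → ℝ}
    (hη : IsCutoff C η) {R : ℝ} (hR : 1 < R) {ξ : ℂ → ℝ} (hξ : ContDiffOn ℝ ∞ ξ (ball 0 R))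
    (h0 : ∀ z, ‖z‖ = 1 → ξ z = 0) {V : ℂ → ℂ} (hV : IntegrableOn V (ball 0 1)) :
    Tendsto (fun n => ∫ z in ball (0 : ℂ) 1, fderiv ℝ (fun y => η n y * ξ y) z (V z)) atTop
      (𝓝 (∫ z in ball (0 : ℂ) 1, fderiv ℝ ξ z (V z))) := by
  obtain ⟨B, hB0, hB⟩ := exists_bound_of_eq_zero_on_circle hR hξ h0
  have hξ1 : ContDiffOn ℝ ∞ ξ (ball 0 1) := hξ.mono (ball_subset_ball hR.le)
  refine tendsto_integral_of_dominated_convergence (fun z => (B + 2 * C * B) * ‖V z‖) ?_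
    (hV.norm.const_mul _) ?_ ?_
  · exact fun n => aestronglyMeasurable_fderiv_apply isOpen_ball
      ((hη.test n).smooth.contDiffOn.mul hξ1) hV.aestronglyMeasurable
  · refine fun n => (ae_restrict_iff' measurableSet_ball).2 (Eventually.of_forall fun z hz => ?_)
    refine (ContinuousLinearMap.le_opNorm _ _).trans ?_
    gcongr
    exact hη.norm_fderiv_mul_le hC hR hξ hB0 hB n hz
  · refine (ae_restrict_iff' measurableSet_ball).2 (Eventually.of_forall fun z hz => ?_)
    refine tendsto_const_nhds.congr' ?_
    filter_upwards [eventually_lt_mul_one_sub hz] with n hn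
    have : (fun y => η n y * ξ y) =ᶠ[𝓝 z] ξ := by
      filter_upwards [hη.eventuallyEq_one hn] with y hy
      rw [hy, one_mul]
    rw [this.fderiv_eq]

theorem volume_layer_le {n : ℕ} (hn : 2 ≤ n) :
    volume {z ∈ ball (0 : ℂ) 1 | n * (1 - ‖z‖ ^ 2) ≤ 2} ≤ ENNReal.ofReal (2 * π / n) := by
  have hn0 : (0 : ℝ) < n := by positivity
  have hn2 : (2 : ℝ) ≤ n := by exact_mod_cast hn
  have h1 : (0 : ℝ) ≤ 1 - 2 / n := by
    rw [sub_nonneg, div_le_one hn0]; exact hn2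
  have hs := sq_sqrt h1
  have hle : √(1 - 2 / n) ≤ 1 := by
    rw [sqrt_le_one]
    have : (0 : ℝ) ≤ 2 / n := by positivity
    linarith
  have hsub : {z ∈ ball (0 : ℂ) 1 | n * (1 - ‖z‖ ^ 2) ≤ 2} ⊆
      ball (0 : ℂ) 1 \ ball 0 √(1 - 2 / n) := by
    rintro z ⟨hz, hz2⟩
    refine ⟨hz, fun h => ?_⟩
    rw [mem_ball_zero_iff] at h
    have h3 : ‖z‖ ^ 2 < 1 - 2 / n := by
      rw [← hs]; gcongr
    have h4 : n * (2 / n : ℝ) = 2 := by field_simp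
    nlinarith
  refine (measure_mono hsub).trans ?_
  rw [measure_sdiff (ball_subset_ball hle) measurableSet_ball.nullMeasurableSet
    measure_ball_lt_top.ne, volume_ball_eq _ zero_le_one, volume_ball_eq _ (sqrt_nonneg _), hs,
    ← ENNReal.ofReal_sub _ (by positivity)]
  refine ENNReal.ofReal_le_ofReal (le_of_eq ?_)
  ring

theorem tendsto_integral_layer {φ : ℂ → ℝ} (hφ : ContinuousOn φ (closedBall 0 1))
    (h0 : ∀ z, ‖z‖ = 1 → φ z = 0) {G : ℕ → ℂ → ℝ} {K : ℝ} (hK : 0 ≤ K)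
    (hG : ∀ n, ∀ z ∈ ball (0 : ℂ) 1, |G n z| ≤ |φ z| * (K * n))
    (hG0 : ∀ (n : ℕ) (z : ℂ), z ∈ ball (0 : ℂ) 1 → 2 < n * (1 - ‖z‖ ^ 2) → G n z = 0)
    (hG1 : ∀ n, ∀ z ∉ ball (0 : ℂ) 1, G n z = 0) :
    Tendsto (fun n => ∫ z, G n z) atTop (𝓝 0) := by
  rw [Metric.tendsto_atTop]
  intro ε hε
  set δ := ε / (2 * π * (K + 1) + 1) with hδ
  have hδ0 : 0 < δ := by positivity
  obtain ⟨N, hN⟩ : ∃ N : ℕ, ∀ n ≥ N, ∀ z ∈ ball (0 : ℂ) 1, n * (1 - ‖z‖ ^ 2) ≤ 2 → |φ z| ≤ δ := by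
    set S := {z ∈ closedBall (0 : ℂ) 1 | δ ≤ |φ z|} with hS
    have hSc : IsCompact S := by
      refine (isCompact_closedBall (0 : ℂ) 1).of_isClosed_subset ?_ (sep_subset _ _)
      exact hφ.abs.preimage_isClosed_of_isClosed isClosed_closedBall isClosed_Ici
    rcases S.eq_empty_or_nonempty with he | hne
    · refine ⟨0, fun n _ z hz _ => ?_⟩
      by_contra h
      have : z ∈ S := ⟨ball_subset_closedBall hz, (not_le.1 h).le⟩
      rw [he] at this
      exact this
    · obtain ⟨w, hw, hmin⟩ := hSc.exists_isMinOn hne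
        (show ContinuousOn (fun z : ℂ => 1 - ‖z‖ ^ 2) S by fun_prop)
      have hw1 : w ∈ ball (0 : ℂ) 1 := by
        have h1 := mem_closedBall_zero_iff.1 hw.1
        rw [mem_ball_zero_iff]
        refine h1.lt_of_ne fun h => ?_
        have := hw.2
        rw [h0 w h, abs_zero] at this
        linarith
      obtain ⟨N, hN⟩ := eventually_atTop.1 (eventually_lt_mul_one_sub hw1)
      refine ⟨N, fun n hn z hz h2 => ?_⟩
      by_contra h
      have h3 := hmin (show z ∈ S from ⟨ball_subset_closedBall hz, (not_le.1 h).le⟩)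
      have h4 := hN n hn
      have h5 : (n : ℝ) * (1 - ‖w‖ ^ 2) ≤ n * (1 - ‖z‖ ^ 2) :=
        mul_le_mul_of_nonneg_left h3 n.cast_nonneg
      linarith
  refine ⟨max N 2, fun n hn => ?_⟩
  have hnN : N ≤ n := (le_max_left _ _).trans hn
  have hn2 : 2 ≤ n := (le_max_right _ _).trans hn
  have hn0 : (0 : ℝ) < n := by positivity
  set L := {z ∈ ball (0 : ℂ) 1 | n * (1 - ‖z‖ ^ 2) ≤ 2} with hL
  have e : ∫ z, G n z = ∫ z in L, G n z := by
    rw [setIntegral_eq_integral_of_forall_compl_eq_zero]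
    intro z hz
    by_cases hz1 : z ∈ ball (0 : ℂ) 1
    · exact hG0 n z hz1 (not_le.1 fun h => hz ⟨hz1, h⟩)
    · exact hG1 n z hz1
  have hvol := volume_layer_le hn2
  have hb : ‖∫ z in L, G n z‖ ≤ δ * (K * n) * volume.real L := by
    refine norm_setIntegral_le_of_norm_le_const (hvol.trans_lt ENNReal.ofReal_lt_top) fun z hz => ?_
    refine (hG n z hz.1).trans ?_
    gcongr
    exact hN n hnN z hz.1 hz.2
  have hv2 : volume.real L ≤ 2 * π / n := ENNReal.toReal_le_of_le_ofReal (by positivity) hvol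
  rw [dist_zero_right, e]
  calc ‖∫ z in L, G n z‖ ≤ δ * (K * n) * (2 * π / n) := hb.trans (by gcongr)
    _ = δ * (2 * π * K) := by field_simp
    _ < δ * (2 * π * (K + 1) + 1) := by gcongr; nlinarith [pi_pos]
    _ = ε := by rw [hδ]; field_simp

/-- The gradient of a real function, as a complex number. -/
noncomputable def grd (f : ℂ → ℝ) (z : ℂ) : ℂ := ⟨dx f z, dy f z⟩

theorem norm_grd (f : ℂ → ℝ) (z : ℂ) : ‖grd f z‖ = ‖fderiv ℝ f z‖ := by
  rw [← sq_eq_sq₀ (norm_nonneg _) (norm_nonneg _), norm_fderiv_sq, Complex.sq_norm,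
    Complex.normSq_apply, grd]
  ring

theorem inner_grd (f : ℂ → ℝ) (z w : ℂ) : inner ℝ (grd f z) w = fderiv ℝ f z w := by
  rw [fderiv_eq_dx_dy, Complex.inner, grd]
  simp [Complex.mul_re]

theorem fderiv_grd (f g : ℂ → ℝ) (z : ℂ) : fderiv ℝ g z (grd f z) = gdot f g z := by
  rw [fderiv_eq_dx_dy, grd, gdot]

theorem contDiffOn_grd {U : Set ℂ} (hU : IsOpen U) {f : ℂ → ℝ} (hf : ContDiffOn ℝ ∞ f U) :
    ContDiffOn ℝ ∞ (grd f) U := by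
  have : grd f = fun z => (dx f z : ℂ) + (dy f z : ℂ) * Complex.I := by
    ext z
    exact (Complex.re_add_im (grd f z)).symm
  rw [this]
  exact (Complex.ofRealCLM.contDiff.comp_contDiffOn (contDiffOn_dx hU hf)).add
    ((Complex.ofRealCLM.contDiff.comp_contDiffOn (contDiffOn_dy hU hf)).mul contDiffOn_const)

theorem IsTest.dx_eq_zero {U : Set ℂ} {η : ℂ → ℝ} (hη : IsTest U η) {z : ℂ} (hz : z ∉ U) :
    WenteDisk.dx η z = 0 := hη.dx.eq_zero hz

theorem IsTest.dy_eq_zero {U : Set ℂ} {η : ℂ → ℝ} (hη : IsTest U η) {z : ℂ} (hz : z ∉ U) :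
    WenteDisk.dy η z = 0 := hη.dy.eq_zero hz

theorem IsPotential.integral_gdot {h : ℂ → ℂ} {ψ : ℂ → ℝ} (hh : IsTest (ball 0 1) h)
    (hψ : IsPotential h ψ) {ξ : ℂ → ℝ} (hξ : IsTest (ball 0 1) ξ) :
    ∫ z, gdot ψ ξ z = ∫ z, fderiv ℝ ξ z (h z) := by
  obtain ⟨R, hR, v, hψc, hv, hd⟩ := hψ.exists_stream
  have hsub : ball (0 : ℂ) 1 ⊆ ball 0 R := ball_subset_ball hR.le
  have e : ∀ z, gdot ψ ξ z = fderiv ℝ ξ z (h z) + jac ξ v z := by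
    intro z
    rw [fderiv_eq_dx_dy, gdot, jac]
    by_cases hz : z ∈ ball (0 : ℂ) 1
    · have := hd z (hsub hz)
      change dx ψ z = _ + dy v z ∧ dy ψ z = _ - dx v z at this
      rw [this.1, this.2]
      ring
    · rw [hξ.dx_eq_zero hz, hξ.dy_eq_zero hz]
      ring
  have hi : Integrable fun z => fderiv ℝ ξ z (h z) := by
    simp_rw [← inner_grd]
    exact hh.integrable_inner isOpen_ball
      (contDiffOn_grd isOpen_ball hξ.smooth.contDiffOn).continuousOn
  simp_rw [e]
  rw [integral_add hi (hξ.integrable_jac isOpen_ball (hv.mono hsub)),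
    hξ.integral_jac isOpen_ball (hv.mono hsub), add_zero]

theorem IsPotential.contDiffOn {h : ℂ → ℂ} {ψ : ℂ → ℝ} (hψ : IsPotential h ψ) :
    ContDiffOn ℝ ∞ ψ (ball 0 1) := by
  obtain ⟨R, hR, v, hψc, hv, hd⟩ := hψ.exists_stream
  exact hψc.mono (ball_subset_ball hR.le)

theorem IsPotential.exists_bound {h : ℂ → ℂ} {ψ : ℂ → ℝ} (hψ : IsPotential h ψ) :
    ∃ C, 0 ≤ C ∧ ∀ z ∈ ball (0 : ℂ) 1, ‖fderiv ℝ ψ z‖ ≤ C ∧ |ψ z| ≤ C * (1 - ‖z‖ ^ 2) := by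
  obtain ⟨R, hR, v, hψc, hv, hd⟩ := hψ.exists_stream
  exact exists_bound_of_eq_zero_on_circle hR hψc hψ.eq_zero

theorem IsPotential.integrableOn_grd {h : ℂ → ℂ} {ψ : ℂ → ℝ} (hψ : IsPotential h ψ) :
    IntegrableOn (grd ψ) (ball 0 1) := by
  obtain ⟨C, hC0, hC⟩ := hψ.exists_bound
  refine IntegrableOn.of_bound measure_ball_lt_top
    ((contDiffOn_grd isOpen_ball hψ.contDiffOn).continuousOn.aestronglyMeasurable
      measurableSet_ball) C ?_
  refine (ae_restrict_iff' measurableSet_ball).2 (Eventually.of_forall fun z hz => ?_)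
  rw [norm_grd]
  exact (hC z hz).1

theorem setIntegral_ball_eq {f : ℂ → ℝ} (h0 : ∀ z ∉ ball (0 : ℂ) 1, f z = 0) :
    ∫ z in ball (0 : ℂ) 1, f z = ∫ z, f z :=
  setIntegral_eq_integral_of_forall_compl_eq_zero h0

theorem IsPotential.integral_gdot_potential {h g : ℂ → ℂ} {ψ χ : ℂ → ℝ}
    (hh : IsTest (ball 0 1) h) (hψ : IsPotential h ψ) (hχ : IsPotential g χ) :
    ∫ z in ball (0 : ℂ) 1, gdot ψ χ z = ∫ z in ball (0 : ℂ) 1, fderiv ℝ χ z (h z) := by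
  obtain ⟨C, hC, η, hη⟩ := exists_cutoff
  obtain ⟨R, hR, v, hχc, -, -⟩ := hχ.exists_stream
  have t1 := hη.tendsto_integral_fderiv_mul hC hR hχc hχ.eq_zero hψ.integrableOn_grd
  have t2 := hη.tendsto_integral_fderiv_mul hC hR hχc hχ.eq_zero (V := h) hh.integrable.integrableOn
  simp_rw [fderiv_grd] at t1
  refine tendsto_nhds_unique t1 (t2.congr fun n => ?_)
  have ht : IsTest (ball 0 1) (fun y => η n y * χ y) :=
    (hη.test n).mul_of_contDiffOn isOpen_ball hχ.contDiffOn
  rw [setIntegral_ball_eq, setIntegral_ball_eq, hψ.integral_gdot hh ht]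
  · intro z hz
    rw [gdot, ht.dx_eq_zero hz, ht.dy_eq_zero hz]
    ring
  · intro z hz
    rw [hh.eq_zero hz, map_zero]

theorem gdot_comm (f g : ℂ → ℝ) (z : ℂ) : gdot f g z = gdot g f z := by
  rw [gdot, gdot]; ring

theorem IsPotential.integral_fderiv_symm {h g : ℂ → ℂ} {ψ χ : ℂ → ℝ}
    (hh : IsTest (ball 0 1) h) (hψ : IsPotential h ψ) (hg : IsTest (ball 0 1) g)
    (hχ : IsPotential g χ) :
    ∫ z in ball (0 : ℂ) 1, fderiv ℝ χ z (h z) = ∫ z in ball (0 : ℂ) 1, fderiv ℝ ψ z (g z) := by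
  rw [← hψ.integral_gdot_potential hh hχ, ← hχ.integral_gdot_potential hg hψ]
  simp_rw [gdot_comm ψ χ]

theorem IsPotential.energy_le {h : ℂ → ℂ} {ψ : ℂ → ℝ}
    (hh : IsTest (ball 0 1) h) (hψ : IsPotential h ψ) :
    ∫⁻ z in ball (0 : ℂ) 1, ENNReal.ofReal (‖fderiv ℝ ψ z‖ ^ 2) ≤
      ∫⁻ z in ball (0 : ℂ) 1, ENNReal.ofReal (‖h z‖ ^ 2) := by
  obtain ⟨C, hC0, hC⟩ := hψ.exists_bound
  have hcont : ContinuousOn (fun z => ‖fderiv ℝ ψ z‖ ^ 2) (ball 0 1) :=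
    (hψ.contDiffOn.continuousOn_fderiv_of_isOpen isOpen_ball (by simp)).norm.pow 2
  have i1 : IntegrableOn (fun z => ‖fderiv ℝ ψ z‖ ^ 2) (ball 0 1) := by
    refine IntegrableOn.of_bound measure_ball_lt_top
      (hcont.aestronglyMeasurable measurableSet_ball) (C ^ 2) ?_
    refine (ae_restrict_iff' measurableSet_ball).2 (Eventually.of_forall fun z hz => ?_)
    rw [Real.norm_of_nonneg (by positivity)]
    gcongr
    exact (hC z hz).1
  have i2 : IntegrableOn (fun z => ‖h z‖ ^ 2) (ball 0 1) := by
    refine Integrable.integrableOn (Continuous.integrable_of_hasCompactSupport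
      (hh.smooth.continuous.norm.pow 2) (hh.compact.mono fun z hz h0 => hz ?_))
    simp [h0]
  have e := hψ.integral_gdot_potential hh hψ
  have e2 : ∀ z, gdot ψ ψ z = ‖fderiv ℝ ψ z‖ ^ 2 := fun z => by rw [norm_fderiv_sq, gdot]; ring
  simp_rw [e2] at e
  have hle : ∫ z in ball (0 : ℂ) 1, fderiv ℝ ψ z (h z) ≤
      ∫ z in ball (0 : ℂ) 1, (2⁻¹ * ‖fderiv ℝ ψ z‖ ^ 2 + 2⁻¹ * ‖h z‖ ^ 2) := by
    refine integral_mono ?_ ?_ ?_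
    · simp_rw [← inner_grd]
      exact (hh.integrable_inner isOpen_ball
        (contDiffOn_grd isOpen_ball hψ.contDiffOn).continuousOn).integrableOn
    · exact (i1.const_mul _).add (i2.const_mul _)
    · intro z
      refine (le_abs_self _).trans (((fderiv ℝ ψ z).le_opNorm (h z)).trans ?_)
      nlinarith [sq_nonneg (‖fderiv ℝ ψ z‖ - ‖h z‖)]
  rw [integral_add (i1.const_mul _) (i2.const_mul _), integral_const_mul, integral_const_mul,
    ← e] at hle
  rw [← ofReal_integral_eq_lintegral_ofReal i1 (Eventually.of_forall fun z => by positivity),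
    ← ofReal_integral_eq_lintegral_ofReal i2 (Eventually.of_forall fun z => by positivity)]
  exact ENNReal.ofReal_le_ofReal (by linarith)

/-- Integration by parts for a solution of `Δφ = J(a, b)` against a potential, without
differentiating `a` and with a null error as the cutoff exhausts the disc. -/
theorem integral_fderiv_eq_cutoff {h : ℂ → ℂ} {ψ v a b φ η : ℂ → ℝ} {c : ℝ}
    (hh : IsTest (ball 0 1) h) (hψ : ContDiffOn ℝ ∞ ψ (ball 0 1)) (hv : ContDiffOn ℝ ∞ v (ball 0 1))
    (hd : ∀ z ∈ ball (0 : ℂ) 1, dx ψ z = (h z).re + dy v z ∧ dy ψ z = (h z).im - dx v z)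
    (ha : ContDiffOn ℝ ∞ a (ball 0 1)) (hb : ContDiffOn ℝ ∞ b (ball 0 1))
    (hφ : ContDiffOn ℝ ∞ φ (ball 0 1))
    (hlap : ∀ z ∈ ball (0 : ℂ) 1, dx (dx φ) z + dy (dy φ) z = jac a b z)
    (hη : IsTest (ball 0 1) η) (hη1 : ∀ z ∈ tsupport h, η z = 1) :
    ∫ z, fderiv ℝ φ z (h z) = (∫ z, (a z - c) * jac (fun y => η y * ψ y) b z) +
      ∫ z, φ z * (ψ z * (dx (dx η) z + dy (dy η) z) + gdot η ψ z + jac η v z) := by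
  have hU : IsOpen (ball (0 : ℂ) 1) := isOpen_ball
  have hac : ContDiffOn ℝ ∞ (fun z => a z - c) (ball 0 1) := ha.sub contDiffOn_const
  have hηψ := hη.mul_of_contDiffOn hU hψ
  have hηφ := hη.mul_of_contDiffOn hU hφ
  have hηa := hηψ.mul_of_contDiffOn hU hac
  have I1 : Integrable fun z => fderiv ℝ φ z (h z) := by
    simp_rw [← inner_grd]
    exact hh.integrable_inner hU (contDiffOn_grd hU hφ).continuousOn
  have J1 := hηψ.integral_gdot hU hφ
  have J2 := hη.integral_gdot' hU (hφ.mul hψ)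
  have J3 := hηφ.integral_jac hU hv
  have J4 := hηa.integral_jac hU hb
  have i1 := hηψ.integrable_gdot hU hφ
  have i1' : Integrable fun z => (η z * ψ z) * (dx (dx φ) z + dy (dy φ) z) :=
    (hηψ.mul_of_contDiffOn hU ((contDiffOn_dx hU (contDiffOn_dx hU hφ)).add
      (contDiffOn_dy hU (contDiffOn_dy hU hφ)))).integrable
  have i2 := hη.integrable_gdot hU (hφ.mul hψ)
  have i2' : Integrable fun z => (dx (dx η) z + dy (dy η) z) * (φ z * ψ z) := by
    simp_rw [add_mul]
    exact (hη.dx.dx.mul_of_contDiffOn hU (hφ.mul hψ)).integrable.add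
      (hη.dy.dy.mul_of_contDiffOn hU (hφ.mul hψ)).integrable
  have i3 := hηφ.integrable_jac hU hv
  have i4 := hηa.integrable_jac hU hb
  have k1 : Integrable fun z => (a z - c) * jac (fun y => η y * ψ y) b z := by
    have := (hηψ.dx.mul_of_contDiffOn hU ((contDiffOn_dy hU hb).mul hac)).integrable.sub
      (hηψ.dy.mul_of_contDiffOn hU ((contDiffOn_dx hU hb).mul hac)).integrable
    refine this.congr (Eventually.of_forall fun z => ?_)
    simp only [Pi.sub_apply, jac]
    ring
  have k2 : Integrable fun z =>
      φ z * (ψ z * (dx (dx η) z + dy (dy η) z) + gdot η ψ z + jac η v z) := by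
    have := (i2'.add (((hη.dx.mul_of_contDiffOn hU ((contDiffOn_dx hU hψ).mul hφ)).integrable.add
      (hη.dy.mul_of_contDiffOn hU ((contDiffOn_dy hU hψ).mul hφ)).integrable))).add
      ((hη.dx.mul_of_contDiffOn hU ((contDiffOn_dy hU hv).mul hφ)).integrable.sub
      (hη.dy.mul_of_contDiffOn hU ((contDiffOn_dx hU hv).mul hφ)).integrable)
    refine this.congr (Eventually.of_forall fun z => ?_)
    simp only [Pi.sub_apply, Pi.add_apply, jac, gdot]
    ring
  have key : ∀ z, fderiv ℝ φ z (h z) - (a z - c) * jac (fun y => η y * ψ y) b z -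
      φ z * (ψ z * (dx (dx η) z + dy (dy η) z) + gdot η ψ z + jac η v z) =
      (gdot (fun y => η y * ψ y) φ z + (η z * ψ z) * (dx (dx φ) z + dy (dy φ) z)) -
      (gdot η (fun y => φ y * ψ y) z + (dx (dx η) z + dy (dy η) z) * (φ z * ψ z)) -
      jac (fun y => η y * φ y) v z - jac (fun y => η y * ψ y * (a y - c)) b z := by
    intro z
    by_cases hz : z ∈ ball (0 : ℂ) 1
    · have dη := differentiableAt_of_contDiffOn hU hη.smooth.contDiffOn hz
      have dψ := differentiableAt_of_contDiffOn hU hψ hz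
      have dφ := differentiableAt_of_contDiffOn hU hφ hz
      have da := differentiableAt_of_contDiffOn hU hac hz
      have eη : fderiv ℝ φ z (h z) = η z * fderiv ℝ φ z (h z) := by
        by_cases hs : z ∈ tsupport h
        · rw [hη1 z hs, one_mul]
        · rw [image_eq_zero_of_notMem_tsupport hs, map_zero, mul_zero]
      have xa : dx (fun y => a y - c) z = dx a z := by rw [dx, fderiv_sub_const]; rfl
      have ya : dy (fun y => a y - c) z = dy a z := by rw [dy, fderiv_sub_const]; rfl
      rw [eη, fderiv_eq_dx_dy, hlap z hz]
      simp only [jac, gdot]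
      have dηψ : DifferentiableAt ℝ (fun y => η y * ψ y) z := dη.mul dψ
      rw [dx_mul dηψ da, dy_mul dηψ da, dx_mul dη dψ, dy_mul dη dψ,
        dx_mul dη dφ, dy_mul dη dφ, dx_mul dφ dψ, dy_mul dφ dψ, xa, ya, (hd z hz).1, (hd z hz).2]
      ring
    · simp only [jac, gdot, hη.dx_eq_zero hz, hη.dy_eq_zero hz, hηψ.dx_eq_zero hz,
        hηψ.dy_eq_zero hz, hηφ.dx_eq_zero hz, hηφ.dy_eq_zero hz, hηa.dx_eq_zero hz,
        hηa.dy_eq_zero hz, hη.eq_zero hz, hh.eq_zero hz, map_zero]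
      ring
  have := integral_congr_ae (μ := volume) (Eventually.of_forall key)
  have s1 : Integrable fun z => fderiv ℝ φ z (h z) -
      (a z - c) * jac (fun y => η y * ψ y) b z := I1.sub k1
  have s2 : Integrable fun z => gdot (fun y => η y * ψ y) φ z +
      (η z * ψ z) * (dx (dx φ) z + dy (dy φ) z) := i1.add i1'
  have s3 : Integrable fun z => gdot η (fun y => φ y * ψ y) z +
      (dx (dx η) z + dy (dy η) z) * (φ z * ψ z) := i2.add i2'
  have s4 : Integrable fun z => (gdot (fun y => η y * ψ y) φ z +
      (η z * ψ z) * (dx (dx φ) z + dy (dy φ) z)) - (gdot η (fun y => φ y * ψ y) z +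
      (dx (dx η) z + dy (dy η) z) * (φ z * ψ z)) := s2.sub s3
  have s5 : Integrable fun z => (gdot (fun y => η y * ψ y) φ z +
      (η z * ψ z) * (dx (dx φ) z + dy (dy φ) z)) - (gdot η (fun y => φ y * ψ y) z +
      (dx (dx η) z + dy (dy η) z) * (φ z * ψ z)) - jac (fun y => η y * φ y) v z := s4.sub i3
  rw [integral_sub s1 k2, integral_sub I1 k1, integral_sub s5 i4, integral_sub s4 i3,
    integral_sub s2 s3, integral_add i1 i1', integral_add (f := fun z => gdot η (fun y => φ y * ψ y) z)
      i2 i2'] at this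
  have J2' : ∫ z, gdot η (fun y => φ y * ψ y) z =
      -∫ z, (dx (dx η) z + dy (dy η) z) * (φ z * ψ z) := J2
  linarith

theorem IsPotential.integral_fderiv_eq {h : ℂ → ℂ} {ψ a b φ : ℂ → ℝ} {c : ℝ}
    (hh : IsTest (ball 0 1) h) (hψ : IsPotential h ψ)
    (ha : ContDiffOn ℝ ∞ a (ball 0 1)) (hb : ContDiffOn ℝ ∞ b (ball 0 1))
    (hφ : ContDiffOn ℝ ∞ φ (ball 0 1)) (hφc : ContinuousOn φ (closedBall 0 1))
    (hφ0 : ∀ z, ‖z‖ = 1 → φ z = 0)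
    (hlap : ∀ z ∈ ball (0 : ℂ) 1, dx (dx φ) z + dy (dy φ) z = jac a b z)
    (hab : IntegrableOn (fun z => (a z - c) * ‖fderiv ℝ b z‖) (ball 0 1)) :
    ∫ z, fderiv ℝ φ z (h z) = ∫ z in ball (0 : ℂ) 1, (a z - c) * jac ψ b z := by
  obtain ⟨C, hC, η, hη⟩ := exists_cutoff
  obtain ⟨B, hB0, hB⟩ := hψ.exists_bound
  obtain ⟨R, hR, v, hψc, hv, hd⟩ := hψ.exists_stream
  have hsub : ball (0 : ℂ) 1 ⊆ ball 0 R := ball_subset_ball hR.le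
  obtain ⟨B', hB'⟩ := (isCompact_closedBall (0 : ℂ) 1).exists_bound_of_continuousOn
    ((hv.continuousOn_fderiv_of_isOpen isOpen_ball (by simp)).mono (closedBall_subset_ball hR))
  have hB'0 : 0 ≤ B' := (norm_nonneg _).trans (hB' 0 (by simp))
  set V : ℂ → ℂ := fun z => ⟨(a z - c) * dy b z, -((a z - c) * dx b z)⟩ with hV
  have hfV : ∀ f z, fderiv ℝ f z (V z) = (a z - c) * jac f b z := by
    intro f z
    rw [fderiv_eq_dx_dy, jac]
    simp only [hV]
    ring
  have hVi : IntegrableOn V (ball 0 1) := by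
    have hbc := (contDiffOn_grd isOpen_ball hb).continuousOn
    have hV2 : ∀ z, V z = ((a z - c : ℝ) : ℂ) * (-Complex.I * grd b z) := by
      intro z
      apply Complex.ext <;> simp [hV, grd]
    have hcont : ContinuousOn V (ball 0 1) := by
      refine ContinuousOn.congr ?_ fun z _ => hV2 z
      exact (Complex.continuous_ofReal.comp_continuousOn
        (ha.continuousOn.sub continuousOn_const)).mul (continuousOn_const.mul hbc)
    refine Integrable.mono hab (hcont.aestronglyMeasurable measurableSet_ball)
      (Eventually.of_forall fun z => ?_)
    rw [hV2, norm_mul, norm_mul, norm_neg, Complex.norm_I, one_mul, norm_grd, norm_mul,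
      Complex.norm_real, norm_norm]
  have t1 := hη.tendsto_integral_fderiv_mul hC hR hψc hψ.eq_zero hVi
  have t2 : Tendsto (fun n => ∫ z, φ z * (ψ z * (dx (dx (η n)) z + dy (dy (η n)) z) +
      gdot (η n) ψ z + jac (η n) v z)) atTop (𝓝 0) := by
    refine tendsto_integral_layer hφc hφ0 (K := 2 * B * C + C * B + C * B') (by positivity) ?_ ?_ ?_
    · intro n z hz
      rw [abs_mul]
      refine mul_le_mul_of_nonneg_left ?_ (abs_nonneg _)
      by_cases h3 : 2 < n * (1 - ‖z‖ ^ 2)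
      · have f0 := hη.fderiv_eq_zero h3
        have x0 : dx (η n) z = 0 := by rw [dx, f0]; rfl
        have y0 : dy (η n) z = 0 := by rw [dy, f0]; rfl
        rw [hη.laplacian_eq_zero h3, gdot, jac, x0, y0]
        simp only [mul_zero, zero_mul, add_zero, sub_zero, abs_zero]
        positivity
      · have q1 : |ψ z * (dx (dx (η n)) z + dy (dy (η n)) z)| ≤ 2 * B * C * n := by
          rw [abs_mul]
          calc _ ≤ (B * (1 - ‖z‖ ^ 2)) * (C * n ^ 2) :=
                mul_le_mul (hB z hz).2 (hη.abs_laplacian_le n z) (abs_nonneg _)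
                  ((abs_nonneg _).trans (hB z hz).2)
            _ = B * C * n * (n * (1 - ‖z‖ ^ 2)) := by ring
            _ ≤ B * C * n * 2 := by gcongr; exact not_lt.1 h3
            _ = _ := by ring
        have q2 : |gdot (η n) ψ z| ≤ (C * n) * B := (abs_gdot_le _ _ _).trans
          (mul_le_mul (hη.norm_fderiv_le n z) (hB z hz).1 (norm_nonneg _) (by positivity))
        have q3 : |jac (η n) v z| ≤ (C * n) * B' := (abs_jac_le _ _ _).trans
          (mul_le_mul (hη.norm_fderiv_le n z) (hB' z (ball_subset_closedBall hz)) (norm_nonneg _)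
            (by positivity))
        refine (abs_add_three _ _ _).trans ?_
        nlinarith
    · intro n z hz h3
      have f0 := hη.fderiv_eq_zero h3
      have x0 : dx (η n) z = 0 := by rw [dx, f0]; rfl
      have y0 : dy (η n) z = 0 := by rw [dy, f0]; rfl
      rw [hη.laplacian_eq_zero h3, gdot, jac, x0, y0]
      ring
    · intro n z hz
      have ht := hη.test n
      rw [gdot, jac, ht.dx_eq_zero hz, ht.dy_eq_zero hz, ht.dx.dx_eq_zero hz, ht.dy.dy_eq_zero hz]
      ring
  simp_rw [hfV] at t1
  have t3 := t1.add t2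
  rw [add_zero] at t3
  refine tendsto_nhds_unique (tendsto_const_nhds.congr' ?_) t3
  obtain ⟨r, hr0, hr1, hr⟩ := hh.exists_radius
  have hrb : (r : ℂ) ∈ ball (0 : ℂ) 1 := by
    rw [mem_ball_zero_iff, Complex.norm_real, Real.norm_of_nonneg hr0.le]; exact hr1
  filter_upwards [eventually_lt_mul_one_sub hrb] with n hn
  have hηψ := (hη.test n).mul_of_contDiffOn isOpen_ball hψ.contDiffOn
  rw [setIntegral_ball_eq, integral_fderiv_eq_cutoff hh hψ.contDiffOn (hv.mono hsub)
    (fun z hz => hd z (hsub hz)) ha hb hφ hlap (hη.test n) fun z hz => ?_]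
  · refine hη.eq_one n z (hn.le.trans ?_)
    rw [Complex.norm_real, Real.norm_of_nonneg hr0.le]
    gcongr
    exact hr z hz
  · intro z hz
    rw [jac, hηψ.dx_eq_zero hz, hηψ.dy_eq_zero hz]
    ring

theorem lintegral_ofReal_mul_le {α : Type*} [MeasurableSpace α] {μ : Measure α} {q s : ℝ}
    (hq : 0 < q) (hs : 0 < s) (hqs : 1 / q + 1 / s = 1) {w t : α → ℝ} (hw : AEMeasurable w μ)
    (ht : AEMeasurable t μ) (hw0 : ∀ x, 0 ≤ w x) (ht0 : ∀ x, 0 ≤ t x) :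
    ∫⁻ x, ENNReal.ofReal (w x * t x) ∂μ ≤ (∫⁻ x, ENNReal.ofReal (w x ^ q) ∂μ) ^ (1 / q) *
      (∫⁻ x, ENNReal.ofReal (t x ^ s) ∂μ) ^ (1 / s) := by
  refine le_trans (le_of_eq ?_) (ENNReal.lintegral_mul_norm_pow_le (p := 1 / q) (q := 1 / s)
    (hw.pow_const q).ennreal_ofReal (ht.pow_const s).ennreal_ofReal (by positivity)
    (by positivity) hqs)
  refine lintegral_congr fun x => ?_
  have hwx := hw0 x
  have htx := ht0 x
  rw [ENNReal.ofReal_rpow_of_nonneg (by positivity) (by positivity),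
    ENNReal.ofReal_rpow_of_nonneg (by positivity) (by positivity), ← Real.rpow_mul hwx,
    ← Real.rpow_mul htx, mul_one_div_cancel hq.ne', mul_one_div_cancel hs.ne', Real.rpow_one,
    Real.rpow_one, ENNReal.ofReal_mul hwx]

theorem lintegral_ofReal_mul_mul_le {α : Type*} [MeasurableSpace α] {μ : Measure α} {m s : ℝ}
    (hm : 0 < m) (hs : 0 < s) (hms : 2 / m + 1 / s = 1) {u w t : α → ℝ} (hu : AEMeasurable u μ)
    (hw : AEMeasurable w μ) (ht : AEMeasurable t μ) (hu0 : ∀ x, 0 ≤ u x) (hw0 : ∀ x, 0 ≤ w x)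
    (ht0 : ∀ x, 0 ≤ t x) :
    ∫⁻ x, ENNReal.ofReal (u x * w x * t x) ∂μ ≤ (∫⁻ x, ENNReal.ofReal (u x ^ m) ∂μ) ^ (1 / m) *
      (∫⁻ x, ENNReal.ofReal (w x ^ m) ∂μ) ^ (1 / m) *
      (∫⁻ x, ENNReal.ofReal (t x ^ s) ∂μ) ^ (1 / s) := by
  have hm2 : 0 < m / 2 := by positivity
  have e : 1 / (m / 2) + 1 / s = 1 := by rw [one_div_div, hms]
  refine (lintegral_ofReal_mul_le hm2 hs e (hu.mul hw) ht
    (fun x => mul_nonneg (hu0 x) (hw0 x)) ht0).trans ?_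
  refine mul_le_mul_left ?_ _
  have h2 := lintegral_ofReal_mul_le (μ := μ) (q := 2) (s := 2) two_pos two_pos (by norm_num)
    (hu.pow_const (m / 2)) (hw.pow_const (m / 2)) (fun x => by have := hu0 x; positivity)
    (fun x => by have := hw0 x; positivity)
  have e1 : ∀ x, (u x * w x) ^ (m / 2) = u x ^ (m / 2) * w x ^ (m / 2) := fun x =>
    Real.mul_rpow (hu0 x) (hw0 x)
  have e2 : ∀ y : ℝ, 0 ≤ y → (y ^ (m / 2)) ^ (2 : ℝ) = y ^ m := fun y hy => by
    rw [← Real.rpow_mul hy]; congr 1; ring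
  simp only [Pi.mul_apply, e1]
  simp only [e2 _ (hu0 _), e2 _ (hw0 _)] at h2
  refine (ENNReal.rpow_le_rpow h2 (by positivity)).trans_eq ?_
  rw [ENNReal.mul_rpow_of_nonneg _ _ (by positivity), ← ENNReal.rpow_mul, ← ENNReal.rpow_mul]
  have e3 : (1 : ℝ) / 2 * (1 / (m / 2)) = 1 / m := by field_simp
  rw [e3]

theorem const_mul_maxFn (k : ℝ≥0∞) (g : ℂ → ℝ≥0∞) (hg : Measurable g) (x : ℂ) :
    k * maxFn g x = maxFn (fun y => k * g y) x := by
  simp only [maxFn, ENNReal.mul_iSup]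
  congr 1; ext ρ
  congr 1; ext hρ
  rw [lintegral_const_mul _ hg]
  ring

theorem setLIntegral_ball_le_maxFn {g : ℂ → ℝ≥0∞} {x y : ℂ} {ρ R : ℝ} (hy : y ∈ ball x ρ)
    (hρR : ρ ≤ R) {S : Set ℂ} (hS : S ⊆ ball x R) :
    ∫⁻ z in S, g z ≤ ENNReal.ofReal (4 * R ^ 2) * maxFn g y := by
  have hρ : 0 < ρ := pos_of_mem_ball hy
  refine (lintegral_mono_set ?_).trans
    ((lintegral_ball_le_maxFn g y (ρ := 2 * R) (by linarith)).trans_eq ?_)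
  · refine hS.trans (ball_subset_ball' ?_)
    rw [dist_comm]
    linarith [mem_ball.1 hy]
  · congr 2; ring

/-- Far-field estimate: a kernel with cubic decay against a density of moderate growth. -/
theorem exists_far_field_bound : ∃ C > (0 : ℝ), ∀ (D : Set ℂ) (x₀ : ℂ) (ρ : ℝ) (v w : ℂ → ℝ)
    (Y : ℝ≥0∞), MeasurableSet D → 0 < ρ → (∀ z, 0 ≤ v z) →
    (∀ z ∈ D, 2 * ρ ≤ ‖z - x₀‖ → w z ≤ 128 * ρ ^ 3 / ‖z - x₀‖ ^ 3) →
    (∀ R, ρ ≤ R → ∫⁻ z in ball x₀ R ∩ D, ENNReal.ofReal (v z) ≤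
      ENNReal.ofReal ((R / ρ) ^ (5 / 2 : ℝ)) * Y) →
    ∫⁻ z in D \ ball x₀ (2 * ρ), ENNReal.ofReal (v z * w z) ≤ ENNReal.ofReal C * Y := by
  set τ : ℝ := 2 ^ (5 / 2 : ℝ) with hτ
  have hτ0 : 0 < τ := by positivity
  have hτ8 : τ < 8 := by
    have : τ < 2 ^ (3 : ℝ) := Real.rpow_lt_rpow_of_exponent_lt (by norm_num) (by norm_num)
    norm_num at this
    exact this
  have hr : τ / 8 < 1 := by linarith
  refine ⟨16 * τ ^ 2 * (1 - τ / 8)⁻¹, by have : 0 < 1 - τ / 8 := by linarith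
                                         positivity, ?_⟩
  intro D x₀ ρ v w Y hD hρ hv hdec hgr
  set A : ℕ → Set ℂ := fun k => (ball x₀ (2 ^ (k + 2) * ρ) ∩ D) \ ball x₀ (2 ^ (k + 1) * ρ) with hA
  have hcov : D \ ball x₀ (2 * ρ) ⊆ ⋃ k, A k := by
    rintro z ⟨hz, hz2⟩
    rw [mem_ball, dist_eq_norm, not_lt] at hz2
    obtain ⟨n, hn1, hn2⟩ := exists_nat_pow_near (x := ‖z - x₀‖ / (2 * ρ)) (y := 2)
      ((one_le_div (by positivity)).2 hz2) one_lt_two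
    rw [le_div_iff₀ (by positivity)] at hn1
    rw [div_lt_iff₀ (by positivity)] at hn2
    refine mem_iUnion.2 ⟨n, ⟨⟨?_, hz⟩, ?_⟩⟩
    · rw [mem_ball, dist_eq_norm]
      calc _ < _ := hn2
        _ = _ := by ring
    · rw [mem_ball, dist_eq_norm, not_lt]
      calc _ = (2 : ℝ) ^ n * (2 * ρ) := by ring
        _ ≤ _ := hn1
  have hAk : ∀ k, ∫⁻ z in A k, ENNReal.ofReal (v z * w z) ≤
      ENNReal.ofReal (16 * τ ^ 2 * (τ / 8) ^ k) * Y := by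
    intro k
    have hp : (0 : ℝ) < 2 ^ (k + 1) := by positivity
    calc ∫⁻ z in A k, ENNReal.ofReal (v z * w z)
        ≤ ∫⁻ z in A k, ENNReal.ofReal (128 / 8 ^ (k + 1)) * ENNReal.ofReal (v z) := by
          refine setLIntegral_mono' ((measurableSet_ball.inter hD).diff measurableSet_ball)
            fun z hz => ?_
          have hz2 : 2 ^ (k + 1) * ρ ≤ ‖z - x₀‖ := by
            have := hz.2
            rwa [mem_ball, dist_eq_norm, not_lt] at this
          have h1 : (2 : ℝ) ≤ 2 ^ (k + 1) := by
            rw [pow_succ]; linarith [one_le_pow₀ (n := k) (one_le_two (α := ℝ))]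
          rw [← ENNReal.ofReal_mul (by positivity), mul_comm (v z)]
          refine ENNReal.ofReal_le_ofReal (mul_le_mul_of_nonneg_right ?_ (hv z))
          refine (hdec z hz.1.2 (le_trans (by gcongr) hz2)).trans ?_
          have hz0 : 0 < ‖z - x₀‖ := lt_of_lt_of_le (by positivity) hz2
          rw [div_le_div_iff₀ (by positivity) (by positivity)]
          have := pow_le_pow_left₀ (by positivity) hz2 3
          calc 128 * ρ ^ 3 * 8 ^ (k + 1) = 128 * (2 ^ (k + 1) * ρ) ^ 3 := by
                rw [show (8 : ℝ) = 2 ^ 3 by norm_num, mul_pow, ← pow_mul, ← pow_mul, mul_comm 3]; ring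
            _ ≤ _ := by gcongr
      _ = ENNReal.ofReal (128 / 8 ^ (k + 1)) * ∫⁻ z in A k, ENNReal.ofReal (v z) :=
          lintegral_const_mul' _ _ ENNReal.ofReal_ne_top
      _ ≤ ENNReal.ofReal (128 / 8 ^ (k + 1)) * (ENNReal.ofReal (τ ^ (k + 2)) * Y) := by
          refine mul_le_mul_right ((lintegral_mono_set sdiff_subset).trans
            ((hgr _ (le_mul_of_one_le_left hρ.le (one_le_pow₀ one_le_two))).trans_eq ?_)) _
          rw [mul_div_cancel_right₀ _ hρ.ne', hτ, ← Real.rpow_natCast, ← Real.rpow_mul two_pos.le,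
            ← Real.rpow_mul_natCast two_pos.le, mul_comm (5 / 2 : ℝ)]
      _ = _ := by
          rw [← mul_assoc, ← ENNReal.ofReal_mul (by positivity)]
          congr 2
          rw [div_pow]
          field_simp
          ring
  refine (lintegral_mono_set hcov).trans ((lintegral_iUnion_le _ _).trans
    ((ENNReal.tsum_le_tsum hAk).trans_eq ?_))
  rw [ENNReal.tsum_mul_right, ← ENNReal.ofReal_tsum_of_nonneg (fun n => by positivity)
    ((summable_geometric_of_lt_one (by positivity) hr).mul_left _), tsum_mul_left,
    tsum_geometric_of_lt_one (by positivity) hr]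

/-- The oscillation of a field on `U`, controlled by testing, uniformly over a family of bounds. -/
theorem exists_lintegral_enorm_sub_le_forall {U : Set ℂ} (hU : IsOpen U) (hne : U.Nonempty)
    (hv : volume U ≠ ⊤) {F : ℂ → ℂ} (hF : ContDiffOn ℝ ∞ F U) {G : ℂ → ℝ≥0∞}
    (hM : ∀ h : ℂ → ℂ, IsTest U h → (∀ z, ‖h z‖ ≤ 1) → ∫ z, h z = 0 → ∀ y ∈ U,
      ENNReal.ofReal (∫ z, inner ℝ (F z) (h z)) ≤ G y) :
    ∃ c : ℂ, ∀ y ∈ U, ∫⁻ z in U, ‖F z - c‖ₑ ≤ 3 * G y := by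
  set M := ⨅ y ∈ U, G y with hMdef
  have hMle : ∀ y ∈ U, M ≤ G y := fun y hy => iInf₂_le y hy
  by_cases hMt : M = ⊤
  · refine ⟨0, fun y hy => ?_⟩
    have : G y = ⊤ := top_le_iff.1 (hMt ▸ hMle y hy)
    rw [this]
    simp
  · obtain ⟨c, hc⟩ := exists_lintegral_enorm_sub_le_of_test hU hne hv hF (M := M.toReal)
      fun h hh h1 h0 => by
        rw [← ENNReal.ofReal_le_iff_le_toReal hMt]
        exact le_iInf₂ (hM h hh h1 h0)
    refine ⟨c, fun y hy => hc.trans ?_⟩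
    rw [ENNReal.ofReal_mul (by norm_num), ENNReal.ofReal_toReal hMt]
    norm_num
    gcongr
    exact hMle y hy

theorem ofReal_setIntegral_le {S : Set ℂ} (hS : MeasurableSet S) {f g : ℂ → ℝ}
    (h : ∀ z ∈ S, |f z| ≤ g z) :
    ENNReal.ofReal (∫ z in S, f z) ≤ ∫⁻ z in S, ENNReal.ofReal (g z) := by
  refine (ENNReal.ofReal_le_ofReal (le_abs_self _)).trans ?_
  rw [← Real.norm_eq_abs, ofReal_norm]
  refine (enorm_integral_le_lintegral_enorm _).trans (setLIntegral_mono' hS fun z hz => ?_)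
  rw [← ofReal_norm]
  exact ENNReal.ofReal_le_ofReal (h z hz)

theorem ofReal_mul_rpow {A r : ℝ} (hA : 0 ≤ A) (hr : 0 ≤ r) (M : ℝ≥0∞) :
    (ENNReal.ofReal A * M) ^ r = ENNReal.ofReal (A ^ r) * M ^ r := by
  rw [ENNReal.mul_rpow_of_nonneg _ _ hr, ENNReal.ofReal_rpow_of_nonneg hA hr]

theorem maxFn_const_mul_rpow {f : ℂ → ℝ} (hf : Measurable f) (hf0 : ∀ z, 0 ≤ f z) {K s : ℝ}
    (hK : 0 ≤ K) (hs : 0 < s) (y : ℂ) :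
    maxFn (fun z => ENNReal.ofReal ((K * f z) ^ s)) y ^ (1 / s) =
      ENNReal.ofReal K * maxFn (fun z => ENNReal.ofReal (f z ^ s)) y ^ (1 / s) := by
  have e : ∀ z, ENNReal.ofReal ((K * f z) ^ s) = ENNReal.ofReal (K ^ s) * ENNReal.ofReal (f z ^ s) :=
    fun z => by rw [Real.mul_rpow hK (hf0 z), ENNReal.ofReal_mul (by positivity)]
  simp_rw [e]
  rw [← const_mul_maxFn _ _ (hf.pow_const s).ennreal_ofReal, ofReal_mul_rpow (by positivity)
    (by positivity), ← Real.rpow_mul hK, mul_one_div_cancel hs.ne', Real.rpow_one]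

theorem sqrt_pi_le_two : √π ≤ 2 := by
  rw [Real.sqrt_le_left two_pos.le]
  linarith [Real.pi_le_four]

theorem ofReal_sq_rpow_half {A : ℝ} (hA : 0 ≤ A) (M : ℝ≥0∞) :
    (ENNReal.ofReal (A ^ 2) * M) ^ (1 / 2 : ℝ) = ENNReal.ofReal A * M ^ (1 / 2 : ℝ) := by
  rw [ofReal_mul_rpow (by positivity) (by norm_num), ← Real.sqrt_eq_rpow, Real.sqrt_sq hA]

theorem ofReal_pi_sq_rpow_half_le {R : ℝ} (hR : 0 ≤ R) :
    ENNReal.ofReal (π * R ^ 2) ^ (1 / 2 : ℝ) ≤ ENNReal.ofReal (2 * R) := by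
  rw [ENNReal.ofReal_rpow_of_nonneg (by positivity) (by norm_num), ← Real.sqrt_eq_rpow,
    Real.sqrt_mul Real.pi_pos.le, Real.sqrt_sq hR]
  gcongr
  exact sqrt_pi_le_two

theorem setLIntegral_disc_le_near_add_far (f : ℂ → ℝ≥0∞) (x₀ : ℂ) (r : ℝ) :
    ∫⁻ z in ball (0 : ℂ) 1, f z ≤ (∫⁻ z in ball x₀ r ∩ ball 0 1, f z) +
      ∫⁻ z in ball 0 1 \ ball x₀ r, f z := by
  rw [inter_comm, lintegral_inter_add_sdiff _ _ measurableSet_ball]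

theorem IsPotential.aemeasurable_norm_fderiv {h : ℂ → ℂ} {ψ : ℂ → ℝ} (hψ : IsPotential h ψ) :
    AEMeasurable (fun z => ‖fderiv ℝ ψ z‖) (volume.restrict (ball 0 1)) :=
  ((hψ.contDiffOn.continuousOn_fderiv_of_isOpen isOpen_ball (by simp)).norm).aemeasurable
    measurableSet_ball

theorem lintegral_ofReal_norm_rpow_le_of_test {U : Set ℂ} {h : ℂ → ℂ} (hh : IsTest U h)
    (h1 : ∀ z, ‖h z‖ ≤ 1) {x₀ : ℂ} {ρ : ℝ} (hρ : 0 ≤ ρ) (hU : U ⊆ ball x₀ ρ) {m : ℝ} (hm : 0 < m) :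
    ∫⁻ z, ENNReal.ofReal (‖h z‖ ^ m) ≤ ENNReal.ofReal (π * ρ ^ 2) := by
  rw [← volume_ball_eq x₀ hρ, ← setLIntegral_one]
  rw [← lintegral_indicator measurableSet_ball]
  refine lintegral_mono fun z => ?_
  by_cases hz : z ∈ ball x₀ ρ
  · rw [indicator_of_mem hz, ← ENNReal.ofReal_one]
    exact ENNReal.ofReal_le_ofReal (Real.rpow_le_one (norm_nonneg _) (h1 z) hm.le)
  · rw [indicator_of_notMem hz, hh.eq_zero fun h => hz (hU h), norm_zero, Real.zero_rpow hm.ne',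
      ENNReal.ofReal_zero]

theorem integral_inner_grd_eq {U : Set ℂ} (hU : U ⊆ ball (0 : ℂ) 1) {h : ℂ → ℂ} (hh : IsTest U h)
    (χ : ℂ → ℝ) : ∫ z, inner ℝ (grd χ z) (h z) = ∫ z in ball (0 : ℂ) 1, fderiv ℝ χ z (h z) := by
  simp_rw [inner_grd]
  refine (setIntegral_ball_eq fun z hz => ?_).symm
  rw [hh.eq_zero fun h => hz (hU h), map_zero]

theorem IsPotential.energy_le' {h : ℂ → ℂ} {ψ : ℂ → ℝ} (hh : IsTest (ball 0 1) h)
    (hψ : IsPotential h ψ) :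
    ∫⁻ z in ball (0 : ℂ) 1, ENNReal.ofReal (‖fderiv ℝ ψ z‖ ^ (2 : ℝ)) ≤
      ∫⁻ z in ball (0 : ℂ) 1, ENNReal.ofReal (‖h z‖ ^ (2 : ℝ)) := by
  simp_rw [Real.rpow_two]
  exact hψ.energy_le hh

theorem exists_potential_pairing_le : ∃ K > (0 : ℝ), ∀ (g : ℂ → ℂ) (χ : ℂ → ℝ),
    IsTest (ball 0 1) g → IsPotential g χ → ∀ x₀ ∈ ball (0 : ℂ) 1, ∀ ρ > (0 : ℝ), ∀ h : ℂ → ℂ,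
    IsTest (ball x₀ ρ ∩ ball 0 1) h → (∀ z, ‖h z‖ ≤ 1) → ∫ z, h z = 0 →
    ∀ y ∈ ball x₀ ρ ∩ ball 0 1, ENNReal.ofReal (∫ z, inner ℝ (grd χ z) (h z)) ≤
      ENNReal.ofReal (K * ρ ^ 2) *
        maxFn (fun z => ENNReal.ofReal (‖g z‖ ^ (2 : ℝ))) y ^ (1 / 2 : ℝ) := by
  obtain ⟨C, hC, hfar⟩ := exists_far_field_bound
  refine ⟨8 + C * 4, by positivity, ?_⟩
  intro g χ hg hχ x₀ hx₀ ρ hρ h hh h1 h0 y hy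
  set M := maxFn (fun z => ENNReal.ofReal (‖g z‖ ^ (2 : ℝ))) y with hM
  have hhD : IsTest (ball 0 1) h := hh.mono inter_subset_right
  obtain ⟨ψ, hψ, hdec⟩ := exists_potential hhD
  have hdec := hdec h1 h0 x₀ hx₀ ρ hρ (hh.subset.trans inter_subset_left)
  have hgm : Measurable fun z => ‖g z‖ := hg.smooth.continuous.norm.measurable
  rw [integral_inner_grd_eq inter_subset_right hh, hψ.integral_fderiv_symm hhD hg hχ]
  have hb : ∀ z ∈ ball (0 : ℂ) 1, |fderiv ℝ ψ z (g z)| ≤ ‖g z‖ * ‖fderiv ℝ ψ z‖ := fun z _ => by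
    rw [mul_comm]; exact (fderiv ℝ ψ z).le_opNorm (g z)
  refine (ofReal_setIntegral_le measurableSet_ball hb).trans
    ((setLIntegral_disc_le_near_add_far _ x₀ (2 * ρ)).trans ?_)
  have hnear : ∫⁻ z in ball x₀ (2 * ρ) ∩ ball 0 1, ENNReal.ofReal (‖g z‖ * ‖fderiv ℝ ψ z‖) ≤
      ENNReal.ofReal (8 * ρ ^ 2) * M ^ (1 / 2 : ℝ) := by
    refine (lintegral_ofReal_mul_le two_pos two_pos (by norm_num) hgm.aemeasurable
      (hψ.aemeasurable_norm_fderiv.mono_measure (Measure.restrict_mono inter_subset_right le_rfl))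
      (fun _ => norm_nonneg _) fun _ => norm_nonneg _).trans ?_
    have n1 : ∫⁻ z in ball x₀ (2 * ρ) ∩ ball 0 1, ENNReal.ofReal (‖g z‖ ^ (2 : ℝ)) ≤
        ENNReal.ofReal ((4 * ρ) ^ 2) * M := by
      refine (setLIntegral_ball_le_maxFn hy.1 (by linarith) inter_subset_left).trans_eq ?_
      congr 2; ring
    have n2 : ∫⁻ z in ball x₀ (2 * ρ) ∩ ball 0 1, ENNReal.ofReal (‖fderiv ℝ ψ z‖ ^ (2 : ℝ)) ≤
        ENNReal.ofReal (π * ρ ^ 2) :=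
      (lintegral_mono_set inter_subset_right).trans ((hψ.energy_le' hhD).trans
        ((setLIntegral_le_lintegral _ _).trans
          (lintegral_ofReal_norm_rpow_le_of_test hh h1 hρ.le inter_subset_left two_pos)))
    refine (mul_le_mul' (ENNReal.rpow_le_rpow n1 (by norm_num))
      ((ENNReal.rpow_le_rpow n2 (by norm_num)).trans (ofReal_pi_sq_rpow_half_le hρ.le))).trans_eq ?_
    rw [ofReal_sq_rpow_half (by positivity), mul_right_comm, ← ENNReal.ofReal_mul (by positivity)]
    congr 2; ring
  have hgr : ∀ R, ρ ≤ R → ∫⁻ z in ball x₀ R ∩ ball 0 1, ENNReal.ofReal ‖g z‖ ≤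
      ENNReal.ofReal ((R / ρ) ^ (5 / 2 : ℝ)) * (ENNReal.ofReal (4 * ρ ^ 2) * M ^ (1 / 2 : ℝ)) := by
    intro R hR
    have hR0 : 0 < R := hρ.trans_le hR
    have := lintegral_ofReal_mul_le (μ := volume.restrict (ball x₀ R ∩ ball 0 1)) two_pos two_pos
      (by norm_num) hgm.aemeasurable (aemeasurable_const (b := (1 : ℝ)))
      (fun _ => norm_nonneg _) fun _ => zero_le_one
    simp only [mul_one, Real.one_rpow, ENNReal.ofReal_one, setLIntegral_one] at this
    refine this.trans ?_
    have n1 : ∫⁻ z in ball x₀ R ∩ ball 0 1, ENNReal.ofReal (‖g z‖ ^ (2 : ℝ)) ≤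
        ENNReal.ofReal ((2 * R) ^ 2) * M := by
      refine (setLIntegral_ball_le_maxFn hy.1 hR inter_subset_left).trans_eq ?_
      congr 2; ring
    have n2 : volume (ball x₀ R ∩ ball 0 1) ≤ ENNReal.ofReal (π * R ^ 2) :=
      (measure_mono inter_subset_left).trans_eq (volume_ball_eq x₀ hR0.le)
    refine (mul_le_mul' (ENNReal.rpow_le_rpow n1 (by norm_num))
      ((ENNReal.rpow_le_rpow n2 (by norm_num)).trans (ofReal_pi_sq_rpow_half_le hR0.le))).trans ?_
    rw [ofReal_sq_rpow_half (by positivity), mul_right_comm, ← ENNReal.ofReal_mul (by positivity),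
      ← mul_assoc (ENNReal.ofReal _) (ENNReal.ofReal _), ← ENNReal.ofReal_mul (by positivity)]
    refine mul_le_mul_left (ENNReal.ofReal_le_ofReal ?_) _
    have : (R / ρ) ^ 2 ≤ (R / ρ) ^ (5 / 2 : ℝ) := by
      rw [← Real.rpow_two]
      exact Real.rpow_le_rpow_of_exponent_le ((one_le_div hρ).2 hR) (by norm_num)
    calc 2 * R * (2 * R) = (R / ρ) ^ 2 * (4 * ρ ^ 2) := by field_simp; ring
      _ ≤ _ := by gcongr
  have hfar := hfar (ball 0 1) x₀ ρ (fun z => ‖g z‖) (fun z => ‖fderiv ℝ ψ z‖) _ measurableSet_ball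
    hρ (fun z => norm_nonneg _) hdec hgr
  refine (add_le_add hnear hfar).trans_eq ?_
  rw [← mul_assoc, ← ENNReal.ofReal_mul hC.le, ← add_mul, ← ENNReal.ofReal_add (by positivity)
    (by positivity)]
  congr 2; ring

theorem stronglyMeasurable_indicator_grd {φ : ℂ → ℝ} (hφ : ContDiffOn ℝ ∞ φ (ball 0 1)) :
    StronglyMeasurable ((ball (0 : ℂ) 1).indicator (grd φ)) :=
  (measurable_indicator_of_continuousOn isOpen_ball
    (contDiffOn_grd isOpen_ball hφ).continuousOn).stronglyMeasurable

/-- Calderón–Zygmund type `L^m` bound for the potential of a test field. -/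
theorem exists_potential_Lp_bound {m : ℝ} (hm : 2 < m) : ∃ C > (0 : ℝ), ∀ (g : ℂ → ℂ) (χ : ℂ → ℝ),
    IsTest (ball 0 1) g → IsPotential g χ →
    ∫⁻ z in ball (0 : ℂ) 1, ENNReal.ofReal (‖fderiv ℝ χ z‖ ^ m) ≤
      ENNReal.ofReal C * ∫⁻ z, ENNReal.ofReal (‖g z‖ ^ m) := by
  obtain ⟨K, hK, hpair⟩ := exists_potential_pairing_le
  obtain ⟨C, hC, hmain⟩ := exists_sharp_maximal_bound ℂ (κ := 1 / 16) (s := 2) (p₀ := m) (p₁ := m)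
    (by norm_num) (by norm_num) one_le_two hm
  set K' := 3 * K + 1 with hK'
  have hK'0 : 0 < K' := by positivity
  refine ⟨C * K' ^ m, by positivity, fun g χ hg hχ => ?_⟩
  have hgm : Measurable fun z => ‖g z‖ := hg.smooth.continuous.norm.measurable
  have hFc := contDiffOn_grd isOpen_ball hχ.contDiffOn
  have hFe : ∀ z ∈ ball (0 : ℂ) 1, (ball (0 : ℂ) 1).indicator (grd χ) z = grd χ z := fun z hz =>
    indicator_of_mem hz _
  have hscale := fun y => maxFn_const_mul_rpow hgm (fun z => norm_nonneg (g z)) hK'0.le two_pos y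
  have hInt : ∀ {q : ℝ}, 0 < q → ∀ {k : ℝ}, 0 ≤ k → ∫⁻ z, ENNReal.ofReal ((k * ‖g z‖) ^ q) =
      ENNReal.ofReal (k ^ q) * ∫⁻ z, ENNReal.ofReal (‖g z‖ ^ q) := by
    intro q hq k hk
    rw [← lintegral_const_mul' _ _ ENNReal.ofReal_ne_top]
    refine lintegral_congr fun z => ?_
    rw [Real.mul_rpow hk (norm_nonneg _), ENNReal.ofReal_mul (by positivity)]
  have hg2 : ∫⁻ z, ENNReal.ofReal (‖g z‖ ^ (2 : ℝ)) ≠ ⊤ := by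
    have : Integrable fun z => ‖g z‖ ^ (2 : ℝ) := by
      simp_rw [Real.rpow_two]
      refine Continuous.integrable_of_hasCompactSupport
        (hg.smooth.continuous.norm.pow 2) (hg.compact.mono fun z hz h0 => hz ?_)
      simp [h0]
    rw [← ofReal_integral_eq_lintegral_ofReal this
      (Eventually.of_forall fun z => by positivity)]
    exact ENNReal.ofReal_ne_top
  have hL1 : ∀ y ∈ ball (0 : ℂ) 1, ∫⁻ z in ball (0 : ℂ) 1, ‖grd χ z‖ₑ ≤
      ENNReal.ofReal 2 * (∫⁻ z in ball (0 : ℂ) 1, ENNReal.ofReal (‖g z‖ ^ (2 : ℝ))) ^ (1 / 2 : ℝ) := by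
    intro y hy
    have := lintegral_ofReal_mul_le (μ := volume.restrict (ball (0 : ℂ) 1)) two_pos two_pos
      (by norm_num) (aemeasurable_const (b := (1 : ℝ))) hχ.aemeasurable_norm_fderiv
      (fun _ => zero_le_one) (fun _ => norm_nonneg _)
    simp only [one_mul, Real.one_rpow, ENNReal.ofReal_one, setLIntegral_one] at this
    simp_rw [← ofReal_norm, norm_grd]
    refine this.trans (mul_le_mul' ?_ (ENNReal.rpow_le_rpow (hχ.energy_le' hg) (by norm_num)))
    rw [volume_ball_eq _ zero_le_one]
    exact (ofReal_pi_sq_rpow_half_le zero_le_one).trans_eq (by norm_num)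
  have hcongr : ∀ {S : Set ℂ} (c : ℂ), MeasurableSet S → S ⊆ ball 0 1 →
      ∫⁻ z in S, ‖(ball (0 : ℂ) 1).indicator (grd χ) z - c‖ₑ = ∫⁻ z in S, ‖grd χ z - c‖ₑ :=
    fun c hS hSD => setLIntegral_congr_fun hS fun z hz => by rw [hFe z (hSD hz)]
  have hF1 : ∫⁻ z in ball (0 : ℂ) 1, ‖(ball (0 : ℂ) 1).indicator (grd χ) z‖ₑ =
      ∫⁻ z in ball (0 : ℂ) 1, ‖grd χ z‖ₑ := by
    simpa using hcongr 0 measurableSet_ball Subset.rfl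
  have := hmain (ball 0 1) 2 isThick_unitDisc ((ball (0 : ℂ) 1).indicator (grd χ))
    (hFc.continuousOn.congr hFe) (stronglyMeasurable_indicator_grd hχ.contDiffOn) ?_
    (fun z => K' * ‖g z‖) (fun z => by positivity) (hgm.const_mul _) ?_ ?_ ?_ m ⟨le_rfl, le_rfl⟩
  · rw [hInt (by linarith) hK'0.le, ← mul_assoc, ← ENNReal.ofReal_mul hC.le] at this
    refine le_trans (le_of_eq (setLIntegral_congr_fun measurableSet_ball fun z hz => ?_)) this
    rw [hFe z hz, norm_grd]
  · rw [hF1]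
    refine ne_top_of_le_ne_top ?_ (hL1 0 (by simp))
    refine ENNReal.mul_ne_top ENNReal.ofReal_ne_top (ENNReal.rpow_ne_top_of_nonneg (by norm_num) ?_)
    exact ne_top_of_le_ne_top hg2 (setLIntegral_le_lintegral _ _)
  · rw [hInt two_pos hK'0.le]
    exact ENNReal.mul_ne_top ENNReal.ofReal_ne_top hg2
  · intro x hx ρ hρ hρ2
    obtain ⟨c, hc⟩ := exists_lintegral_enorm_sub_le_forall (isOpen_ball.inter isOpen_ball)
      ⟨x, mem_ball_self hρ, hx⟩ (ne_top_of_le_ne_top measure_ball_lt_top.ne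
        (measure_mono inter_subset_left)) (hFc.mono inter_subset_right)
      (hpair g χ hg hχ x hx ρ hρ)
    refine ⟨c, fun y hy => ?_⟩
    rw [hcongr c (measurableSet_ball.inter measurableSet_ball) inter_subset_right]
    refine (hc y hy).trans ?_
    rw [hscale, ← mul_assoc, ← mul_assoc, ← ENNReal.ofReal_mul (by positivity)]
    refine mul_le_mul_left ?_ _
    rw [show (3 : ℝ≥0∞) = ENNReal.ofReal 3 by norm_num, ← ENNReal.ofReal_mul (by norm_num)]
    exact ENNReal.ofReal_le_ofReal (by rw [hK']; nlinarith [sq_nonneg ρ])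
  · intro y hy
    rw [hF1, hscale, ← mul_assoc, ← ENNReal.ofReal_mul (by norm_num)]
    refine (hL1 y hy).trans ?_
    have : ∫⁻ z in ball (0 : ℂ) 1, ENNReal.ofReal (‖g z‖ ^ (2 : ℝ)) ≤
        ENNReal.ofReal (2 ^ 2) * maxFn (fun z => ENNReal.ofReal (‖g z‖ ^ (2 : ℝ))) y :=
      (lintegral_mono_set (isThick_unitDisc.subset_ball y hy)).trans
        (lintegral_ball_le_maxFn _ y two_pos)
    refine (mul_le_mul_right (ENNReal.rpow_le_rpow this (by norm_num)) _).trans ?_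
    rw [ofReal_sq_rpow_half two_pos.le, ← mul_assoc, ← ENNReal.ofReal_mul two_pos.le]
    refine mul_le_mul_left (ENNReal.ofReal_le_ofReal ?_) _
    rw [hK']; linarith

theorem abs_add_rpow_le {m : ℝ} (hm : 0 < m) (x y : ℝ) :
    |x + y| ^ m ≤ 2 ^ m * (|x| ^ m + |y| ^ m) := by
  have h1 : |x + y| ≤ 2 * max |x| |y| := (abs_add_le x y).trans (by
    linarith [le_max_left |x| |y|, le_max_right |x| |y|])
  calc |x + y| ^ m ≤ (2 * max |x| |y|) ^ m := Real.rpow_le_rpow (abs_nonneg _) h1 hm.le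
    _ = 2 ^ m * max |x| |y| ^ m := Real.mul_rpow two_pos.le (le_max_of_le_left (abs_nonneg _))
    _ ≤ _ := by
      gcongr
      have hx : 0 ≤ |x| ^ m := by positivity
      have hy : 0 ≤ |y| ^ m := by positivity
      rcases max_choice |x| |y| with h | h <;> rw [h] <;> linarith

theorem ball_inter_disc_subset {x₀ : ℂ} (hx₀ : x₀ ∈ ball (0 : ℂ) 1) (R : ℝ) :
    ball x₀ R ∩ ball 0 1 ⊆ ball x₀ (min R 2) ∩ ball 0 1 := fun z hz =>
  ⟨by rw [mem_ball, lt_min_iff]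
      exact ⟨hz.1, isThick_unitDisc.subset_ball x₀ hx₀ hz.2⟩, hz.2⟩

/-- Growth of the oscillation of a function with gradient in weak `L²` around its mean at a
fixed scale. -/
theorem exists_oscillation_growth {m : ℝ} (hm : 1 < m) : ∃ C > (0 : ℝ), ∀ N > (0 : ℝ), ∀ a : ℂ → ℝ,
    ContDiffOn ℝ 1 a (ball 0 1) →
    (∀ t > 0, volume {x ∈ ball (0 : ℂ) 1 | t < ‖fderiv ℝ a x‖} ≤ ENNReal.ofReal (N ^ 2 / t ^ 2)) →
    ∀ x₀ ∈ ball (0 : ℂ) 1, ∀ ρ, 0 < ρ → ρ ≤ 2 → ∃ c : ℝ, ∀ R, ρ ≤ R →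
      ∫⁻ x in ball x₀ R ∩ ball 0 1, ENNReal.ofReal (|a x - c| ^ m) ≤
        ENNReal.ofReal (C * N ^ m * (R ^ 4 / ρ ^ 2)) := by
  obtain ⟨C, hC, hJN⟩ := exists_john_nirenberg hm
  have hm0 : 0 < m := by linarith
  set B : ℝ := 2 ^ m with hB
  have hB0 : 0 < B := by positivity
  refine ⟨B * C * (1 + 128 * B), by positivity, fun N hN a ha hw x₀ hx₀ ρ hρ hρ2 => ?_⟩
  have hNm : 0 < N ^ m := by positivity
  obtain ⟨c, hc⟩ := hJN N hN a ha hw x₀ hx₀ ρ hρ hρ2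
  refine ⟨c, fun R' hR' => (lintegral_mono_set (ball_inter_disc_subset hx₀ R')).trans ?_⟩
  set R := min R' 2 with hRdef
  have hR : ρ ≤ R := le_min hR' hρ2
  have hR2 : R ≤ 2 := min_le_right _ _
  have hRR : R ≤ R' := min_le_left _ _
  have hR0 : 0 < R := hρ.trans_le hR
  obtain ⟨c', hc'⟩ := hJN N hN a ha hw x₀ hx₀ R hR0 hR2
  have hmeas : ∀ (k : ℝ) (S : Set ℂ), S ⊆ ball 0 1 →
      AEMeasurable (fun x => ENNReal.ofReal (|a x - k| ^ m)) (volume.restrict S) := by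
    intro k S hS
    have : AEMeasurable a (volume.restrict S) :=
      (ha.continuousOn.aemeasurable measurableSet_ball).mono_measure
        (Measure.restrict_mono hS le_rfl)
    exact (((this.sub_const k).norm).pow_const m).ennreal_ofReal
  have hpt : ∀ x k l : ℝ, ENNReal.ofReal (|x - k| ^ m) ≤ ENNReal.ofReal B *
      (ENNReal.ofReal (|x - l| ^ m) + ENNReal.ofReal (|l - k| ^ m)) := by
    intro x k l
    rw [← ENNReal.ofReal_add (by positivity) (by positivity), ← ENNReal.ofReal_mul hB0.le]
    refine ENNReal.ofReal_le_ofReal ?_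
    have := abs_add_rpow_le hm0 (x - l) (l - k)
    rwa [sub_add_sub_cancel] at this
  have hS : ball x₀ ρ ∩ ball 0 1 ⊆ ball x₀ R ∩ ball 0 1 :=
    inter_subset_inter_left _ (ball_subset_ball hR)
  have hcc : |c' - c| ^ m * (1 / 16 * ρ ^ 2) ≤ B * (2 * C * N ^ m * R ^ 2) := by
    have hnn : 0 ≤ B * (2 * C * N ^ m * R ^ 2) := by positivity
    rw [← ENNReal.ofReal_le_ofReal_iff hnn]
    calc ENNReal.ofReal (|c' - c| ^ m * (1 / 16 * ρ ^ 2))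
        = ENNReal.ofReal (|c' - c| ^ m) * ENNReal.ofReal (1 / 16 * ρ ^ 2) :=
          ENNReal.ofReal_mul (by positivity)
      _ ≤ ENNReal.ofReal (|c' - c| ^ m) * volume (ball x₀ ρ ∩ ball 0 1) :=
          mul_le_mul_right (isThick_unitDisc.le_volume x₀ hx₀ ρ hρ hρ2) _
      _ = ∫⁻ _ in ball x₀ ρ ∩ ball 0 1, ENNReal.ofReal (|c' - c| ^ m) :=
          (setLIntegral_const _ _).symm
      _ ≤ ∫⁻ x in ball x₀ ρ ∩ ball 0 1, ENNReal.ofReal B *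
          (ENNReal.ofReal (|a x - c'| ^ m) + ENNReal.ofReal (|a x - c| ^ m)) := by
          refine lintegral_mono fun x => (hpt c' c (a x)).trans_eq ?_
          rw [abs_sub_comm c' (a x)]
      _ = ENNReal.ofReal B * ((∫⁻ x in ball x₀ ρ ∩ ball 0 1, ENNReal.ofReal (|a x - c'| ^ m)) +
          ∫⁻ x in ball x₀ ρ ∩ ball 0 1, ENNReal.ofReal (|a x - c| ^ m)) := by
          rw [lintegral_const_mul' _ _ ENNReal.ofReal_ne_top,
            lintegral_add_left' (hmeas c' _ inter_subset_right)]
      _ ≤ ENNReal.ofReal B * (ENNReal.ofReal (C * N ^ m * R ^ 2) +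
          ENNReal.ofReal (C * N ^ m * ρ ^ 2)) := by
          gcongr
          exact (lintegral_mono_set hS).trans hc'
      _ ≤ _ := by
          rw [← ENNReal.ofReal_add (by positivity) (by positivity), ← ENNReal.ofReal_mul hB0.le]
          refine ENNReal.ofReal_le_ofReal (mul_le_mul_of_nonneg_left ?_ hB0.le)
          have : C * N ^ m * ρ ^ 2 ≤ C * N ^ m * R ^ 2 := by gcongr
          linarith
  have hρ2' : 0 < ρ ^ 2 := by positivity
  have hcc2 : |c' - c| ^ m ≤ 32 * B * C * N ^ m * R ^ 2 / ρ ^ 2 := by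
    rw [le_div_iff₀ hρ2']; linarith
  have hvol : volume (ball x₀ R ∩ ball 0 1) ≤ ENNReal.ofReal (4 * R ^ 2) := by
    refine (measure_mono inter_subset_left).trans ((volume_ball_eq x₀ hR0.le).le.trans ?_)
    gcongr
    exact Real.pi_le_four
  calc ∫⁻ x in ball x₀ R ∩ ball 0 1, ENNReal.ofReal (|a x - c| ^ m)
      ≤ ∫⁻ x in ball x₀ R ∩ ball 0 1, ENNReal.ofReal B *
          (ENNReal.ofReal (|a x - c'| ^ m) + ENNReal.ofReal (|c' - c| ^ m)) :=
        lintegral_mono fun x => hpt (a x) c c'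
    _ = ENNReal.ofReal B * ((∫⁻ x in ball x₀ R ∩ ball 0 1, ENNReal.ofReal (|a x - c'| ^ m)) +
          ENNReal.ofReal (|c' - c| ^ m) * volume (ball x₀ R ∩ ball 0 1)) := by
        rw [lintegral_const_mul' _ _ ENNReal.ofReal_ne_top,
          lintegral_add_right _ measurable_const, setLIntegral_const]
    _ ≤ ENNReal.ofReal B * (ENNReal.ofReal (C * N ^ m * R ^ 2) +
          ENNReal.ofReal (32 * B * C * N ^ m * R ^ 2 / ρ ^ 2) * ENNReal.ofReal (4 * R ^ 2)) := by
        gcongr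
    _ ≤ _ := by
        rw [← ENNReal.ofReal_mul (by positivity), ← ENNReal.ofReal_add (by positivity)
          (by positivity), ← ENNReal.ofReal_mul hB0.le]
        refine ENNReal.ofReal_le_ofReal ?_
        have h1 : R ^ 2 ≤ R ^ 4 / ρ ^ 2 := by
          rw [le_div_iff₀ hρ2']
          calc R ^ 2 * ρ ^ 2 ≤ R ^ 2 * R ^ 2 := by gcongr
            _ = R ^ 4 := by ring
        have h2 : R ^ 4 / ρ ^ 2 ≤ R' ^ 4 / ρ ^ 2 := by gcongr
        calc B * (C * N ^ m * R ^ 2 + 32 * B * C * N ^ m * R ^ 2 / ρ ^ 2 * (4 * R ^ 2))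
            = B * C * N ^ m * (R ^ 2 + 128 * B * (R ^ 4 / ρ ^ 2)) := by ring
          _ ≤ B * C * N ^ m * (R' ^ 4 / ρ ^ 2 + 128 * B * (R' ^ 4 / ρ ^ 2)) := by
              gcongr
              exact h1.trans h2
          _ = _ := by ring

theorem rpow_trilinear_eq {m s A B Z N k x : ℝ} (hm : 0 < m) (hms : 2 / m + 1 / s = 1)
    (hA : 0 ≤ A) (hB : 0 ≤ B) (hZ : 0 ≤ Z) (hN : 0 ≤ N) (hk : 0 ≤ k) (hx : 0 < x) :
    (A * N ^ m * (k * x)) ^ (1 / m) * (B * x) ^ (1 / m) * (Z * x) ^ (1 / s) =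
      A ^ (1 / m) * B ^ (1 / m) * Z ^ (1 / s) * N * (k ^ (1 / m) * x) := by
  rw [Real.mul_rpow (by positivity) (by positivity), Real.mul_rpow hA (by positivity),
    Real.mul_rpow hk hx.le, Real.mul_rpow hB hx.le, Real.mul_rpow hZ hx.le, ← Real.rpow_mul hN,
    mul_one_div_cancel hm.ne', Real.rpow_one]
  have : x ^ (1 / m) * x ^ (1 / m) * x ^ (1 / s) = x := by
    rw [← Real.rpow_add hx, ← Real.rpow_add hx]
    have : 1 / m + 1 / m + 1 / s = 1 := by
      have h2 : 2 / m = 1 / m + 1 / m := by ring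
      linarith
    rw [this, Real.rpow_one]
  linear_combination (A ^ (1 / m) * B ^ (1 / m) * Z ^ (1 / s) * N * k ^ (1 / m)) * this

theorem lintegral_trilinear_le {α : Type*} [MeasurableSpace α] {μ : Measure α} {m s : ℝ}
    (hm : 0 < m) (hs : 0 < s) (hms : 2 / m + 1 / s = 1) {u w t : α → ℝ} (hu : AEMeasurable u μ)
    (hw : AEMeasurable w μ) (ht : AEMeasurable t μ) (hu0 : ∀ x, 0 ≤ u x) (hw0 : ∀ x, 0 ≤ w x)
    (ht0 : ∀ x, 0 ≤ t x) {X Y Z : ℝ} (hX : 0 ≤ X) (hY : 0 ≤ Y) (hZ : 0 ≤ Z) {M : ℝ≥0∞}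
    (hXu : ∫⁻ x, ENNReal.ofReal (u x ^ m) ∂μ ≤ ENNReal.ofReal X)
    (hYw : ∫⁻ x, ENNReal.ofReal (w x ^ m) ∂μ ≤ ENNReal.ofReal Y)
    (hZt : ∫⁻ x, ENNReal.ofReal (t x ^ s) ∂μ ≤ ENNReal.ofReal Z * M) :
    ∫⁻ x, ENNReal.ofReal (u x * w x * t x) ∂μ ≤
      ENNReal.ofReal (X ^ (1 / m) * Y ^ (1 / m) * Z ^ (1 / s)) * M ^ (1 / s) := by
  refine (lintegral_ofReal_mul_mul_le hm hs hms hu hw ht hu0 hw0 ht0).trans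
    ((mul_le_mul' (mul_le_mul' (ENNReal.rpow_le_rpow hXu (by positivity))
      (ENNReal.rpow_le_rpow hYw (by positivity)))
      (ENNReal.rpow_le_rpow hZt (by positivity))).trans_eq ?_)
  rw [ofReal_mul_rpow hZ (by positivity), ENNReal.ofReal_rpow_of_nonneg hX (by positivity),
    ENNReal.ofReal_rpow_of_nonneg hY (by positivity), ← mul_assoc, ← ENNReal.ofReal_mul
    (by positivity), ← ENNReal.ofReal_mul (by positivity)]

/-- Data for the Dirichlet problem `Δφ = J(a, b)` on the unit disc with `∇a` of weak `L²`
size at most `N`. -/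
structure IsWenteData (N : ℝ) (a b φ : ℂ → ℝ) : Prop where
  pos : 0 < N
  smooth_left : ContDiffOn ℝ ∞ a (ball 0 1)
  smooth_right : ContDiffOn ℝ ∞ b (ball 0 1)
  smooth : ContDiffOn ℝ ∞ φ (ball 0 1)
  continuousOn : ContinuousOn φ (closedBall 0 1)
  eq_zero : ∀ z, ‖z‖ = 1 → φ z = 0
  laplacian_eq : ∀ z ∈ ball (0 : ℂ) 1, dx (dx φ) z + dy (dy φ) z = jac a b z
  volume_le : ∀ t > 0, volume {x ∈ ball (0 : ℂ) 1 | t < ‖fderiv ℝ a x‖} ≤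
    ENNReal.ofReal (N ^ 2 / t ^ 2)

/-- The norm of the gradient on the unit disc, extended by zero. -/
noncomputable def gradNorm (b : ℂ → ℝ) : ℂ → ℝ := (ball (0 : ℂ) 1).indicator fun z => ‖fderiv ℝ b z‖

theorem gradNorm_nonneg (b : ℂ → ℝ) (z : ℂ) : 0 ≤ gradNorm b z :=
  indicator_nonneg (fun _ _ => norm_nonneg _) z

theorem gradNorm_of_mem (b : ℂ → ℝ) {z : ℂ} (hz : z ∈ ball (0 : ℂ) 1) :
    gradNorm b z = ‖fderiv ℝ b z‖ := indicator_of_mem hz _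

theorem measurable_gradNorm {b : ℂ → ℝ} (hb : ContDiffOn ℝ ∞ b (ball 0 1)) :
    Measurable (gradNorm b) :=
  measurable_indicator_of_continuousOn isOpen_ball
    (hb.continuousOn_fderiv_of_isOpen isOpen_ball (by simp)).norm

theorem lintegral_gradNorm_rpow (b : ℂ → ℝ) {q : ℝ} (hq : 0 < q) :
    ∫⁻ z, ENNReal.ofReal (gradNorm b z ^ q) =
      ∫⁻ z in ball (0 : ℂ) 1, ENNReal.ofReal (‖fderiv ℝ b z‖ ^ q) := by
  rw [← lintegral_indicator measurableSet_ball]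
  refine lintegral_congr fun z => ?_
  by_cases hz : z ∈ ball (0 : ℂ) 1
  · rw [indicator_of_mem hz, gradNorm_of_mem b hz]
  · rw [indicator_of_notMem hz, gradNorm, indicator_of_notMem hz, Real.zero_rpow hq.ne',
      ENNReal.ofReal_zero]

/-- Pairing of the solution against test fields: at the scale of a small ball with mean-zero
fields, and on the whole disc. -/
theorem exists_wente_pairing {s m : ℝ} (hs : 0 < s) (hm : 4 ≤ m) (hms : 2 / m + 1 / s = 1) :
    ∃ K > (0 : ℝ), ∀ (N : ℝ) (a b φ : ℂ → ℝ), IsWenteData N a b φ →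
    ∫⁻ z, ENNReal.ofReal (gradNorm b z ^ s) ≠ ⊤ →
    (∀ x₀ ∈ ball (0 : ℂ) 1, ∀ ρ, 0 < ρ → ρ ≤ 2 → ∀ h : ℂ → ℂ, IsTest (ball x₀ ρ ∩ ball 0 1) h →
      (∀ z, ‖h z‖ ≤ 1) → ∫ z, h z = 0 → ∀ y ∈ ball x₀ ρ ∩ ball 0 1,
      ENNReal.ofReal (∫ z, inner ℝ (grd φ z) (h z)) ≤ ENNReal.ofReal (K * N * ρ ^ 2) *
        maxFn (fun z => ENNReal.ofReal (gradNorm b z ^ s)) y ^ (1 / s)) ∧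
    ∀ h : ℂ → ℂ, IsTest (ball 0 1) h → (∀ z, ‖h z‖ ≤ 1) →
      ENNReal.ofReal (∫ z, inner ℝ (grd φ z) (h z)) ≤ ENNReal.ofReal (K * N) *
        (∫⁻ z, ENNReal.ofReal (gradNorm b z ^ s)) ^ (1 / s) := by
  have hm0 : 0 < m := by linarith
  obtain ⟨Ca, hCa, hosc⟩ := exists_oscillation_growth (m := m) (by linarith)
  obtain ⟨Cp, hCp, hpot⟩ := exists_potential_Lp_bound (m := m) (by linarith)
  obtain ⟨Cf, hCf, hfar⟩ := exists_far_field_bound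
  set P := Cp * π with hP
  have hP0 : 0 < P := by positivity
  set K₁ := Ca ^ (1 / m) * P ^ (1 / m) * (16 : ℝ) ^ (1 / s) * (16 : ℝ) ^ (1 / m) with hK₁
  set K₂ := Ca ^ (1 / m) * π ^ (1 / m) * (4 : ℝ) ^ (1 / s) with hK₂
  set K₃ := Ca ^ (1 / m) * P ^ (1 / m) * (1 / 4 : ℝ) ^ (1 / s) * 4 with hK₃
  have hK₁0 : 0 < K₁ := by positivity
  have hK₂0 : 0 < K₂ := by positivity
  have hK₃0 : 0 < K₃ := by positivity
  refine ⟨K₁ + Cf * K₂ + K₃, by positivity, ?_⟩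
  intro N a b φ hD hbs
  have hN := hD.pos
  have ham : AEMeasurable a (volume.restrict (ball 0 1)) :=
    hD.smooth_left.continuousOn.aemeasurable measurableSet_ball
  have hum : ∀ (c : ℝ) {S : Set ℂ}, S ⊆ ball 0 1 →
      AEMeasurable (fun z => |a z - c|) (volume.restrict S) := fun c S hS =>
    ((ham.sub_const c).norm).mono_measure (Measure.restrict_mono hS le_rfl)
  have htm := measurable_gradNorm hD.smooth_right
  -- growth of `|a - c| |∇b|`
  have hgrow : ∀ (x₀ : ℂ) (ρ c R : ℝ) (M : ℝ≥0∞), 0 < ρ → ρ ≤ R →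
      ∫⁻ x in ball x₀ R ∩ ball 0 1, ENNReal.ofReal (|a x - c| ^ m) ≤
        ENNReal.ofReal (Ca * N ^ m * (R ^ 4 / ρ ^ 2)) →
      ∫⁻ z in ball x₀ R ∩ ball 0 1, ENNReal.ofReal (gradNorm b z ^ s) ≤
        ENNReal.ofReal (4 * R ^ 2) * M →
      ∫⁻ z in ball x₀ R ∩ ball 0 1, ENNReal.ofReal (|a z - c| * gradNorm b z) ≤
        ENNReal.ofReal ((R / ρ) ^ (5 / 2 : ℝ)) * (ENNReal.ofReal (K₂ * N * ρ ^ 2) * M ^ (1 / s)) := by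
    intro x₀ ρ c R M hρ hR h1 h2
    have hR0 : 0 < R := hρ.trans_le hR
    have hl : 1 ≤ R / ρ := (one_le_div hρ).2 hR
    have h3 : ∫⁻ x in ball x₀ R ∩ ball 0 1, ENNReal.ofReal ((1 : ℝ) ^ m) ≤
        ENNReal.ofReal (π * R ^ 2) := by
      rw [Real.one_rpow, ENNReal.ofReal_one, setLIntegral_one, ← volume_ball_eq x₀ hR0.le]
      exact measure_mono inter_subset_left
    have := lintegral_trilinear_le hm0 hs hms (hum c inter_subset_right)
      (aemeasurable_const (b := (1 : ℝ))) htm.aemeasurable (fun _ => abs_nonneg _)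
      (fun _ => zero_le_one) (gradNorm_nonneg b) (by positivity) (by positivity) (by positivity)
      h1 h3 h2
    simp only [mul_one] at this
    refine this.trans ?_
    have e : R ^ 4 / ρ ^ 2 = (R / ρ) ^ 2 * R ^ 2 := by field_simp
    rw [e, rpow_trilinear_eq hm0 hms hCa.le Real.pi_pos.le (by norm_num) hN.le (by positivity)
      (by positivity), ← hK₂, ← mul_assoc (ENNReal.ofReal _), ← ENNReal.ofReal_mul (by positivity)]
    refine mul_le_mul_left (ENNReal.ofReal_le_ofReal ?_) _
    have h4 : ((R / ρ) ^ 2) ^ (1 / m) * (R / ρ) ^ 2 ≤ (R / ρ) ^ (5 / 2 : ℝ) := by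
      rw [← Real.rpow_two, ← Real.rpow_mul (by positivity), ← Real.rpow_add (by positivity)]
      refine Real.rpow_le_rpow_of_exponent_le hl ?_
      have : 2 * (1 / m) ≤ 1 / 2 := by
        rw [mul_one_div, div_le_div_iff₀ hm0 two_pos]; linarith
      linarith
    calc K₂ * N * (((R / ρ) ^ 2) ^ (1 / m) * R ^ 2)
        = (((R / ρ) ^ 2) ^ (1 / m) * (R / ρ) ^ 2) * (K₂ * N * ρ ^ 2) := by
          field_simp
      _ ≤ _ := by gcongr
  -- the weak formulation
  have hweak : ∀ (x₀ : ℂ), x₀ ∈ ball (0 : ℂ) 1 → ∀ (ρ c : ℝ), 0 < ρ → ρ ≤ 2 →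
      (∀ R, ρ ≤ R → ∫⁻ x in ball x₀ R ∩ ball 0 1, ENNReal.ofReal (|a x - c| ^ m) ≤
        ENNReal.ofReal (Ca * N ^ m * (R ^ 4 / ρ ^ 2))) →
      ∀ h ψ, IsTest (ball 0 1) h → IsPotential h ψ →
      ENNReal.ofReal (∫ z, inner ℝ (grd φ z) (h z)) ≤ ∫⁻ z in ball (0 : ℂ) 1,
        ENNReal.ofReal (|a z - c| * ‖fderiv ℝ ψ z‖ * gradNorm b z) := by
    intro x₀ hx₀ ρ c hρ hρ2 hc h ψ hh hψ
    have hball : ball x₀ 2 ∩ ball (0 : ℂ) 1 = ball 0 1 :=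
      inter_eq_self_of_subset_right (isThick_unitDisc.subset_ball x₀ hx₀)
    have hab : IntegrableOn (fun z => (a z - c) * ‖fderiv ℝ b z‖) (ball 0 1) := by
      have hg := hgrow x₀ ρ c 2 (ENNReal.ofReal (1 / 16) * ∫⁻ z, ENNReal.ofReal (gradNorm b z ^ s))
        hρ hρ2 (hc 2 hρ2) (by
          rw [← mul_assoc, ← ENNReal.ofReal_mul (by norm_num)]
          norm_num
          exact setLIntegral_le_lintegral _ _)
      rw [hball] at hg
      refine ⟨((ham.sub_const c).mul ((hD.smooth_right.continuousOn_fderiv_of_isOpen isOpen_ball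
        (by simp)).norm.aemeasurable measurableSet_ball)).aestronglyMeasurable, ?_⟩
      refine lt_of_le_of_lt (le_of_eq (setLIntegral_congr_fun measurableSet_ball fun z hz => ?_))
        (lt_of_le_of_lt hg ?_)
      · rw [← ofReal_norm, norm_mul, norm_norm, gradNorm_of_mem b hz, Real.norm_eq_abs]
      · refine ENNReal.mul_lt_top ENNReal.ofReal_lt_top (ENNReal.mul_lt_top ENNReal.ofReal_lt_top
          (ENNReal.rpow_lt_top_of_nonneg (by positivity) ?_))
        exact ENNReal.mul_ne_top ENNReal.ofReal_ne_top hbs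
    simp_rw [inner_grd]
    rw [hψ.integral_fderiv_eq hh hD.smooth_left hD.smooth_right hD.smooth hD.continuousOn hD.eq_zero
      hD.laplacian_eq hab]
    refine ofReal_setIntegral_le measurableSet_ball fun z hz => ?_
    rw [abs_mul, mul_assoc, gradNorm_of_mem b hz]
    exact mul_le_mul_of_nonneg_left (abs_jac_le _ _ _) (abs_nonneg _)
  -- bound for the potential
  have hpsi : ∀ {U S : Set ℂ} {x₀ : ℂ} {ρ : ℝ} {h : ℂ → ℂ} {ψ : ℂ → ℝ}, 0 < ρ → S ⊆ ball 0 1 →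
      U ⊆ ball 0 1 → U ⊆ ball x₀ ρ → IsTest U h → (∀ z, ‖h z‖ ≤ 1) → IsPotential h ψ →
      ∫⁻ z in S, ENNReal.ofReal (‖fderiv ℝ ψ z‖ ^ m) ≤ ENNReal.ofReal (P * ρ ^ 2) := by
    intro U S x₀ ρ h ψ hρ hS hU hUx hh h1 hψ
    refine (lintegral_mono_set hS).trans ((hpot h ψ (hh.mono hU) hψ).trans ?_)
    refine (mul_le_mul_right (lintegral_ofReal_norm_rpow_le_of_test hh h1 hρ.le hUx hm0)
      _).trans_eq ?_
    rw [← ENNReal.ofReal_mul hCp.le, hP, mul_assoc]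
  refine ⟨?_, ?_⟩
  · intro x₀ hx₀ ρ hρ hρ2 h hh h1 h0 y hy
    set M := maxFn (fun z => ENNReal.ofReal (gradNorm b z ^ s)) y with hM
    obtain ⟨c, hc⟩ := hosc N hN a (hD.smooth_left.of_le (by simp)) hD.volume_le x₀ hx₀ ρ hρ hρ2
    have hhD : IsTest (ball 0 1) h := hh.mono inter_subset_right
    obtain ⟨ψ, hψ, hdec⟩ := exists_potential hhD
    have hdec := hdec h1 h0 x₀ hx₀ ρ hρ (hh.subset.trans inter_subset_left)
    refine (hweak x₀ hx₀ ρ c hρ hρ2 hc h ψ hhD hψ).trans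
      ((setLIntegral_disc_le_near_add_far _ x₀ (2 * ρ)).trans ?_)
    have hnear := lintegral_trilinear_le (M := M) hm0 hs hms (hum c inter_subset_right)
      (hψ.aemeasurable_norm_fderiv.mono_measure (Measure.restrict_mono inter_subset_right le_rfl))
      htm.aemeasurable (fun _ => abs_nonneg _) (fun _ => norm_nonneg _) (gradNorm_nonneg b)
      (by positivity) (by positivity) (by positivity) (hc (2 * ρ) (by linarith))
      (hpsi hρ inter_subset_right inter_subset_right inter_subset_left hh h1 hψ)
      (setLIntegral_ball_le_maxFn hy.1 (by linarith) inter_subset_left)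
    have e1 : (2 * ρ) ^ 4 / ρ ^ 2 = 16 * ρ ^ 2 := by field_simp; norm_num
    have e2 : 4 * (2 * ρ) ^ 2 = 16 * ρ ^ 2 := by ring
    rw [e1, e2, rpow_trilinear_eq hm0 hms hCa.le hP0.le (by norm_num) hN.le (by norm_num)
      (by positivity)] at hnear
    have hf := hfar (ball 0 1) x₀ ρ (fun z => |a z - c| * gradNorm b z) (fun z => ‖fderiv ℝ ψ z‖) _
      measurableSet_ball hρ (fun z => mul_nonneg (abs_nonneg _) (gradNorm_nonneg b z)) hdec
      fun R hR => hgrow x₀ ρ c R M hρ hR (hc R hR)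
        (setLIntegral_ball_le_maxFn hy.1 hR inter_subset_left)
    simp_rw [mul_right_comm _ (gradNorm b _)] at hf
    refine (add_le_add hnear hf).trans ?_
    rw [← mul_assoc (ENNReal.ofReal Cf), ← ENNReal.ofReal_mul hCf.le, ← add_mul, ← ENNReal.ofReal_add (by positivity)
      (by positivity)]
    refine mul_le_mul_left (ENNReal.ofReal_le_ofReal ?_) _
    have : 0 ≤ K₃ * N * ρ ^ 2 := by positivity
    rw [hK₁]
    linarith
  · intro h hh h1
    obtain ⟨c, hc⟩ := hosc N hN a (hD.smooth_left.of_le (by simp)) hD.volume_le 0 (by simp) 2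
      two_pos le_rfl
    obtain ⟨ψ, hψ, -⟩ := exists_potential hh
    refine (hweak 0 (by simp) 2 c two_pos le_rfl hc h ψ hh hψ).trans ?_
    have hball : ball (0 : ℂ) 2 ∩ ball (0 : ℂ) 1 = ball 0 1 :=
      inter_eq_self_of_subset_right (ball_subset_ball one_le_two)
    have hc2 := hc 2 le_rfl
    rw [hball] at hc2
    have hnear := lintegral_trilinear_le (M := ∫⁻ z, ENNReal.ofReal (gradNorm b z ^ s)) (Z := 1)
      hm0 hs hms (hum c Subset.rfl) hψ.aemeasurable_norm_fderiv
      htm.aemeasurable (fun _ => abs_nonneg _) (fun _ => norm_nonneg _) (gradNorm_nonneg b)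
      (by positivity) (by positivity) (by positivity) hc2
      (hpsi two_pos Subset.rfl Subset.rfl (ball_subset_ball one_le_two) hh h1 hψ)
      (by rw [ENNReal.ofReal_one, one_mul]; exact setLIntegral_le_lintegral _ _)
    refine hnear.trans (mul_le_mul_left (ENNReal.ofReal_le_ofReal ?_) _)
    have e := rpow_trilinear_eq (Z := 1 / 4) (k := 1) (x := 4) hm0 hms hCa.le hP0.le (by norm_num)
      hN.le zero_le_one (by norm_num)
    have e1 : (2 : ℝ) ^ 4 / 2 ^ 2 = 1 * 4 := by norm_num
    have e2 : (1 : ℝ) / 4 * 4 = 1 := by norm_num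
    rw [e2, Real.one_rpow, Real.one_rpow] at e
    rw [e1, Real.one_rpow, show (2 : ℝ) ^ 2 = 4 by norm_num, e]
    have h5 : 0 ≤ (K₁ + Cf * K₂) * N := by positivity
    rw [hK₃]
    linarith

theorem lintegral_gradNorm_rpow_ne_top {b : ℂ → ℝ} {s p : ℝ} (hs : 0 < s) (hsp : s ≤ p)
    (hb : ∫⁻ z in ball (0 : ℂ) 1, ENNReal.ofReal (‖fderiv ℝ b z‖ ^ p) ≠ ⊤) :
    ∫⁻ z, ENNReal.ofReal (gradNorm b z ^ s) ≠ ⊤ := by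
  rw [lintegral_gradNorm_rpow b hs]
  have h : ∀ z, ENNReal.ofReal (‖fderiv ℝ b z‖ ^ s) ≤ 1 + ENNReal.ofReal (‖fderiv ℝ b z‖ ^ p) := by
    intro z
    rw [← ENNReal.ofReal_one, ← ENNReal.ofReal_add zero_le_one (by positivity)]
    refine ENNReal.ofReal_le_ofReal ?_
    rcases le_total ‖fderiv ℝ b z‖ 1 with h1 | h1
    · have := Real.rpow_le_one (norm_nonneg _) h1 hs.le
      have := Real.rpow_nonneg (norm_nonneg (fderiv ℝ b z)) p
      linarith
    · have := Real.rpow_le_rpow_of_exponent_le h1 hsp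
      linarith
  refine ne_top_of_le_ne_top ?_ (lintegral_mono h)
  rw [lintegral_add_left measurable_const, setLIntegral_one]
  exact ENNReal.add_ne_top.2 ⟨measure_ball_lt_top.ne, hb⟩

/-- The Wente estimate on the unit disc. -/
theorem exists_unitDisc_bound {p₀ : ℝ} (p₁ : ℝ) (hp₀ : 1 < p₀) :
    ∃ C > (0 : ℝ), ∀ p ∈ Icc p₀ p₁, ∀ (N : ℝ) (a b φ : ℂ → ℝ), IsWenteData N a b φ →
    ∫⁻ z in ball (0 : ℂ) 1, ENNReal.ofReal (‖fderiv ℝ b z‖ ^ p) ≠ ⊤ →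
    ∫⁻ z in ball (0 : ℂ) 1, ENNReal.ofReal (‖fderiv ℝ φ z‖ ^ p) ≤
      ENNReal.ofReal ((C * N) ^ p) *
        ∫⁻ z in ball (0 : ℂ) 1, ENNReal.ofReal (‖fderiv ℝ b z‖ ^ p) := by
  set s := min (4 / 3) ((1 + p₀) / 2) with hs
  have hs1 : 1 < s := lt_min (by norm_num) (by linarith)
  have hs0 : 0 < s := by linarith
  have hsp : s < p₀ := (min_le_right _ _).trans_lt (by linarith)
  have hs43 : s ≤ 4 / 3 := min_le_left _ _
  have hs1' : 0 < s - 1 := by linarith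
  obtain ⟨K, hK, hpair⟩ := exists_wente_pairing (s := s) (m := 2 * s / (s - 1)) hs0
    (by rw [le_div_iff₀ hs1']; linarith) (by field_simp; ring)
  obtain ⟨C, hC, hmain⟩ := exists_sharp_maximal_bound ℂ (κ := 1 / 16) (s := s) (p₀ := p₀)
    (p₁ := p₁) (by norm_num) (by norm_num) hs1.le hsp
  refine ⟨max 1 C * (4 * K), by positivity, fun p hp N a b φ hD hb => ?_⟩
  have hp1 : 1 ≤ p := hp₀.le.trans hp.1
  have hN := hD.pos
  have hbs := lintegral_gradNorm_rpow_ne_top hs0 (hsp.le.trans hp.1) hb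
  obtain ⟨hosc, hglob⟩ := hpair N a b φ hD hbs
  set k := 4 * K * N with hk
  have hk0 : 0 < k := by positivity
  have hgm := measurable_gradNorm hD.smooth_right
  have hFc := contDiffOn_grd isOpen_ball hD.smooth
  have hFe : ∀ z ∈ ball (0 : ℂ) 1, (ball (0 : ℂ) 1).indicator (grd φ) z = grd φ z := fun z hz =>
    indicator_of_mem hz _
  have hscale := fun y => maxFn_const_mul_rpow hgm (gradNorm_nonneg b) hk0.le hs0 y
  have hInt : ∀ {q : ℝ}, ∫⁻ z, ENNReal.ofReal ((k * gradNorm b z) ^ q) =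
      ENNReal.ofReal (k ^ q) * ∫⁻ z, ENNReal.ofReal (gradNorm b z ^ q) := by
    intro q
    rw [← lintegral_const_mul' _ _ ENNReal.ofReal_ne_top]
    refine lintegral_congr fun z => ?_
    rw [Real.mul_rpow hk0.le (gradNorm_nonneg b z), ENNReal.ofReal_mul (by positivity)]
  set I := (∫⁻ z, ENNReal.ofReal (gradNorm b z ^ s)) ^ (1 / s) with hI
  have hItop : ENNReal.ofReal (K * N) * I ≠ ⊤ :=
    ENNReal.mul_ne_top ENNReal.ofReal_ne_top (ENNReal.rpow_ne_top_of_nonneg (by positivity) hbs)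
  have hL1 : ∫⁻ z in ball (0 : ℂ) 1, ‖grd φ z‖ₑ ≤ ENNReal.ofReal (K * N) * I := by
    rw [← ENNReal.ofReal_toReal hItop]
    refine lintegral_enorm_le_of_test isOpen_ball hFc fun h hh h1 => ?_
    exact (ENNReal.ofReal_le_iff_le_toReal hItop).1 (hglob h hh h1)
  have hcongr : ∀ {S : Set ℂ} (c : ℂ), MeasurableSet S → S ⊆ ball 0 1 →
      ∫⁻ z in S, ‖(ball (0 : ℂ) 1).indicator (grd φ) z - c‖ₑ = ∫⁻ z in S, ‖grd φ z - c‖ₑ :=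
    fun c hS hSD => setLIntegral_congr_fun hS fun z hz => by rw [hFe z (hSD hz)]
  have hF1 : ∫⁻ z in ball (0 : ℂ) 1, ‖(ball (0 : ℂ) 1).indicator (grd φ) z‖ₑ =
      ∫⁻ z in ball (0 : ℂ) 1, ‖grd φ z‖ₑ := by
    simpa using hcongr 0 measurableSet_ball Subset.rfl
  have := hmain (ball 0 1) 2 isThick_unitDisc ((ball (0 : ℂ) 1).indicator (grd φ))
    (hFc.continuousOn.congr hFe) (stronglyMeasurable_indicator_grd hD.smooth) ?_
    (fun z => k * gradNorm b z) (fun z => mul_nonneg hk0.le (gradNorm_nonneg b z))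
    (hgm.const_mul _) ?_ ?_ ?_ p hp
  · rw [hInt, lintegral_gradNorm_rpow b (by linarith), ← mul_assoc,
      ← ENNReal.ofReal_mul hC.le] at this
    refine (le_of_eq (setLIntegral_congr_fun measurableSet_ball fun z hz => ?_)).trans
      (this.trans (mul_le_mul_left (ENNReal.ofReal_le_ofReal ?_) _))
    · simp only [hFe z hz, norm_grd]
    · rw [mul_assoc (max 1 C), ← hk, Real.mul_rpow (by positivity) hk0.le]
      gcongr
      exact (le_max_right 1 C).trans (Real.self_le_rpow_of_one_le (le_max_left _ _) hp1)
  · rw [hF1]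
    exact ne_top_of_le_ne_top hItop hL1
  · rw [hInt]
    exact ENNReal.mul_ne_top ENNReal.ofReal_ne_top hbs
  · intro x hx ρ hρ hρ2
    obtain ⟨c, hc⟩ := exists_lintegral_enorm_sub_le_forall (isOpen_ball.inter isOpen_ball)
      ⟨x, mem_ball_self hρ, hx⟩ (ne_top_of_le_ne_top measure_ball_lt_top.ne
        (measure_mono inter_subset_left)) (hFc.mono inter_subset_right)
      (hosc x hx ρ hρ hρ2)
    refine ⟨c, fun y hy => ?_⟩
    rw [hcongr c (measurableSet_ball.inter measurableSet_ball) inter_subset_right]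
    refine (hc y hy).trans ?_
    rw [hscale, ← mul_assoc, ← mul_assoc, ← ENNReal.ofReal_mul (by positivity)]
    refine mul_le_mul_left ?_ _
    rw [show (3 : ℝ≥0∞) = ENNReal.ofReal 3 by norm_num, ← ENNReal.ofReal_mul (by norm_num)]
    refine ENNReal.ofReal_le_ofReal ?_
    have : 0 ≤ K * N * ρ ^ 2 := by positivity
    rw [hk]; linarith
  · intro y hy
    rw [hF1, hscale, ← mul_assoc, ← ENNReal.ofReal_mul (by norm_num)]
    refine hL1.trans ?_
    have hle : ∫⁻ z, ENNReal.ofReal (gradNorm b z ^ s) ≤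
        ENNReal.ofReal (2 ^ 2) * maxFn (fun z => ENNReal.ofReal (gradNorm b z ^ s)) y := by
      refine le_trans ?_ (lintegral_ball_le_maxFn _ y two_pos)
      rw [lintegral_gradNorm_rpow b hs0]
      refine (le_of_eq (setLIntegral_congr_fun measurableSet_ball fun z hz => ?_)).trans
        (lintegral_mono_set (isThick_unitDisc.subset_ball y hy))
      simp only [gradNorm_of_mem b hz]
    refine (mul_le_mul_right (ENNReal.rpow_le_rpow hle (by positivity)) _).trans ?_
    rw [ENNReal.mul_rpow_of_nonneg _ _ (by positivity), ENNReal.ofReal_rpow_of_nonneg (by norm_num)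
      (by positivity), ← mul_assoc, ← ENNReal.ofReal_mul (by positivity)]
    refine mul_le_mul_left (ENNReal.ofReal_le_ofReal ?_) _
    have h4 : ((2 : ℝ) ^ 2) ^ (1 / s) ≤ (2 ^ 2) ^ (1 : ℝ) :=
      Real.rpow_le_rpow_of_exponent_le (by norm_num) ((div_le_one hs0).2 hs1.le)
    rw [Real.rpow_one] at h4
    have h0 : 0 < K * N := by positivity
    rw [hk]; nlinarith

/-- The similarity `z ↦ c + r z` from the complex plane onto `ℝ²`. -/
noncomputable def discMap (c : E2) (r : ℝ) (hr : r ≠ 0) : ℂ ≃ₜ E2 :=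
  Complex.orthonormalBasisOneI.repr.toHomeomorph.trans
    ((Homeomorph.smulOfNeZero r hr).trans (Homeomorph.addLeft c))

theorem discMap_apply (c : E2) {r : ℝ} (hr : r ≠ 0) (z : ℂ) :
    discMap c r hr z = c + r • Complex.orthonormalBasisOneI.repr z := rfl

theorem map_discMap_volume (c : E2) {r : ℝ} (hr : r ≠ 0) :
    (volume : Measure ℂ).map (discMap c r hr) = ENNReal.ofReal (r ^ 2)⁻¹ • volume := by
  have h1 : (volume : Measure ℂ).map (discMap c r hr) =
      (((volume : Measure ℂ).map Complex.orthonormalBasisOneI.repr).map (r • ·)).map (c + ·) := by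
    rw [Measure.map_map (by fun_prop) (by fun_prop), Measure.map_map (by fun_prop) (by fun_prop)]
    rfl
  rw [h1, Complex.orthonormalBasisOneI.repr.measurePreserving.map_eq,
    Measure.map_addHaar_smul _ hr, Measure.map_smul, map_add_left_eq_self]
  simp

theorem dist_discMap (c : E2) {r : ℝ} (hr : 0 < r) (z : ℂ) :
    dist (discMap c r hr.ne' z) c = r * ‖z‖ := by
  rw [discMap_apply, dist_eq_norm, add_sub_cancel_left, norm_smul, Real.norm_of_nonneg hr.le,
    LinearIsometryEquiv.norm_map]

theorem discMap_mem_ball (c : E2) {r : ℝ} (hr : 0 < r) {z : ℂ} :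
    discMap c r hr.ne' z ∈ ball c r ↔ z ∈ ball (0 : ℂ) 1 := by
  rw [mem_ball, dist_discMap c hr, mem_ball_zero_iff, mul_lt_iff_lt_one_right hr]

theorem discMap_mem_closedBall (c : E2) {r : ℝ} (hr : 0 < r) {z : ℂ} :
    discMap c r hr.ne' z ∈ closedBall c r ↔ z ∈ closedBall (0 : ℂ) 1 := by
  rw [mem_closedBall, dist_discMap c hr, mem_closedBall_zero_iff, mul_le_iff_le_one_right hr]

theorem setLIntegral_discMap (c : E2) {r : ℝ} (hr : 0 < r) (f : E2 → ℝ≥0∞) :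
    ∫⁻ z in ball (0 : ℂ) 1, f (discMap c r hr.ne' z) =
      ENNReal.ofReal (r ^ 2)⁻¹ * ∫⁻ x in ball c r, f x := by
  have hpre : ball (0 : ℂ) 1 = discMap c r hr.ne' ⁻¹' ball c r := by
    ext z; exact (discMap_mem_ball c hr).symm
  have hL := (discMap c r hr.ne').measurableEmbedding
  rw [hpre, ← hL.lintegral_map, ← hL.restrict_map, map_discMap_volume, Measure.restrict_smul,
    lintegral_smul_measure, smul_eq_mul]

theorem hasFDerivAt_discMap (c : E2) {r : ℝ} (hr : r ≠ 0) (z : ℂ) :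
    HasFDerivAt (discMap c r hr)
      (r • (Complex.orthonormalBasisOneI.repr : ℂ ≃L[ℝ] E2).toContinuousLinearMap) z :=
  ((((Complex.orthonormalBasisOneI.repr : ℂ ≃L[ℝ] E2).hasFDerivAt (x := z)).const_smul r).const_add
    c)

theorem contDiff_discMap (c : E2) {r : ℝ} (hr : r ≠ 0) : ContDiff ℝ ∞ (discMap c r hr) :=
  contDiff_const.add (Complex.orthonormalBasisOneI.repr.contDiff.const_smul r)

theorem fderiv_comp_discMap (c : E2) {r : ℝ} (hr : r ≠ 0) {f : E2 → ℝ} {z : ℂ}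
    (hf : DifferentiableAt ℝ f (discMap c r hr z)) (w : ℂ) :
    fderiv ℝ (f ∘ discMap c r hr) z w =
      r * fderiv ℝ f (discMap c r hr z) (Complex.orthonormalBasisOneI.repr w) := by
  rw [(hf.hasFDerivAt.comp z (hasFDerivAt_discMap c hr z)).fderiv]
  simp

theorem norm_fderiv_comp_discMap (c : E2) {r : ℝ} (hr : 0 < r) {f : E2 → ℝ} {z : ℂ}
    (hf : DifferentiableAt ℝ f (discMap c r hr.ne' z)) :
    ‖fderiv ℝ (f ∘ discMap c r hr.ne') z‖ = r * ‖fderiv ℝ f (discMap c r hr.ne' z)‖ := by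
  have h : fderiv ℝ (f ∘ discMap c r hr.ne') z = r • (fderiv ℝ f (discMap c r hr.ne' z)).comp
      (Complex.orthonormalBasisOneI.repr : ℂ ≃L[ℝ] E2).toContinuousLinearMap := by
    ext w
    rw [fderiv_comp_discMap c hr.ne' hf]
    simp
  rw [h, norm_smul, Real.norm_of_nonneg hr.le]
  congr 1
  exact ContinuousLinearMap.opNorm_comp_linearIsometryEquiv _ _

theorem repr_one : Complex.orthonormalBasisOneI.repr 1 = EuclideanSpace.single (0 : Fin 2) (1 : ℝ) := by
  ext i; fin_cases i <;> simp

theorem repr_I :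
    Complex.orthonormalBasisOneI.repr Complex.I = EuclideanSpace.single (1 : Fin 2) (1 : ℝ) := by
  ext i; fin_cases i <;> simp

theorem dx_comp_discMap (c : E2) {r : ℝ} (hr : r ≠ 0) {f : E2 → ℝ} {z : ℂ}
    (hf : DifferentiableAt ℝ f (discMap c r hr z)) :
    dx (f ∘ discMap c r hr) z = r * pd 0 f (discMap c r hr z) := by
  rw [dx, fderiv_comp_discMap c hr hf, repr_one, pd]

theorem dy_comp_discMap (c : E2) {r : ℝ} (hr : r ≠ 0) {f : E2 → ℝ} {z : ℂ}
    (hf : DifferentiableAt ℝ f (discMap c r hr z)) :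
    dy (f ∘ discMap c r hr) z = r * pd 1 f (discMap c r hr z) := by
  rw [dy, fderiv_comp_discMap c hr hf, repr_I, pd]

theorem laplacian_comp_discMap (c : E2) {r : ℝ} (hr : 0 < r) {f : E2 → ℝ}
    (hf : ContDiffOn ℝ ∞ f (ball c r)) {z : ℂ} (hz : z ∈ ball (0 : ℂ) 1) :
    dx (dx (f ∘ discMap c r hr.ne')) z + dy (dy (f ∘ discMap c r hr.ne')) z =
      r ^ 2 * lap f (discMap c r hr.ne' z) := by
  have hd : ∀ w ∈ ball (0 : ℂ) 1, DifferentiableAt ℝ f (discMap c r hr.ne' w) := fun w hw =>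
    (hf.differentiableOn (by simp)).differentiableAt
      (isOpen_ball.mem_nhds ((discMap_mem_ball c hr).2 hw))
  have hpd : ∀ i, DifferentiableAt ℝ (pd i f) (discMap c r hr.ne' z) := fun i =>
    ((((hf.fderiv_of_isOpen isOpen_ball (m := ∞) (by simp)).differentiableOn
      (by simp)).differentiableAt (isOpen_ball.mem_nhds ((discMap_mem_ball c hr).2 hz))).clm_apply
        (differentiableAt_const _))
  have hnear := isOpen_ball.mem_nhds hz
  have hx : dx (f ∘ discMap c r hr.ne') =ᶠ[𝓝 z] fun w => r * (pd 0 f ∘ discMap c r hr.ne') w := by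
    filter_upwards [hnear] with w hw using dx_comp_discMap c hr.ne' (hd w hw)
  have hy : dy (f ∘ discMap c r hr.ne') =ᶠ[𝓝 z] fun w => r * (pd 1 f ∘ discMap c r hr.ne') w := by
    filter_upwards [hnear] with w hw using dy_comp_discMap c hr.ne' (hd w hw)
  have hc : ∀ i, DifferentiableAt ℝ (pd i f ∘ discMap c r hr.ne') z := fun i =>
    (hpd i).comp z (hasFDerivAt_discMap c hr.ne' z).differentiableAt
  rw [dx, dy, hx.fderiv_eq, hy.fderiv_eq, fderiv_const_mul (hc 0), fderiv_const_mul (hc 1)]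
  have h0 := dx_comp_discMap c hr.ne' (hpd 0)
  have h1 := dy_comp_discMap c hr.ne' (hpd 1)
  rw [dx] at h0
  rw [dy] at h1
  simp only [smul_apply, smul_eq_mul, h0, h1, lap]
  ring

theorem volume_lt_le_of_wnorm {f : E2 → ℝ} {S : Set E2} {N t : ℝ} (ht : 0 < t)
    (hN : wnorm 2 f S ≤ ENNReal.ofReal N) :
    volume {x ∈ S | t < |f x|} ≤ ENNReal.ofReal (N ^ 2 / t ^ 2) := by
  have h := (le_iSup (fun t : ℝ≥0 => (t : ℝ≥0∞) * (volume {x ∈ S | (t : ℝ) < |f x|}) ^ (1 / 2 : ℝ))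
    ⟨t, ht.le⟩).trans hN
  set V := volume {x ∈ S | t < |f x|} with hV
  replace h : ENNReal.ofReal t * V ^ (1 / 2 : ℝ) ≤ ENNReal.ofReal N := by
    rwa [ENNReal.ofReal, Real.toNNReal_of_nonneg ht.le]
  have h2 := ENNReal.rpow_le_rpow h (zero_le_two (α := ℝ))
  rw [ENNReal.mul_rpow_of_nonneg _ _ zero_le_two, ← ENNReal.rpow_mul,
    show (1 / 2 : ℝ) * 2 = 1 by norm_num, ENNReal.rpow_one, ENNReal.rpow_two, ENNReal.rpow_two,
    ← ENNReal.ofReal_pow ht.le] at h2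
  rw [ENNReal.ofReal_div_of_pos (by positivity), ENNReal.le_div_iff_mul_le
    (Or.inl (by simpa using ht.ne')) (Or.inl ENNReal.ofReal_ne_top), mul_comm]
  refine h2.trans ?_
  rcases le_total 0 N with h0 | h0
  · rw [ENNReal.ofReal_pow h0]
  · rw [ENNReal.ofReal_of_nonpos h0]; simp

theorem isWenteData_comp_discMap {c : E2} {r : ℝ} (hr : 0 < r) {a b φ : E2 → ℝ} {N : ℝ}
    (hN : 0 < N) (ha : ContDiffOn ℝ ∞ a (ball c r)) (hb : ContDiffOn ℝ ∞ b (ball c r))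
    (hφ : ContDiffOn ℝ ∞ φ (ball c r)) (hφc : ContinuousOn φ (closedBall c r))
    (haN : wnorm 2 (fun x => ‖fderiv ℝ a x‖) (ball c r) ≤ ENNReal.ofReal N)
    (heq : ∀ x ∈ ball c r, lap φ x = pd 0 a x * pd 1 b x - pd 1 a x * pd 0 b x)
    (h0 : ∀ x ∈ sphere c r, φ x = 0) :
    IsWenteData N (a ∘ discMap c r hr.ne') (b ∘ discMap c r hr.ne') (φ ∘ discMap c r hr.ne') := by
  have hmaps : MapsTo (discMap c r hr.ne') (ball 0 1) (ball c r) := fun z hz =>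
    (discMap_mem_ball c hr).2 hz
  have hL := (contDiff_discMap c hr.ne').contDiffOn (s := ball (0 : ℂ) 1)
  have hd : ∀ {f : E2 → ℝ}, ContDiffOn ℝ ∞ f (ball c r) → ∀ z ∈ ball (0 : ℂ) 1,
      DifferentiableAt ℝ f (discMap c r hr.ne' z) := fun hf z hz =>
    (hf.differentiableOn (by simp)).differentiableAt (isOpen_ball.mem_nhds (hmaps hz))
  refine ⟨hN, ha.comp hL hmaps, hb.comp hL hmaps, hφ.comp hL hmaps,
    hφc.comp (discMap c r hr.ne').continuous.continuousOn fun z hz =>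
      (discMap_mem_closedBall c hr).2 hz, fun z hz => ?_, fun z hz => ?_, fun t ht => ?_⟩
  · exact h0 _ (by rw [mem_sphere, dist_discMap c hr, hz, mul_one])
  · rw [laplacian_comp_discMap c hr hφ hz, heq _ (hmaps hz), jac,
      dx_comp_discMap c hr.ne' (hd ha z hz), dy_comp_discMap c hr.ne' (hd ha z hz),
      dx_comp_discMap c hr.ne' (hd hb z hz), dy_comp_discMap c hr.ne' (hd hb z hz)]
    ring
  · have hset : {z ∈ ball (0 : ℂ) 1 | t < ‖fderiv ℝ (a ∘ discMap c r hr.ne') z‖} =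
        discMap c r hr.ne' ⁻¹' {x ∈ ball c r | t / r < |‖fderiv ℝ a x‖|} := by
      ext z
      simp only [mem_ofPred_eq, mem_preimage, discMap_mem_ball c hr, abs_norm]
      refine and_congr_right fun hz => ?_
      rw [norm_fderiv_comp_discMap c hr (hd ha z hz), div_lt_iff₀ hr, mul_comm]
    have hV := volume_lt_le_of_wnorm (t := t / r) (by positivity) haN
    rw [hset, ← (discMap c r hr.ne').measurableEmbedding.map_apply, map_discMap_volume,
      Measure.smul_apply, smul_eq_mul]
    refine (mul_le_mul_right hV _).trans_eq ?_
    rw [← ENNReal.ofReal_mul (by positivity)]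
    congr 1
    field_simp

theorem setLIntegral_norm_fderiv_comp_discMap {c : E2} {r : ℝ} (hr : 0 < r) {f : E2 → ℝ}
    (hf : ContDiffOn ℝ ∞ f (ball c r)) (p : ℝ) :
    ∫⁻ z in ball (0 : ℂ) 1, ENNReal.ofReal (‖fderiv ℝ (f ∘ discMap c r hr.ne') z‖ ^ p) =
      ENNReal.ofReal ((r ^ 2)⁻¹ * r ^ p) *
        ∫⁻ x in ball c r, ENNReal.ofReal (‖fderiv ℝ f x‖ ^ p) := by
  rw [ENNReal.ofReal_mul (by positivity), mul_assoc,
    ← lintegral_const_mul' _ _ ENNReal.ofReal_ne_top, ← setLIntegral_discMap c hr]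
  refine setLIntegral_congr_fun measurableSet_ball fun z hz => ?_
  have hd : DifferentiableAt ℝ f (discMap c r hr.ne' z) :=
    (hf.differentiableOn (by simp)).differentiableAt
      (isOpen_ball.mem_nhds ((discMap_mem_ball c hr).2 hz))
  simp only [norm_fderiv_comp_discMap c hr hd, Real.mul_rpow hr.le (norm_nonneg _),
    ENNReal.ofReal_mul (Real.rpow_nonneg hr.le p)]

theorem setIntegral_rpow_eq_toReal {c : E2} {r p : ℝ} {f : E2 → ℝ}
    (hf : ContDiffOn ℝ ∞ f (ball c r)) (hp : 0 ≤ p) :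
    ∫ x in ball c r, ‖fderiv ℝ f x‖ ^ p =
      (∫⁻ x in ball c r, ENNReal.ofReal (‖fderiv ℝ f x‖ ^ p)).toReal :=
  integral_eq_lintegral_of_nonneg_ae (Eventually.of_forall fun x => by positivity)
    (((hf.continuousOn_fderiv_of_isOpen isOpen_ball (by simp)).norm.rpow_const
      fun _ _ => Or.inr hp).aestronglyMeasurable measurableSet_ball)

/-- The Wente estimate on an arbitrary disc, for every `N` above the weak `L²` norm. -/
theorem rpow_setIntegral_le_of_unitDisc {C p : ℝ} (hC : 0 < C) (hp : 1 < p)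
    (hdisc : ∀ (N : ℝ) (a b φ : ℂ → ℝ), IsWenteData N a b φ →
      ∫⁻ z in ball (0 : ℂ) 1, ENNReal.ofReal (‖fderiv ℝ b z‖ ^ p) ≠ ⊤ →
      ∫⁻ z in ball (0 : ℂ) 1, ENNReal.ofReal (‖fderiv ℝ φ z‖ ^ p) ≤
        ENNReal.ofReal ((C * N) ^ p) *
          ∫⁻ z in ball (0 : ℂ) 1, ENNReal.ofReal (‖fderiv ℝ b z‖ ^ p))
    {c : E2} {r : ℝ} (hr : 0 < r) {a b φ : E2 → ℝ} {N : ℝ}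
    (hN : 0 < N) (ha : ContDiffOn ℝ ∞ a (ball c r)) (hb : ContDiffOn ℝ ∞ b (ball c r))
    (hφ : ContDiffOn ℝ ∞ φ (ball c r)) (hφc : ContinuousOn φ (closedBall c r))
    (haN : wnorm 2 (fun x => ‖fderiv ℝ a x‖) (ball c r) ≤ ENNReal.ofReal N)
    (hbp : IntegrableOn (fun x => ‖fderiv ℝ b x‖ ^ p) (ball c r))
    (heq : ∀ x ∈ ball c r, lap φ x = pd 0 a x * pd 1 b x - pd 1 a x * pd 0 b x)
    (h0 : ∀ x ∈ sphere c r, φ x = 0) :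
    (∫ x in ball c r, ‖fderiv ℝ φ x‖ ^ p) ^ (1 / p) ≤
      C * N * (∫ x in ball c r, ‖fderiv ℝ b x‖ ^ p) ^ (1 / p) := by
  have hp0 : 0 < p := by linarith
  have hbtop : ∫⁻ x in ball c r, ENNReal.ofReal (‖fderiv ℝ b x‖ ^ p) ≠ ⊤ := by
    rw [← ofReal_integral_eq_lintegral_ofReal hbp (Eventually.of_forall fun x => by positivity)]
    exact ENNReal.ofReal_ne_top
  have h := hdisc N _ _ _ (isWenteData_comp_discMap hr hN ha hb hφ hφc haN heq h0)
    (by rw [setLIntegral_norm_fderiv_comp_discMap hr hb]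
        exact ENNReal.mul_ne_top ENNReal.ofReal_ne_top hbtop)
  have hk : 0 < (r ^ 2)⁻¹ * r ^ p := by positivity
  rw [setLIntegral_norm_fderiv_comp_discMap hr hb, setLIntegral_norm_fderiv_comp_discMap hr hφ,
    mul_left_comm, ENNReal.mul_le_mul_iff_right (by simpa using hk) ENNReal.ofReal_ne_top] at h
  have h' := ENNReal.toReal_mono (ENNReal.mul_ne_top ENNReal.ofReal_ne_top hbtop) h
  rw [ENNReal.toReal_mul, ENNReal.toReal_ofReal (by positivity),
    ← setIntegral_rpow_eq_toReal hφ hp0.le, ← setIntegral_rpow_eq_toReal hb hp0.le] at h'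
  have hφ0 : 0 ≤ ∫ x in ball c r, ‖fderiv ℝ φ x‖ ^ p := integral_nonneg fun x => by positivity
  have hb0 : 0 ≤ ∫ x in ball c r, ‖fderiv ℝ b x‖ ^ p := integral_nonneg fun x => by positivity
  refine (Real.rpow_le_rpow hφ0 h' (by positivity)).trans_eq ?_
  rw [Real.mul_rpow (by positivity) hb0, ← Real.rpow_mul (by positivity),
    mul_one_div_cancel hp0.ne', Real.rpow_one]

end WenteDisk

end

/-- Wente-type estimate: if `Δφ = ∇^⊥a·∇b` on a disk with zero boundary data,
`∇a ∈ L^{2,∞}` and `∇b ∈ L^p`, then `‖∇φ‖_{L^p} ≤ C_p ‖∇a‖_{L^{2,∞}} ‖∇b‖_{L^p}`,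
with a constant uniform on compact subintervals `[p₀,p₁] ⊂ (1,∞)`. -/
theorem wente_weakL2_Lp (p₀ p₁ : ℝ) (hp₀ : 1 < p₀) (hp₁ : p₀ ≤ p₁) :
    ∃ C > (0:ℝ), ∀ p ∈ Set.Icc p₀ p₁, ∀ (c : E2) (r : ℝ), 0 < r →
      ∀ a b φ : E2 → ℝ,
      ContDiffOn ℝ (⊤ : ℕ∞) a (ball c r) → ContDiffOn ℝ (⊤ : ℕ∞) b (ball c r) →
      ContDiffOn ℝ (⊤ : ℕ∞) φ (ball c r) → ContinuousOn φ (closedBall c r) →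
      wnorm 2 (fun x => ‖fderiv ℝ a x‖) (ball c r) ≠ ⊤ →
      IntegrableOn (fun x => ‖fderiv ℝ b x‖ ^ p) (ball c r) →
      (∀ x ∈ ball c r, lap φ x = pd 0 a x * pd 1 b x - pd 1 a x * pd 0 b x) →
      (∀ x ∈ sphere c r, φ x = 0) →
      (∫ x in ball c r, ‖fderiv ℝ φ x‖ ^ p) ^ (1 / p) ≤
        C * (wnorm 2 (fun x => ‖fderiv ℝ a x‖) (ball c r)).toReal *
          (∫ x in ball c r, ‖fderiv ℝ b x‖ ^ p) ^ (1 / p) := by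
  obtain ⟨C, hC, hdisc⟩ := WenteDisk.exists_unitDisc_bound p₁ hp₀
  refine ⟨C, hC, fun p hp c r hr a b φ ha hb hφ hφc haN hbp heq h0 => ?_⟩
  have hB : 0 ≤ (∫ x in ball c r, ‖fderiv ℝ b x‖ ^ p) ^ (1 / p) :=
    Real.rpow_nonneg (integral_nonneg fun x => by positivity) _
  set B := (∫ x in ball c r, ‖fderiv ℝ b x‖ ^ p) ^ (1 / p)
  set W := wnorm 2 (fun x => ‖fderiv ℝ a x‖) (ball c r)
  refine le_of_forall_pos_le_add fun δ hδ => ?_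
  have hden : 0 < C * B + 1 := by positivity
  have hε : 0 < δ / (C * B + 1) := by positivity
  have hW : W ≤ ENNReal.ofReal (W.toReal + δ / (C * B + 1)) := by
    rw [ENNReal.le_ofReal_iff_toReal_le haN (by positivity)]
    linarith
  refine (WenteDisk.rpow_setIntegral_le_of_unitDisc hC (hp₀.trans_le hp.1)
    (fun N a b φ => hdisc p hp N a b φ) hr (by positivity) ha hb hφ hφc hW hbp heq h0).trans ?_
  have : C * B * (δ / (C * B + 1)) ≤ δ := by
    rw [mul_div_assoc', div_le_iff₀ hden]
    nlinarith
  linarith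

end
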